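/- Let w = e^{−Q} be a Freud weight on ℝ: Q even, three times continuously differentiable, Q' > 0 on (0,∞), 2 ≤ A ≤ (x·Q'(x))'/Q'(x) ≤ B on (0,∞), and |x·Q'''(x)/Q''(x)| ≤ c for |x| ≥ 1; let d ≥ 1 be such that Q''(x) ≥ (1 − (B−1)² − c(B−1))/x² for |x| ≥ d. Let \tilde{w} : ℝ → ℝ be an even, positive, twice continuously differentiable weight with \tilde{w}(x) = w(x) for |x| ≤ 1 and \tilde{w}(x) = w(x)·|x|/Q'(|x|) for |x| ≥ d, such that log(1/\tilde{w}) has positive continuous first and second derivatives on (0,∞). For each n let x_{1,n} < … < x_{n,n} be the zeros of the n-th orthonormal polynomial p_n with respect to w, and l_{k,n}(x) = ∏_{l≠k}(x − x_{l,n})/(x_{k,n} − x_{l,n}) the fundamental Lagrange polynomials. Then there is a constant C such that for all n and all x ∈ ℝ: \tilde{w}(x)·∑_{k=1}^n l_{k,n}(x)²/\tilde{w}(x_{k,n}) ≤ C, i.e. the norms of the weighted Grünwald operators Y_{n,\tilde{w}} are uniformly bounded. -/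

import Mathlib

section
namespace GW
open MeasureTheory Real Set

structure Fr where
  Q : ℝ → ℝ
  Q1 : ℝ → ℝ
  Q2 : ℝ → ℝ
  Q3 : ℝ → ℝ
  D : ℕ
  c : ℝ
  hD : 2 ≤ D
  hc : 0 ≤ c
  even : ∀ x, Q (-x) = Q x
  d1 : ∀ x, HasDerivAt Q (Q1 x) x
  d2 : ∀ x, HasDerivAt Q1 (Q2 x) x
  d3 : ∀ x, HasDerivAt Q2 (Q3 x) x
  pos : ∀ x, 0 < x → 0 < Q1 x
  lo : ∀ x, 0 < x → Q1 x ≤ x * Q2 x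
  hi : ∀ x, 0 < x → x * Q2 x ≤ ((D:ℝ) - 1) * Q1 x
  hc3 : ∀ x, 1 ≤ x → |x * Q3 x| ≤ c * Q2 x

namespace Fr
variable (F : Fr)

noncomputable def R (t : ℝ) : ℝ := t * F.Q1 t
noncomputable def q (t : ℝ) : ℝ := F.Q1 t / t

lemma cQ : Continuous F.Q := continuous_iff_continuousAt.2 fun x => (F.d1 x).continuousAt
lemma cQ1 : Continuous F.Q1 := continuous_iff_continuousAt.2 fun x => (F.d2 x).continuousAt
lemma cQ2 : Continuous F.Q2 := continuous_iff_continuousAt.2 fun x => (F.d3 x).continuousAt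
lemma cR : Continuous F.R := continuous_id.mul F.cQ1

lemma Q1_neg (x : ℝ) : F.Q1 (-x) = - F.Q1 x := by
  have h1 : HasDerivAt (fun y => F.Q (-y)) (-F.Q1 (-x)) x := by
    exact ((F.d1 (-x)).comp x (hasDerivAt_neg x)).congr_deriv (by ring)
  have h2 : (fun y => F.Q (-y)) = F.Q := funext F.even
  rw [h2] at h1
  have := h1.unique (F.d1 x)
  linarith

lemma Q1_zero : F.Q1 0 = 0 := by
  have := F.Q1_neg 0
  simp at this; linarith

lemma Q2_neg (x : ℝ) : F.Q2 (-x) = F.Q2 x := by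
  have h1 : HasDerivAt (fun y => F.Q1 (-y)) (-F.Q2 (-x)) x := by
    exact ((F.d2 (-x)).comp x (hasDerivAt_neg x)).congr_deriv (by ring)
  have h2 : (fun y => F.Q1 (-y)) = fun y => - F.Q1 y := funext F.Q1_neg
  rw [h2] at h1
  have := h1.unique (F.d2 x).neg
  linarith

lemma Q2_pos {x : ℝ} (hx : 0 < x) : 0 < F.Q2 x := by
  have := F.lo x hx
  have := F.pos x hx
  by_contra h
  push Not at h
  nlinarith

lemma Q2_pos' {x : ℝ} (hx : x ≠ 0) : 0 < F.Q2 x := by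
  rcases lt_or_gt_of_ne hx with h | h
  · rw [← F.Q2_neg]; exact F.Q2_pos (by linarith)
  · exact F.Q2_pos h

lemma Q2_nonneg (x : ℝ) : 0 ≤ F.Q2 x := by
  by_cases hx : x = 0
  · subst hx
    have : (0:ℝ) ∈ closure (Ioi (0:ℝ)) := by rw [closure_Ioi]; simp
    have h2 : closure (Ioi (0:ℝ)) ⊆ {x | 0 ≤ F.Q2 x} :=
      closure_minimal (fun x hx => (F.Q2_pos hx).le) (isClosed_le continuous_const F.cQ2)
    exact h2 this
  · exact (F.Q2_pos' hx).le

lemma Q1_mono : StrictMono F.Q1 := by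
  have h : Monotone F.Q1 := by
    apply monotone_of_deriv_nonneg (fun x => (F.d2 x).differentiableAt)
    intro x; rw [(F.d2 x).deriv]; exact F.Q2_nonneg x
  have h1 : StrictMonoOn F.Q1 (Ici 0) := by
    apply strictMonoOn_of_deriv_pos (convex_Ici 0) F.cQ1.continuousOn
    intro x hx
    rw [interior_Ici] at hx
    rw [(F.d2 x).deriv]; exact F.Q2_pos hx
  intro x y hxy
  rcases le_or_gt 0 x with h0 | h0
  · exact h1 h0 (h0.trans hxy.le) hxy
  · rcases le_or_gt y 0 with h2 | h2
    · have := h1 (a := -y) (b := -x) (by simpa using h2) (by simpa using h0.le) (by linarith)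
      rw [F.Q1_neg, F.Q1_neg] at this; linarith
    · have a1 := F.pos y h2
      have a2 := F.pos (-x) (by linarith)
      rw [F.Q1_neg] at a2; linarith

lemma R_neg (t : ℝ) : F.R (-t) = F.R t := by simp [R, F.Q1_neg]
lemma q_neg (t : ℝ) : F.q (-t) = F.q t := by simp [q, F.Q1_neg]
lemma R_pos {t : ℝ} (ht : 0 < t) : 0 < F.R t := mul_pos ht (F.pos t ht)
lemma q_pos {t : ℝ} (ht : 0 < t) : 0 < F.q t := div_pos (F.pos t ht) ht
lemma R_zero : F.R 0 = 0 := by simp [R]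
lemma q_zero : F.q 0 = 0 := by simp [q]
lemma R_abs (t : ℝ) : F.R |t| = F.R t := by
  rcases abs_choice t with h | h <;> rw [h]; exact F.R_neg t
lemma q_abs (t : ℝ) : F.q |t| = F.q t := by
  rcases abs_choice t with h | h <;> rw [h]; exact F.q_neg t
lemma Q_abs (t : ℝ) : F.Q |t| = F.Q t := by
  rcases abs_choice t with h | h <;> rw [h]; exact F.even t
lemma Q1_abs (t : ℝ) : F.Q1 |t| = |F.Q1 t| := by
  rcases le_total 0 t with h | h
  · rw [abs_of_nonneg h, abs_of_nonneg]
    rw [← F.Q1_zero]; exact F.Q1_mono.monotone h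
  · rw [abs_of_nonpos h, F.Q1_neg, abs_of_nonpos]
    rw [← F.Q1_zero]; exact F.Q1_mono.monotone h
lemma q_nonneg (t : ℝ) : 0 ≤ F.q t := by
  rw [← q_abs]
  rcases (abs_nonneg t).eq_or_lt with h | h
  · rw [← h, q_zero]
  · exact (F.q_pos h).le
lemma R_nonneg (t : ℝ) : 0 ≤ F.R t := by
  rw [← R_abs]
  rcases (abs_nonneg t).eq_or_lt with h | h
  · rw [← h, R_zero]
  · exact (F.R_pos h).le
lemma q_mul_self (t : ℝ) : F.q t * t = F.Q1 t := by
  by_cases h : t = 0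
  · subst h; simp [F.Q1_zero]
  · simp [q, h]
lemma q_mul_sq (t : ℝ) : F.q t * t^2 = F.R t := by
  rw [sq, ← mul_assoc, q_mul_self, R, mul_comm]

lemma q_mono {s t : ℝ} (hs : 0 < s) (hst : s ≤ t) : F.q s ≤ F.q t := by
  have : MonotoneOn F.q (Ioi 0) := by
    apply monotoneOn_of_deriv_nonneg (convex_Ioi 0)
    · exact F.cQ1.continuousOn.div continuousOn_id (fun x hx => ne_of_gt hx)
    · intro x hx
      rw [interior_Ioi] at hx
      exact ((F.d2 x).div (hasDerivAt_id x) (ne_of_gt hx)).differentiableAt.differentiableWithinAt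
    · intro x hx
      rw [interior_Ioi] at hx
      have h := ((F.d2 x).div (hasDerivAt_id x) (ne_of_gt hx)).deriv
      have h2 : deriv F.q x = deriv (F.Q1 / id) x := rfl
      rw [h2, h]
      have := F.lo x hx
      apply div_nonneg _ (sq_nonneg _)
      simp; linarith
  exact this hs (lt_of_lt_of_le hs hst) hst

lemma q_mono' {s t : ℝ} (hst : |s| ≤ |t|) : F.q s ≤ F.q t := by
  rw [← F.q_abs s, ← F.q_abs t]
  rcases (abs_nonneg s).eq_or_lt with h | h
  · rw [← h, q_zero]; exact F.q_nonneg _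
  · exact F.q_mono h hst

lemma R_lower {s t : ℝ} (hs : 0 < s) (hst : s ≤ t) : (t/s)^2 * F.R s ≤ F.R t := by
  rw [← q_mul_sq, ← q_mul_sq]
  have := F.q_mono hs hst
  have e : (t/s)^2 * (F.q s * s^2) = F.q s * t^2 := by field_simp
  rw [e]; gcongr

lemma Q1_upper {s t : ℝ} (hs : 0 < s) (hst : s ≤ t) : F.Q1 t ≤ (t/s)^(F.D-1) * F.Q1 s := by
  have ht := lt_of_lt_of_le hs hst
  have : AntitoneOn (fun x => F.Q1 x / x^(F.D-1)) (Ioi 0) := by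
    apply antitoneOn_of_deriv_nonpos (convex_Ioi 0)
    · exact F.cQ1.continuousOn.div (by fun_prop) (fun x hx => (pow_pos hx _).ne')
    · intro x hx
      rw [interior_Ioi] at hx
      exact ((F.d2 x).div (hasDerivAt_pow (F.D-1) x) (pow_pos hx _).ne').differentiableAt.differentiableWithinAt
    · intro x hx
      rw [interior_Ioi] at hx
      have h := ((F.d2 x).div (hasDerivAt_pow (F.D-1) x) (pow_pos hx _).ne').deriv
      have h2 : deriv (fun x => F.Q1 x / x^(F.D-1)) x = deriv (F.Q1 / fun x => x^(F.D-1)) x := rfl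
      rw [h2, h]
      have := F.hi x hx
      apply div_nonpos_of_nonpos_of_nonneg _ (sq_nonneg _)
      obtain ⟨m, hm⟩ : ∃ m, F.D = m + 2 := ⟨F.D - 2, by have := F.hD; omega⟩
      rw [hm] at this ⊢
      simp only [show m + 2 - 1 = m + 1 by omega, show m + 1 - 1 = m by omega]
      push_cast at this ⊢
      have hx' : (0:ℝ) < x := hx
      have : 0 ≤ x^m * ((↑m + 2 - 1) * F.Q1 x - x * F.Q2 x) := by
        apply mul_nonneg (by positivity); linarith
      rw [pow_succ]; nlinarith
  have h := this (a := s) (b := t) hs ht hst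
  simp only at h
  rw [div_le_iff₀ (pow_pos ht _)] at h
  rw [div_pow]
  calc F.Q1 t ≤ _ := h
    _ = _ := by ring

lemma R_upper {s t : ℝ} (hs : 0 < s) (hst : s ≤ t) : F.R t ≤ (t/s)^F.D * F.R s := by
  have h := F.Q1_upper hs hst
  have ht := lt_of_lt_of_le hs hst
  obtain ⟨m, hm⟩ : ∃ m, F.D = m + 1 := ⟨F.D - 1, by have := F.hD; omega⟩
  rw [hm] at h ⊢
  simp only [show m + 1 - 1 = m by omega] at h
  have e : (t/s)^(m+1) * F.R s = t * ((t/s)^m * F.Q1 s) := by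
    rw [R, pow_succ]; field_simp
  rw [e, R]; gcongr

lemma R_mono {s t : ℝ} (hst : |s| ≤ |t|) : F.R s ≤ F.R t := by
  rw [← q_mul_sq, ← q_mul_sq]
  have := F.q_mono' hst
  have h2 : s^2 ≤ t^2 := sq_le_sq.2 hst
  exact mul_le_mul this h2 (sq_nonneg _) (F.q_nonneg _)

lemma Q_mono {s t : ℝ} (hst : |s| ≤ |t|) : F.Q s ≤ F.Q t := by
  rw [← F.Q_abs s, ← F.Q_abs t]
  have : MonotoneOn F.Q (Ici 0) := by
    apply monotoneOn_of_deriv_nonneg (convex_Ici 0) F.cQ.continuousOn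
    · intro x _; exact (F.d1 x).differentiableAt.differentiableWithinAt
    · intro x hx
      rw [interior_Ici] at hx
      rw [(F.d1 x).deriv]; exact (F.pos x hx).le
  exact this (abs_nonneg s) (abs_nonneg t) hst

lemma Q_tangent (x t : ℝ) : F.Q x + F.Q1 x * (t - x) ≤ F.Q t := by
  have h : ∀ y, HasDerivAt (fun y => F.Q y - F.Q1 x * y) (F.Q1 y - F.Q1 x) y := by
    intro y
    exact ((F.d1 y).sub ((hasDerivAt_id y).const_mul (F.Q1 x))).congr_deriv (by ring)
  rcases le_total x t with hxt | hxt
  · have : MonotoneOn (fun y => F.Q y - F.Q1 x * y) (Ici x) := by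
      apply monotoneOn_of_deriv_nonneg (convex_Ici x)
      · intro y _; exact (h y).continuousAt.continuousWithinAt
      · intro y _; exact (h y).differentiableAt.differentiableWithinAt
      · intro y hy
        rw [interior_Ici] at hy
        rw [(h y).deriv]; have := F.Q1_mono hy; linarith
    have := this (mem_Ici.2 le_rfl) (mem_Ici.2 hxt) hxt
    simp only at this; linarith
  · have : AntitoneOn (fun y => F.Q y - F.Q1 x * y) (Iic x) := by
      apply antitoneOn_of_deriv_nonpos (convex_Iic x)
      · intro y _; exact (h y).continuousAt.continuousWithinAt
      · intro y _; exact (h y).differentiableAt.differentiableWithinAt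
      · intro y hy
        rw [interior_Iic] at hy
        rw [(h y).deriv]; have := F.Q1_mono hy; linarith
    have := this (mem_Iic.2 hxt) (mem_Iic.2 le_rfl) hxt
    simp only at this; linarith

lemma Q_log_lower {s t : ℝ} (hs : 0 < s) (hst : s ≤ t) : F.R s * log (t/s) ≤ F.Q t - F.Q s := by
  have h : ∀ y ∈ Ici s, HasDerivAt (fun y => F.Q y - F.R s * log y) (F.Q1 y - F.R s * y⁻¹) y := by
    intro y hy
    have hy' : y ≠ 0 := (lt_of_lt_of_le hs hy).ne'
    exact (F.d1 y).sub ((hasDerivAt_log hy').const_mul (F.R s))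
  have : MonotoneOn (fun y => F.Q y - F.R s * log y) (Ici s) := by
    apply monotoneOn_of_deriv_nonneg (convex_Ici s)
    · intro y hy; exact (h y hy).continuousAt.continuousWithinAt
    · intro y hy; exact (h y (interior_subset hy)).differentiableAt.differentiableWithinAt
    · intro y hy
      rw [(h y (interior_subset hy)).deriv]
      rw [interior_Ici] at hy
      have hy0 : 0 < y := lt_trans hs hy
      have h1 := F.R_mono (s := s) (t := y) (by rw [abs_of_pos hs, abs_of_pos hy0]; exact le_of_lt hy)
      have : F.R s * y⁻¹ ≤ F.R y * y⁻¹ := by gcongr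
      have e : F.R y * y⁻¹ = F.Q1 y := by rw [R]; field_simp
      linarith
  have := this (mem_Ici.2 le_rfl) (mem_Ici.2 hst) hst
  simp only at this
  rw [log_div (lt_of_lt_of_le hs hst).ne' hs.ne']
  linarith

lemma Q_quad {s t : ℝ} (hs : 0 < s) (hst : s ≤ |t|) : F.R s / 2 * ((t/s)^2 - 1) ≤ F.Q t - F.Q s := by
  have key : ∀ t, s ≤ t → F.R s / 2 * ((t/s)^2 - 1) ≤ F.Q t - F.Q s := by
    intro t hst
    have h : ∀ y, HasDerivAt (fun y => F.Q y - F.q s / 2 * y^2) (F.Q1 y - F.q s * y) y := by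
      intro y
      exact ((F.d1 y).sub ((hasDerivAt_pow 2 y).const_mul (F.q s / 2))).congr_deriv (by push_cast; ring)
    have : MonotoneOn (fun y => F.Q y - F.q s / 2 * y^2) (Ici s) := by
      apply monotoneOn_of_deriv_nonneg (convex_Ici s)
      · intro y hy; exact (h y).continuousAt.continuousWithinAt
      · intro y hy; exact (h y).differentiableAt.differentiableWithinAt
      · intro y hy
        rw [(h y).deriv]
        rw [interior_Ici] at hy
        have hy0 : 0 < y := lt_trans hs hy
        have h1 := F.q_mono hs (le_of_lt hy)
        have : F.q s * y ≤ F.q y * y := by gcongr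
        rw [F.q_mul_self] at this
        linarith
    have := this (mem_Ici.2 le_rfl) (mem_Ici.2 hst) hst
    simp only at this
    have e : F.R s / 2 * ((t/s)^2 - 1) = F.q s / 2 * t^2 - F.q s / 2 * s^2 := by
      rw [← q_mul_sq]; field_simp
    rw [e]; linarith
  have := key |t| hst
  rwa [div_pow, sq_abs, ← div_pow, Q_abs] at this

lemma conv1 (t x : ℝ) : (t-x)^2 * F.q t / 2 ≤ (t - x) * (F.Q1 t - F.Q1 x) := by
  rw [← F.q_mul_self t, ← F.q_mul_self x]
  have ht := F.q_nonneg t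
  have hx := F.q_nonneg x
  rcases le_total |t| |x| with h | h
  · have := F.q_mono' h
    have h2 : t^2 ≤ x^2 := sq_le_sq.2 h
    nlinarith [mul_nonneg hx (sq_nonneg (t-x)), mul_nonneg (sub_nonneg.2 this) (sub_nonneg.2 h2), mul_nonneg ht (sq_nonneg (t-x)), mul_nonneg (sub_nonneg.2 this) (sq_nonneg (t-x))]
  · have := F.q_mono' h
    have h2 : x^2 ≤ t^2 := sq_le_sq.2 h
    nlinarith [mul_nonneg hx (sq_nonneg (t-x)), mul_nonneg (sub_nonneg.2 this) (sub_nonneg.2 h2), mul_nonneg ht (sq_nonneg (t-x)), mul_nonneg (sub_nonneg.2 this) (sq_nonneg (t-x))]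

lemma conv2 (t x : ℝ) : (t-x)^2 * F.q x / 2 ≤ (t - x) * (F.Q1 t - F.Q1 x) := by
  have := F.conv1 x t
  nlinarith

lemma conv0 (t x : ℝ) : 0 ≤ (t - x) * (F.Q1 t - F.Q1 x) := by
  have := F.conv1 t x
  have := F.q_nonneg t
  have : 0 ≤ (t-x)^2 * F.q t / 2 := by positivity
  linarith

lemma exists_a {y : ℝ} (hy : 0 < y) : ∃ a, 0 < a ∧ F.R a = y := by
  have h1 := F.R_pos one_pos
  obtain ⟨T, hT1, hT⟩ : ∃ T, 1 ≤ T ∧ y ≤ F.R T := by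
    refine ⟨1 + y / F.R 1, by have : 0 < y / F.R 1 := by positivity
                              linarith, ?_⟩
    have hp : 0 < y / F.R 1 := by positivity
    have := F.R_lower one_pos (t := 1 + y / F.R 1) (by linarith)
    refine le_trans ?_ this
    have : y = y / F.R 1 * F.R 1 := by field_simp
    calc y = y / F.R 1 * F.R 1 := this
      _ ≤ _ := by
        gcongr; simp; nlinarith
  have hivt := intermediate_value_Icc (by linarith : (0:ℝ) ≤ T) (F.cR.continuousOn)
  obtain ⟨a, ha, hRa⟩ := hivt ⟨by rw [R_zero]; exact hy.le, hT⟩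
  refine ⟨a, ?_, hRa⟩
  rcases ha.1.eq_or_lt with h | h
  · rw [← h, R_zero] at hRa; linarith
  · exact h

lemma Q_growth (t : ℝ) : F.Q 0 + F.Q1 1 / 2 * (t^2 - 1) ≤ F.Q t := by
  have h1 := F.pos 1 one_pos
  rcases le_total 1 |t| with h | h
  · have := F.Q_quad one_pos h
    have h0 := F.Q_mono (s := 0) (t := 1) (by simp)
    simp [R] at this
    linarith
  · have h0 := F.Q_mono (s := 0) (t := t) (by simp)
    have : t^2 ≤ 1 := by rw [← sq_abs]; nlinarith [abs_nonneg t]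
    nlinarith

end Fr
end GW
end

section
namespace GW
open MeasureTheory Real Set Polynomial

@[fun_prop]
def PG (f : ℝ → ℝ) : Prop := Measurable f ∧ ∃ C : ℝ, ∃ m : ℕ, 0 ≤ C ∧ ∀ t, |f t| ≤ C * (1 + t^2)^m

namespace PG
lemma le1 (t : ℝ) : 1 ≤ 1 + t^2 := by nlinarith [sq_nonneg t]

@[fun_prop] lemma const (c : ℝ) : PG (fun _ => c) :=
  ⟨measurable_const, |c|, 0, abs_nonneg c, fun t => by simp⟩
@[fun_prop] lemma id : PG (fun t : ℝ => t) :=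
  ⟨measurable_id, 1, 1, zero_le_one, fun t => by
    rw [abs_le]; constructor <;> nlinarith [sq_nonneg (t-1), sq_nonneg (t+1)]⟩
@[fun_prop] lemma add {f g : ℝ → ℝ} (hf : PG f) (hg : PG g) : PG (fun t => f t + g t) := by
  obtain ⟨mf, C, m, hC, hf⟩ := hf
  obtain ⟨mg, C', m', hC', hg⟩ := hg
  refine ⟨mf.add mg, C + C', m + m', by positivity, fun t => ?_⟩
  have h1 := le1 t
  have a1 : (1+t^2)^m ≤ (1+t^2)^(m+m') := pow_le_pow_right₀ h1 (by omega)
  have a2 : (1+t^2)^m' ≤ (1+t^2)^(m+m') := pow_le_pow_right₀ h1 (by omega)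
  calc |f t + g t| ≤ |f t| + |g t| := abs_add_le _ _
    _ ≤ C * (1+t^2)^m + C' * (1+t^2)^m' := add_le_add (hf t) (hg t)
    _ ≤ C * (1+t^2)^(m+m') + C' * (1+t^2)^(m+m') := by gcongr
    _ = _ := by ring
@[fun_prop] lemma mul {f g : ℝ → ℝ} (hf : PG f) (hg : PG g) : PG (fun t => f t * g t) := by
  obtain ⟨mf, C, m, hC, hf⟩ := hf
  obtain ⟨mg, C', m', hC', hg⟩ := hg
  refine ⟨mf.mul mg, C * C', m + m', by positivity, fun t => ?_⟩
  calc |f t * g t| = |f t| * |g t| := abs_mul _ _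
    _ ≤ (C * (1+t^2)^m) * (C' * (1+t^2)^m') := by
      gcongr
      · exact hf t
      · exact hg t
    _ = _ := by ring
@[fun_prop] lemma neg {f : ℝ → ℝ} (hf : PG f) : PG (fun t => - f t) := by
  have := (const (-1)).mul hf
  simpa using this
@[fun_prop] lemma sub {f g : ℝ → ℝ} (hf : PG f) (hg : PG g) : PG (fun t => f t - g t) := by
  simp only [sub_eq_add_neg]; exact hf.add hg.neg
@[fun_prop] lemma pow {f : ℝ → ℝ} (hf : PG f) (n : ℕ) : PG (fun t => f t ^ n) := by
  induction n with
  | zero => simp only [pow_zero]; exact const 1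
  | succ n ih => simp only [pow_succ]; exact ih.mul hf
@[fun_prop] lemma div_const {f : ℝ → ℝ} (hf : PG f) (c : ℝ) : PG (fun t => f t / c) := by
  simp only [div_eq_mul_inv]; exact hf.mul (const _)
@[fun_prop] lemma abs {f : ℝ → ℝ} (hf : PG f) : PG (fun t => |f t|) := by
  obtain ⟨mf, C, m, hC, hf⟩ := hf
  exact ⟨by fun_prop, C, m, hC, fun t => by rw [abs_abs]; exact hf t⟩
@[fun_prop] lemma sum {ι : Type*} (s : Finset ι) {f : ι → ℝ → ℝ} (hf : ∀ i, PG (f i)) :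
    PG (fun t => ∑ i ∈ s, f i t) := by
  classical
  induction s using Finset.induction_on with
  | empty => simp only [Finset.sum_empty]; exact const 0
  | insert a s ha ih => simp only [Finset.sum_insert ha]; exact (hf a).add ih
@[fun_prop] lemma poly (p : ℝ[X]) : PG (fun t => p.eval t) := by
  induction p using Polynomial.induction_on' with
  | add p q hp hq => simp only [eval_add]; exact hp.add hq
  | monomial n a => simp only [eval_monomial]; exact (const a).mul (id.pow n)
lemma of_le {f g : ℝ → ℝ} (hg : PG g) (hf : Measurable f) (h : ∀ t, |f t| ≤ g t) : PG f := by
  obtain ⟨mg, C, m, hC, hg⟩ := hg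
  exact ⟨hf, C, m, hC, fun t => (h t).trans ((le_abs_self _).trans (hg t))⟩
end PG

namespace Fr
variable (F : Fr)

noncomputable def w (t : ℝ) : ℝ := Real.exp (-(F.Q t))
lemma w_pos (t : ℝ) : 0 < F.w t := Real.exp_pos _
lemma w_cont : Continuous F.w := by unfold w; have := F.cQ; fun_prop
lemma w_neg (t : ℝ) : F.w (-t) = F.w t := by simp [w, F.even]

lemma q_bound (t : ℝ) : F.q t ≤ F.Q1 1 * (1 + t^2)^F.D := by
  have h1 := F.pos 1 one_pos
  rcases le_total |t| 1 with h | h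
  · have := F.q_mono' (s := t) (t := 1) (by simpa using h)
    have e : F.q 1 = F.Q1 1 := by simp [q]
    rw [e] at this
    have : (1:ℝ) ≤ (1+t^2)^F.D := one_le_pow₀ (PG.le1 t)
    nlinarith
  · have h0 : 0 < |t| := by linarith
    have := F.Q1_upper one_pos h
    have h2 : F.q t ≤ F.Q1 |t| := by
      rw [← F.q_abs, q]; exact div_le_self (F.pos _ h0).le h
    refine h2.trans (this.trans ?_)
    rw [mul_comm]
    gcongr
    rw [div_one]
    calc |t|^(F.D-1) ≤ |t|^(F.D) := pow_le_pow_right₀ h (by omega)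
      _ ≤ (1+t^2)^F.D := by
        gcongr
        rw [← sq_abs]; nlinarith

@[fun_prop] lemma pg_q : PG (fun t => F.q t) := by
  refine PG.of_le (g := fun t => F.Q1 1 * (1 + t^2)^F.D) (by fun_prop) ?_ ?_
  · unfold q; exact F.cQ1.measurable.div measurable_id
  · intro t; rw [abs_of_nonneg (F.q_nonneg t)]; exact F.q_bound t
@[fun_prop] lemma pg_Q1 : PG (fun t => F.Q1 t) := by
  have : PG (fun t => F.q t * t) := by fun_prop
  simpa only [F.q_mul_self] using this
@[fun_prop] lemma pg_R : PG (fun t => F.R t) := by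
  unfold R; fun_prop

lemma w_le (t : ℝ) : F.w t ≤ Real.exp (-F.Q 0 + F.Q1 1 / 2) * Real.exp (-(F.Q1 1 / 2) * t^2) := by
  rw [w, ← Real.exp_add]
  apply Real.exp_le_exp.2
  have := F.Q_growth t
  linarith

lemma integrable {f : ℝ → ℝ} (hf : PG f) : Integrable (fun t => f t * F.w t) := by
  obtain ⟨mf, C, m, hC, hf⟩ := hf
  set κ := F.Q1 1 / 2 with hκ
  have hκ0 : 0 < κ := by have := F.pos 1 one_pos; positivity
  have hg : Integrable (fun t : ℝ => (C * (m.factorial * (2/κ)^m * Real.exp (κ/2)) * Real.exp (-F.Q 0 + κ)) * Real.exp (-(κ/2) * t^2)) :=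
    (integrable_exp_neg_mul_sq (by positivity)).const_mul _
  refine hg.mono' (mf.mul F.w_cont.measurable).aestronglyMeasurable (Filter.Eventually.of_forall fun t => ?_)
  rw [norm_mul, norm_eq_abs, norm_eq_abs, abs_of_pos (F.w_pos t)]
  have h1 : (1+t^2)^m ≤ m.factorial * (2/κ)^m * Real.exp (κ/2 * (1 + t^2)) := by
    have := Real.pow_div_factorial_le_exp (κ/2 * (1+t^2)) (by positivity) m
    rw [div_le_iff₀ (by positivity), mul_pow] at this
    have e : (2/κ)^m * (κ/2)^m = 1 := by rw [← mul_pow]; field_simp; simp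
    calc (1+t^2)^m = ((2/κ)^m * (κ/2)^m) * (1+t^2)^m := by rw [e, one_mul]
      _ = (2/κ)^m * ((κ/2)^m * (1+t^2)^m) := by ring
      _ ≤ (2/κ)^m * (Real.exp (κ/2 * (1 + t^2)) * m.factorial) := by gcongr
      _ = _ := by ring
  calc |f t| * F.w t ≤ (C * (m.factorial * (2/κ)^m * Real.exp (κ/2 * (1 + t^2)))) * (Real.exp (-F.Q 0 + κ) * Real.exp (-κ * t^2)) := by
        apply mul_le_mul _ (F.w_le t) (F.w_pos t).le (by positivity)
        refine (hf t).trans ?_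
        gcongr
    _ = (C * (m.factorial * (2/κ)^m)) * Real.exp (-F.Q 0 + κ) * (Real.exp (κ/2 * (1 + t^2)) * Real.exp (-κ * t^2)) := by ring
    _ = (C * (m.factorial * (2/κ)^m)) * Real.exp (-F.Q 0 + κ) * (Real.exp (κ/2) * Real.exp (-(κ/2) * t^2)) := by
        rw [← Real.exp_add, ← Real.exp_add]; ring_nf
    _ = _ := by ring

noncomputable def I (f : ℝ → ℝ) : ℝ := ∫ t, f t * F.w t

variable {F}
lemma I_congr {f g : ℝ → ℝ} (h : ∀ t, f t = g t) : F.I f = F.I g := by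
  have : f = g := funext h
  rw [this]
lemma I_add {f g : ℝ → ℝ} (hf : PG f) (hg : PG g) : F.I (fun t => f t + g t) = F.I f + F.I g := by
  unfold I; rw [← integral_add (F.integrable hf) (F.integrable hg)]
  congr 1; ext t; ring
lemma I_sub {f g : ℝ → ℝ} (hf : PG f) (hg : PG g) : F.I (fun t => f t - g t) = F.I f - F.I g := by
  unfold I; rw [← integral_sub (F.integrable hf) (F.integrable hg)]
  congr 1; ext t; ring
lemma I_smul (c : ℝ) (f : ℝ → ℝ) : F.I (fun t => c * f t) = c * F.I f := by
  unfold I; rw [← integral_const_mul]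
  congr 1; ext t; ring
lemma I_sum {ι : Type*} (s : Finset ι) {f : ι → ℝ → ℝ} (hf : ∀ i, PG (f i)) :
    F.I (fun t => ∑ i ∈ s, f i t) = ∑ i ∈ s, F.I (f i) := by
  unfold I; rw [← integral_finsetSum _ (fun i _ => F.integrable (hf i))]
  congr 1; ext t; rw [Finset.sum_mul]
lemma I_mono {f g : ℝ → ℝ} (hf : PG f) (hg : PG g) (h : ∀ t, f t ≤ g t) : F.I f ≤ F.I g :=
  integral_mono (F.integrable hf) (F.integrable hg) fun t => mul_le_mul_of_nonneg_right (h t) (F.w_pos t).le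
lemma I_nonneg {f : ℝ → ℝ} (h : ∀ t, 0 ≤ f t) : 0 ≤ F.I f :=
  integral_nonneg fun t => mul_nonneg (h t) (F.w_pos t).le
lemma I_neg {f : ℝ → ℝ} : F.I (fun t => - f t) = - F.I f := by
  have := I_smul (F := F) (-1) f
  simpa using this
lemma I_flip (f : ℝ → ℝ) : F.I (fun t => f (-t)) = F.I f := by
  unfold I
  rw [← integral_neg_eq_self (fun t => f t * F.w t)]
  simp only [w_neg]
lemma I_odd {f : ℝ → ℝ} (h : ∀ t, f (-t) = - f t) : F.I f = 0 := by
  have h1 := I_flip (F := F) f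
  have : F.I (fun t => f (-t)) = - F.I f := by rw [← I_neg]; exact I_congr h
  linarith

lemma I_parts (p : ℝ[X]) : F.I (fun t => p.derivative.eval t) = F.I (fun t => p.eval t * F.Q1 t) := by
  have hw : ∀ t, HasDerivAt F.w (-(F.Q1 t) * F.w t) t := by
    intro t
    exact ((F.d1 t).neg.exp).congr_deriv (by simp only [w]; exact mul_comm _ _)
  have h := integral_eq_zero_of_hasDerivAt_of_integrable
    (f := fun t => p.eval t * F.w t) (f' := fun t => (p.derivative.eval t - p.eval t * F.Q1 t) * F.w t)
    (fun t => ((p.hasDerivAt t).mul (hw t)).congr_deriv (by ring))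
    (F.integrable (by fun_prop)) (F.integrable (by fun_prop))
  have h2 := I_sub (F := F) (f := fun t => p.derivative.eval t) (g := fun t => p.eval t * F.Q1 t) (by fun_prop) (by fun_prop)
  have h3 : F.I (fun t => p.derivative.eval t - p.eval t * F.Q1 t) = 0 := h
  linarith

lemma I_pos {p : ℝ[X]} (hp : p ≠ 0) : 0 < F.I (fun t => p.eval t ^ 2) := by
  have h0 : 0 ≤ F.I (fun t => p.eval t ^ 2) := I_nonneg fun t => sq_nonneg _
  rcases h0.lt_or_eq with h | h
  · exact h
  exfalso
  have hc : Continuous (fun t => p.eval t ^ 2 * F.w t) := by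
    have := F.w_cont; fun_prop
  have h2 := (integral_eq_zero_iff_of_nonneg (fun t => mul_nonneg (sq_nonneg (p.eval t)) (F.w_pos t).le) (F.integrable (by fun_prop : PG fun t => p.eval t ^ 2))).1 h.symm
  have h3 := (Continuous.ae_eq_iff_eq volume hc continuous_const).1 h2
  apply hp
  apply Polynomial.funext
  intro t
  have : p.eval t ^ 2 * F.w t = 0 := congrFun h3 t
  have hw := F.w_pos t
  rcases mul_eq_zero.1 this with h | h
  · simpa using h
  · exact absurd h hw.ne'

end Fr
end GW
end

section
namespace GW
open MeasureTheory Real Set Polynomial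
set_option linter.unusedSectionVars false

structure ON (F : Fr) (P : ℕ → ℝ[X]) : Prop where
  deg : ∀ n, (P n).natDegree = n
  lead : ∀ n, 0 < (P n).leadingCoeff
  orth : ∀ n : ℕ, ∀ g : ℝ[X], g.degree < n → F.I (fun t => (P n).eval t * g.eval t) = 0
  norm : ∀ n, F.I (fun t => (P n).eval t ^ 2) = 1

namespace ON
variable {F : Fr} {P : ℕ → ℝ[X]} (h : ON F P)
include h

lemma ga_eq (n : ℕ) : (P n).coeff n = (P n).leadingCoeff := by
  rw [leadingCoeff, h.deg]
lemma ga_pos (n : ℕ) : 0 < (P n).coeff n := by rw [h.ga_eq]; exact h.lead n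
lemma ne0 (n : ℕ) : P n ≠ 0 := by
  intro h0; have := h.lead n; rw [h0] at this; simp at this
lemma degree (n : ℕ) : (P n).degree = n := by
  rw [degree_eq_natDegree (h.ne0 n), h.deg]

lemma degree_lt_of {n : ℕ} {g : ℝ[X]} (hg : g.natDegree ≤ n) (h0 : g.coeff n = 0) : g.degree < n := by
  rw [degree_lt_iff_coeff_zero]
  intro m hm
  rcases hm.eq_or_lt with h1 | h1
  · rw [← h1]; exact h0
  · exact coeff_eq_zero_of_natDegree_lt (lt_of_le_of_lt hg h1)

lemma natDegree_le_of' {n : ℕ} {g : ℝ[X]} (hg : g.degree < (n+1 : ℕ)) : g.natDegree ≤ n := by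
  rw [natDegree_le_iff_coeff_eq_zero]
  intro N hN
  exact (degree_lt_iff_coeff_zero _ _).1 hg N hN

lemma tool {n : ℕ} {g : ℝ[X]} (hg : g.natDegree ≤ n) :
    F.I (fun t => (P n).eval t * g.eval t) = g.coeff n / (P n).coeff n := by
  set c := g.coeff n / (P n).coeff n with hc
  have hga := h.ga_pos n
  have h1 : (g - C c * P n).degree < n := by
    apply h.degree_lt_of
    · refine (natDegree_sub_le _ _).trans (max_le hg ?_)
      refine (natDegree_C_mul_le _ _).trans (h.deg n).le
    · rw [coeff_sub, coeff_C_mul, hc]; field_simp; ring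
  have h2 := h.orth n _ h1
  have e : ∀ t, (P n).eval t * g.eval t = (P n).eval t * (g - C c * P n).eval t + c * (P n).eval t ^2 := by
    intro t; simp; ring
  rw [Fr.I_congr e, Fr.I_add (by fun_prop) (by fun_prop), h2, Fr.I_smul, h.norm]
  ring

lemma orth' {m n : ℕ} (hmn : m < n) : F.I (fun t => (P n).eval t * (P m).eval t) = 0 := by
  apply h.orth
  rw [h.degree]; exact_mod_cast hmn

lemma eq_zero_of {d : ℝ[X]} (hd : F.I (fun t => d.eval t ^ 2) = 0) : d = 0 := by
  by_contra h0
  exact (Fr.I_pos (F := F) h0).ne' hd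

lemma parity (n : ℕ) (t : ℝ) : (P n).eval (-t) = (-1)^n * (P n).eval t := by
  set s : ℝ := (-1)^n with hs
  have hss : s * s = 1 := by rw [hs, ← pow_add, ← two_mul, pow_mul]; simp
  set d := P n - C s * (P n).comp (-X) with hd
  have hdd : (P n - C s * (P n).comp (-X)).degree < n := by
    apply h.degree_lt_of
    · refine (natDegree_sub_le _ _).trans (max_le (h.deg n).le ?_)
      refine (natDegree_C_mul_le _ _).trans ?_
      rw [natDegree_comp, natDegree_neg, natDegree_X, h.deg]; simp
    · rw [coeff_sub, coeff_C_mul, show (-X : ℝ[X]) = C (-1) * X by simp, comp_C_mul_X_coeff, ← hs]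
      linear_combination -(P n).coeff n * hss
  have hd0 : d = 0 := by
    apply h.eq_zero_of
    have e : ∀ t, d.eval t ^ 2 = (P n).eval t * d.eval t - s * ((P n).eval (-t) * d.eval t) := by
      intro t; simp [hd]; ring
    have hp : PG (fun t => (P n).eval (-t) * d.eval t) := by
      have : ∀ t, (P n).eval (-t) = ((P n).comp (-X)).eval t := by intro t; simp
      simp only [this]; fun_prop
    rw [Fr.I_congr e, Fr.I_sub (by fun_prop) (by fun_prop), h.orth n d hdd, Fr.I_smul]
    have e2 := Fr.I_flip (F := F) (fun t => (P n).eval (-t) * d.eval t)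
    simp only [neg_neg] at e2
    rw [← e2]
    have e3 : ∀ t, (P n).eval t * d.eval (-t) = (-s) * ((P n).eval t * d.eval t) := by
      intro t; simp only [hd, eval_sub, eval_mul, eval_C, eval_comp, eval_neg, eval_X, neg_neg]
      linear_combination (-(P n).eval t * (P n).eval (-t)) * hss
    rw [Fr.I_congr e3, Fr.I_smul, h.orth n d hdd]; ring
  have := congrArg (eval (-t)) hd0
  simp [hd] at this
  linarith

end ON

noncomputable def al (P : ℕ → ℝ[X]) (m : ℕ) : ℝ := (P m).coeff m / (P (m+1)).coeff (m+1)

namespace ON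
variable {F : Fr} {P : ℕ → ℝ[X]} (h : ON F P)
include h

lemma al_pos (m : ℕ) : 0 < al P m := div_pos (h.ga_pos _) (h.ga_pos _)

lemma I_R (n : ℕ) : F.I (fun t => F.R t * (P n).eval t ^ 2) = 2 * n + 1 := by
  have h1 := Fr.I_parts (F := F) (X * P n ^ 2)
  have e1 : ∀ t, (X * P n ^ 2).eval t * F.Q1 t = F.R t * (P n).eval t ^ 2 := by
    intro t; simp [Fr.R]; ring
  rw [Fr.I_congr e1] at h1
  rw [← h1]
  have e2 : ∀ t, (derivative (X * P n ^ 2)).eval t = (P n).eval t ^ 2 + 2 * ((P n).eval t * (X * derivative (P n)).eval t) := by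
    intro t; simp [derivative_mul, derivative_pow]; ring
  have hd : (X * derivative (P n)).natDegree ≤ n := by
    rcases Nat.eq_zero_or_pos n with h0 | h0
    · subst h0
      have : derivative (P 0) = 0 := by
        rw [eq_C_of_natDegree_eq_zero (h.deg 0)]; simp
      rw [this]; simp
    · have := natDegree_derivative_le (P n)
      rw [h.deg] at this
      refine natDegree_mul_le.trans ?_
      rw [natDegree_X]; omega
  have hcf : (X * derivative (P n)).coeff n = n * (P n).coeff n := by
    cases n with
    | zero => simp
    | succ m => rw [coeff_X_mul, coeff_derivative]; push_cast; ring
  rw [Fr.I_congr e2, Fr.I_add (by fun_prop) (by fun_prop), Fr.I_smul, h.tool hd, h.norm, hcf]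
  have := h.ga_pos n
  field_simp; ring

lemma I_Q1 (m : ℕ) : F.I (fun t => F.Q1 t * ((P (m+1)).eval t * (P m).eval t)) = (m+1) / al P m := by
  have h1 := Fr.I_parts (F := F) (P (m+1) * P m)
  have e1 : ∀ t, (P (m+1) * P m).eval t * F.Q1 t = F.Q1 t * ((P (m+1)).eval t * (P m).eval t) := by
    intro t; simp; ring
  rw [Fr.I_congr e1] at h1
  rw [← h1]
  have e2 : ∀ t, (derivative (P (m+1) * P m)).eval t = (P (m+1)).eval t * (derivative (P m)).eval t + (P m).eval t * (derivative (P (m+1))).eval t := by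
    intro t; simp [derivative_mul]; ring
  have hd1 : (derivative (P m)).degree < (m+1 : ℕ) := by
    refine degree_derivative_le.trans_lt ?_
    rw [h.degree]; exact_mod_cast Nat.lt_succ_self m
  have hd2 : (derivative (P (m+1))).natDegree ≤ m := by
    have := natDegree_derivative_le (P (m+1))
    rw [h.deg] at this; simpa using this
  rw [Fr.I_congr e2, Fr.I_add (by fun_prop) (by fun_prop), h.orth _ _ hd1, h.tool hd2, coeff_derivative, al]
  have := h.ga_pos m
  have := h.ga_pos (m+1)
  field_simp; ring

lemma I_X (m : ℕ) : F.I (fun t => (P (m+1)).eval t * (t * (P m).eval t)) = al P m := by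
  have hd : (X * P m).natDegree ≤ m + 1 := by
    refine natDegree_mul_le.trans ?_
    rw [natDegree_X, h.deg]; omega
  have := h.tool hd
  rw [coeff_X_mul] at this
  rw [al, ← this]; simp

lemma rec0 (t : ℝ) : t * (P 0).eval t = al P 0 * (P 1).eval t := by
  have hp := h.parity 1 0
  have h1 : P 1 = C ((P 1).coeff 1) * X + C ((P 1).coeff 0) := eq_X_add_C_of_natDegree_le_one (h.deg 1).le
  have h0 : P 0 = C ((P 0).coeff 0) := eq_C_of_natDegree_eq_zero (h.deg 0)
  have hc : (P 1).coeff 0 = 0 := by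
    rw [coeff_zero_eq_eval_zero]; simp at hp; linarith
  rw [hc] at h1
  have hg := h.ga_pos 1
  have e0 : (P 0).eval t = (P 0).coeff 0 := by rw [h0]; simp
  have e1 : (P 1).eval t = (P 1).coeff 1 * t := by
    conv_lhs => rw [h1]
    simp
  rw [e0, e1, al]; field_simp

lemma rec' (m : ℕ) (t : ℝ) : t * (P (m+1)).eval t = al P (m+1) * (P (m+2)).eval t + al P m * (P m).eval t := by
  set d := X * P (m+1) - C (al P (m+1)) * P (m+2) - C (al P m) * P m with hd
  have g1 := h.ga_pos (m+1)
  have g2 := h.ga_pos (m+2)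
  have g0 := h.ga_pos m
  have cf : ∀ i j, i < j → (P i).coeff j = 0 := fun i j hij => coeff_eq_zero_of_natDegree_lt (by rw [h.deg]; exact hij)
  have b1 : d.natDegree ≤ m + 2 := by
    refine (natDegree_sub_le _ _).trans (max_le ((natDegree_sub_le _ _).trans (max_le ?_ ?_)) ?_)
    · refine natDegree_mul_le.trans ?_
      rw [natDegree_X, h.deg]; omega
    · refine (natDegree_C_mul_le _ _).trans (h.deg _).le
    · refine (natDegree_C_mul_le _ _).trans ?_
      rw [h.deg]; omega
  have c1 : d.coeff (m+2) = 0 := by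
    rw [hd, coeff_sub, coeff_sub, coeff_X_mul, coeff_C_mul, coeff_C_mul, cf m (m+2) (by omega), al]
    field_simp; ring
  have b2 : d.natDegree ≤ m + 1 := by
    exact h.natDegree_le_of' (h.degree_lt_of b1 c1)
  have ev : ∀ t, d.eval t = t * (P (m+1)).eval t - al P (m+1) * (P (m+2)).eval t - al P m * (P m).eval t := by
    intro t; simp [hd]
  have c2 : d.coeff (m+1) = 0 := by
    have ht := h.tool b2
    have e : ∀ t, (P (m+1)).eval t * d.eval t = t * (P (m+1)).eval t ^ 2 - al P (m+1) * ((P (m+2)).eval t * (P (m+1)).eval t) - al P m * ((P (m+1)).eval t * (P m).eval t) := by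
      intro t; rw [ev]; ring
    rw [Fr.I_congr e, Fr.I_sub (by fun_prop) (by fun_prop), Fr.I_sub (by fun_prop) (by fun_prop), Fr.I_smul, Fr.I_smul, h.orth' (by omega), h.orth' (by omega), Fr.I_odd] at ht
    · have : d.coeff (m+1) / (P (m+1)).coeff (m+1) = 0 := by linarith
      rcases div_eq_zero_iff.1 this with h1 | h1
      · exact h1
      · exact absurd h1 g1.ne'
    · intro t; rw [h.parity, mul_pow, ← pow_mul, mul_comm (m+1) 2, pow_mul]; simp
  have b3 : d.natDegree ≤ m := by
    exact h.natDegree_le_of' (h.degree_lt_of b2 c2)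
  have c3 : d.coeff m = 0 := by
    have ht := h.tool b3
    have e : ∀ t, (P m).eval t * d.eval t = (P (m+1)).eval t * (t * (P m).eval t) - al P (m+1) * ((P (m+2)).eval t * (P m).eval t) - al P m * ((P m).eval t ^ 2) := by
      intro t; rw [ev]; ring
    rw [Fr.I_congr e, Fr.I_sub (by fun_prop) (by fun_prop), Fr.I_sub (by fun_prop) (by fun_prop), Fr.I_smul, Fr.I_smul, h.orth' (by omega), h.norm, h.I_X] at ht
    have : d.coeff m / (P m).coeff m = 0 := by linarith
    rcases div_eq_zero_iff.1 this with h1 | h1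
    · exact h1
    · exact absurd h1 g0.ne'
  have b4 := h.degree_lt_of b3 c3
  have hd0 : d = 0 := by
    apply h.eq_zero_of
    have e : ∀ t, d.eval t ^ 2 = (P (m+1)).eval t * (X * d).eval t - al P (m+1) * ((P (m+2)).eval t * d.eval t) - al P m * ((P m).eval t * d.eval t) := by
      intro t; rw [sq]; nth_rw 1 [ev]; simp; ring
    have dX : (X * d).degree < ((m+1 : ℕ) : WithBot ℕ) := by
      rw [degree_lt_iff_coeff_zero] at b4 ⊢
      intro N hN
      obtain ⟨k, rfl⟩ : ∃ k, N = k + 1 := ⟨N-1, by omega⟩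
      rw [coeff_X_mul]; exact b4 k (by omega)
    have d2 : d.degree < ((m+2 : ℕ) : WithBot ℕ) := by
      rw [degree_lt_iff_coeff_zero] at b4 ⊢
      intro N hN
      exact b4 N (by omega)
    rw [Fr.I_congr e, Fr.I_sub (by fun_prop) (by fun_prop), Fr.I_sub (by fun_prop) (by fun_prop), Fr.I_smul, Fr.I_smul, h.orth _ _ dX, h.orth _ _ d2, h.orth _ _ b4]
    ring
  have := ev t
  rw [hd0] at this
  simp at this
  linarith

section
variable {n : ℕ} {a : ℝ} (hn : 1 ≤ n) (ha : 0 < a) (hRa : F.R a = n)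
include hn ha hRa

lemma Q1a (t : ℝ) : |F.Q1 t| ≤ n / a + F.R t / a := by
  rw [← F.Q1_abs]
  have hR := F.R_nonneg t
  rcases le_total |t| a with h1 | h1
  · have := F.Q1_mono.monotone h1
    have e : F.Q1 a = n / a := by rw [← hRa, Fr.R]; field_simp
    have : 0 ≤ F.R t / a := by positivity
    linarith
  · have e : F.Q1 |t| = F.R t / |t| := by
      have : |t| ≠ 0 := (lt_of_lt_of_le ha h1).ne'
      rw [← F.R_abs, Fr.R]; field_simp
    rw [e]
    have h2 : F.R t / |t| ≤ F.R t / a := by gcongr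
    have : 0 ≤ (n:ℝ)/a := by positivity
    linarith

lemma sq_le_R (t : ℝ) : t^2 ≤ a^2 + a^2 / n * F.R t := by
  have hn' : (1:ℝ) ≤ n := by exact_mod_cast hn
  have hR := F.R_nonneg t
  rcases le_total |t| a with h1 | h1
  · have : t^2 ≤ a^2 := by rw [← sq_abs]; gcongr
    have : 0 ≤ a^2/n * F.R t := by positivity
    linarith
  · have := F.R_lower ha h1
    rw [F.R_abs, hRa, div_pow, sq_abs] at this
    have : a^2/n * (t^2/a^2*n) ≤ a^2/n*F.R t := by gcongr
    have e : a^2/n * (t^2/a^2*n) = t^2 := by field_simp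
    nlinarith [sq_nonneg a]

lemma al_ge {m : ℕ} (hm : n = m + 1) : a / 3 ≤ al P m := by
  have hn' : (1:ℝ) ≤ n := by exact_mod_cast hn
  have hQ := h.I_Q1 m
  have hle : F.I (fun t => F.Q1 t * ((P (m+1)).eval t * (P m).eval t)) ≤
      F.I (fun t => (n/(2*a)) * (P (m+1)).eval t ^2 + (n/(2*a)) * (P m).eval t ^2 + ((1/(2*a)) * (F.R t * (P (m+1)).eval t ^2) + (1/(2*a)) * (F.R t * (P m).eval t ^2))) := by
    apply Fr.I_mono (by fun_prop) (by fun_prop)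
    intro t
    set u := (P (m+1)).eval t
    set v := (P m).eval t
    have h1 := h.Q1a hn ha hRa t
    have h2 : F.Q1 t * (u*v) ≤ |F.Q1 t| * (|u| * |v|) := by
      rw [← abs_mul, ← abs_mul]; exact le_abs_self _
    have h3 : |u| * |v| ≤ (u^2+v^2)/2 := by
      nlinarith [sq_nonneg (|u| - |v|), sq_abs u, sq_abs v]
    have h4 : |F.Q1 t| * (|u| * |v|) ≤ (n/a + F.R t / a) * ((u^2+v^2)/2) := by
      apply mul_le_mul h1 h3 (by positivity)
      have := F.R_nonneg t; positivity
    refine h2.trans (h4.trans (le_of_eq ?_))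
    field_simp
  rw [hQ, Fr.I_add (by fun_prop) (by fun_prop), Fr.I_add (by fun_prop) (by fun_prop), Fr.I_add (by fun_prop) (by fun_prop), Fr.I_smul, Fr.I_smul, Fr.I_smul, Fr.I_smul, h.norm, h.norm, h.I_R, h.I_R] at hle
  have hal := h.al_pos m
  have en : (n:ℝ) = m + 1 := by rw [hm]; push_cast; ring
  have e : (n:ℝ)/(2*a)*1 + n/(2*a)*1 + (1/(2*a)*(2*((m+1:ℕ):ℝ)+1) + 1/(2*a)*(2*m+1)) = 3*n/a := by
    rw [en]; push_cast; field_simp; ring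
  rw [e, ← en, div_le_div_iff₀ hal ha] at hle
  have : n * a ≤ n * (3 * al P m) := by linarith
  have := le_of_mul_le_mul_left this (by linarith)
  linarith

lemma al_le {j : ℕ} (hj : j ≤ n) : al P j ≤ 2 * a := by
  have hn' : (1:ℝ) ≤ n := by exact_mod_cast hn
  have hj' : (j:ℝ) ≤ n := by exact_mod_cast hj
  have hle : F.I (fun t => (P (j+1)).eval t * (t * (P j).eval t)) ≤
      F.I (fun t => a * (P (j+1)).eval t ^2 + ((a/4) * (P j).eval t ^ 2 + (a/(4*n)) * (F.R t * (P j).eval t ^2))) := by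
    apply Fr.I_mono (by fun_prop) (by fun_prop)
    intro t
    set u := (P (j+1)).eval t
    set v := (P j).eval t
    have h1 := h.sq_le_R hn ha hRa t
    have h2 : u * (t * v) ≤ a * u^2 + t^2 * v^2 / (4*a) := by
      have : 0 ≤ (2*a*u - t*v)^2 / (4*a) := by positivity
      have e : (2*a*u - t*v)^2 / (4*a) = a * u^2 + t^2 * v^2 / (4*a) - u*(t*v) := by field_simp; ring
      linarith
    have h3 : t^2 * v^2/(4*a) ≤ (a^2 + a^2 / n * F.R t) * v^2/(4*a) := by gcongr
    have e : (a^2 + a^2 / n * F.R t) * v^2/(4*a) = (a/4) * v^2 + (a/(4*n)) * (F.R t * v^2) := by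
      field_simp
    linarith
  rw [h.I_X, Fr.I_add (by fun_prop) (by fun_prop), Fr.I_add (by fun_prop) (by fun_prop), Fr.I_smul, Fr.I_smul, Fr.I_smul, h.norm, h.norm, h.I_R] at hle
  have : a/(4*n)*(2*j+1) ≤ a/(4*n)*(3*n) := by gcongr; linarith
  have e : a/(4*n)*(3*n) = 3*a/4 := by field_simp
  linarith

lemma H_aux {u v : ℝ[X]} {s : ℝ} (hs : 0 < s) :
    F.I (fun t => F.Q1 t * (u.eval t * v.eval t)) ≤ s/2 * F.I (fun t => F.q t * u.eval t ^2) + 1/(2*s) * F.I (fun t => F.R t * v.eval t ^ 2) := by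
  rw [← Fr.I_smul, ← Fr.I_smul, ← Fr.I_add (by fun_prop) (by fun_prop)]
  apply Fr.I_mono (by fun_prop) (by fun_prop)
  intro t
  rw [← F.q_mul_self, ← F.q_mul_sq]
  have hq := F.q_nonneg t
  have : 0 ≤ F.q t * (s * u.eval t - t * v.eval t)^2 / (2*s) := by positivity
  have e : F.q t * (s * u.eval t - t * v.eval t)^2 / (2*s) = s/2 * (F.q t * u.eval t ^2) + 1/(2*s) * (F.q t * t^2 * v.eval t ^ 2) - F.q t * t * (u.eval t * v.eval t) := by
    field_simp; ring
  linarith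

lemma H_ge {m : ℕ} (hm : n = m + 1) : n / (8 * a^2) ≤ F.I (fun t => F.q t * (P n).eval t ^2) := by
  have hn' : (1:ℝ) ≤ n := by exact_mod_cast hn
  have hal := h.al_pos m
  have hle := h.al_le hn ha hRa (j := m) (by omega)
  have h1 := h.H_aux hn ha hRa (u := P (m+1)) (v := P m) (s := 2 * al P m) (by positivity)
  rw [h.I_Q1, h.I_R] at h1
  subst hm
  push_cast at *
  set H := F.I (fun t => F.q t * (P (m+1)).eval t ^2)
  have h2 : 1/(2*(2*al P m)) * (2*(m:ℝ)+1) ≤ (m+1)/(2*al P m) := by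
    rw [div_mul_eq_mul_div, div_le_div_iff₀ (by positivity) (by positivity)]; nlinarith
  have h3 : (m+1)/(2*al P m) ≤ al P m * H := by
    have : ((m:ℝ)+1)/al P m = (m+1)/(2*al P m) + (m+1)/(2*al P m) := by field_simp; ring
    linarith
  rw [div_le_iff₀ (by positivity)] at h3 ⊢
  have : al P m ^2 ≤ (2*a)^2 := by gcongr
  have hH : 0 ≤ H := Fr.I_nonneg fun t => mul_nonneg (F.q_nonneg t) (sq_nonneg _)
  nlinarith

lemma H_ge' {m : ℕ} (hm : n = m + 1) : n / (12 * a^2) ≤ F.I (fun t => F.q t * (P m).eval t ^2) := by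
  have hn' : (1:ℝ) ≤ n := by exact_mod_cast hn
  have hal := h.al_pos m
  have hle := h.al_le hn ha hRa (j := m) (by omega)
  have h1 := h.H_aux hn ha hRa (u := P m) (v := P (m+1)) (s := 3 * al P m) (by positivity)
  have e1 : ∀ t, F.Q1 t * ((P m).eval t * (P (m+1)).eval t) = F.Q1 t * ((P (m+1)).eval t * (P m).eval t) := by
    intro t; ring
  rw [Fr.I_congr e1, h.I_Q1, h.I_R] at h1
  subst hm
  push_cast at *
  set H := F.I (fun t => F.q t * (P m).eval t ^2)
  have h2 : 1/(2*(3*al P m)) * (2*((m:ℝ)+1)+1) ≤ (m+1)/(2*al P m) := by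
    rw [div_mul_eq_mul_div, div_le_div_iff₀ (by positivity) (by positivity)]; nlinarith
  have h3 : (m+1)/(2*al P m) ≤ 3/2 * al P m * H := by
    have : ((m:ℝ)+1)/al P m = (m+1)/(2*al P m) + (m+1)/(2*al P m) := by field_simp; ring
    linarith
  rw [div_le_iff₀ (by positivity)] at h3 ⊢
  have : al P m ^2 ≤ (2*a)^2 := by gcongr
  have hH : 0 ≤ H := Fr.I_nonneg fun t => mul_nonneg (F.q_nonneg t) (sq_nonneg _)
  nlinarith

lemma pos_far {x : ℝ} (hx : 4 * a ≤ x) : 0 < (P n).eval x := by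
  have p0 : 0 < (P 0).eval x := by
    have h0 : P 0 = C ((P 0).coeff 0) := eq_C_of_natDegree_eq_zero (h.deg 0)
    rw [h0]; simpa using h.ga_pos 0
  have key : ∀ j, j < n → 0 < (P j).eval x ∧ 2 * a * (P j).eval x ≤ al P j * (P (j+1)).eval x := by
    intro j
    induction j with
    | zero =>
      intro _
      refine ⟨p0, ?_⟩
      rw [← h.rec0]
      have : 2 * a ≤ x := by linarith
      gcongr
    | succ j ih =>
      intro hj
      obtain ⟨i1, i2⟩ := ih (by omega)
      have a1 := h.al_pos j
      have a2 := h.al_le hn ha hRa (j := j) (by omega)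
      have hp : 0 < (P (j+1)).eval x := by
        have : 0 < al P j * (P (j+1)).eval x := lt_of_lt_of_le (by positivity) i2
        exact (pos_iff_pos_of_mul_pos this).1 a1
      refine ⟨hp, ?_⟩
      have hr := h.rec' j x
      have h1 : al P j * (P j).eval x ≤ 2 * a * (P j).eval x := by gcongr
      have h2 : al P j * (P (j+1)).eval x ≤ 2 * a * (P (j+1)).eval x := by gcongr
      have h3 : 4 * a * (P (j+1)).eval x ≤ x * (P (j+1)).eval x := by gcongr
      linarith
  obtain ⟨m, rfl⟩ : ∃ m, n = m + 1 := ⟨n-1, by omega⟩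
  obtain ⟨i1, i2⟩ := key m (by omega)
  have : 0 < al P m * (P (m+1)).eval x := lt_of_lt_of_le (by positivity) i2
  exact (pos_iff_pos_of_mul_pos this).1 (h.al_pos m)

lemma zero_lt {x : ℝ} (hx : (P n).eval x = 0) : |x| < 4 * a := by
  by_contra hh
  push Not at hh
  have := h.pos_far hn ha hRa hh
  rcases abs_choice x with h1 | h1
  · rw [h1, hx] at this; exact lt_irrefl _ this
  · rw [h1, h.parity, hx] at this; simp at this
end
end ON
end GW
end

section
namespace GW
open MeasureTheory Real Set Polynomial
set_option linter.unusedSectionVars false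

noncomputable def ell {n : ℕ} (y : Fin n → ℝ) (k : Fin n) : ℝ[X] := Lagrange.basis Finset.univ y k
noncomputable def lam (F : Fr) {n : ℕ} (y : Fin n → ℝ) (k : Fin n) : ℝ := F.I (fun t => (ell y k).eval t ^ 2)

namespace ON
variable {F : Fr} {P : ℕ → ℝ[X]} (h : ON F P) {n : ℕ} {y : Fin n → ℝ} (hy : Function.Injective y)
  (hz : ∀ k, (P n).eval (y k) = 0)

section
include hy
lemma ell_self (k : Fin n) : (ell y k).eval (y k) = 1 :=
  Lagrange.eval_basis_self hy.injOn (Finset.mem_univ k)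
lemma ell_ne {k j : Fin n} (hkj : k ≠ j) : (ell y k).eval (y j) = 0 :=
  Lagrange.eval_basis_of_ne hkj (Finset.mem_univ j)
lemma ell_ne0 (k : Fin n) : ell y k ≠ 0 := by
  intro h0; have := ell_self hy k; rw [h0] at this; simp at this
lemma ell_natDegree (k : Fin n) : (ell y k).natDegree = n - 1 := by
  rw [ell, Lagrange.natDegree_basis hy.injOn (Finset.mem_univ k)]; simp
lemma lam_pos (k : Fin n) : 0 < lam F y k := Fr.I_pos (ell_ne0 hy k)
lemma eval_ell (k : Fin n) (x : ℝ) : (ell y k).eval x = ∏ j ∈ Finset.univ.erase k, (x - y j) / (y k - y j) := by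
  rw [ell, Lagrange.basis, eval_prod]
  apply Finset.prod_congr rfl
  intro j _
  simp [Lagrange.basisDivisor]; ring
end

include h hy hz
lemma vanish {g : ℝ[X]} (hg : g.natDegree ≤ n) (h0 : ∀ k, g.eval (y k) = 0) : g = C (g.coeff n / (P n).coeff n) * P n := by
  have hga := h.ga_pos n
  rw [← sub_eq_zero]
  apply Polynomial.eq_zero_of_degree_lt_of_eval_index_eq_zero Finset.univ hy.injOn
  · rw [Finset.card_univ, Fintype.card_fin]
    apply h.degree_lt_of
    · refine (natDegree_sub_le _ _).trans (max_le hg ?_)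
      refine (natDegree_C_mul_le _ _).trans (h.deg n).le
    · rw [coeff_sub, coeff_C_mul]; field_simp; ring
  · intro k _
    simp [h0, hz]

lemma Xell (k : Fin n) : (P n).derivative.eval (y k) ≠ 0 ∧
    (X - C (y k)) * ell y k = C (1 / (P n).derivative.eval (y k)) * P n := by
  have hk := k.pos
  have h1 : ((X - C (y k)) * ell y k).natDegree ≤ n := by
    refine natDegree_mul_le.trans ?_
    rw [natDegree_X_sub_C, ell_natDegree hy]; omega
  have h2 := h.vanish hy hz h1 (by
    intro j
    by_cases hj : k = j
    · subst hj; simp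
    · simp [ell_ne hy hj])
  set c := ((X - C (y k)) * ell y k).coeff n / (P n).coeff n
  have h3 := congrArg (fun p => (derivative p).eval (y k)) h2
  simp [derivative_mul, ell_self hy] at h3
  have h4 : (P n).derivative.eval (y k) ≠ 0 := by
    intro h0; rw [h0] at h3; simp at h3
  refine ⟨h4, ?_⟩
  rw [h2]
  congr 2
  field_simp; linarith

lemma Xell_eval (k : Fin n) (t : ℝ) : (t - y k) * (ell y k).eval t = (P n).eval t / (P n).derivative.eval (y k) := by
  have := congrArg (eval t) (h.Xell hy hz k).2
  simp at this; rw [this]; ring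

lemma I_Xell (k : Fin n) {g : ℝ[X]} (hg : g.degree < n) : F.I (fun t => (t - y k) * (ell y k).eval t * g.eval t) = 0 := by
  have e : ∀ t, (t - y k) * (ell y k).eval t * g.eval t = (1 / (P n).derivative.eval (y k)) * ((P n).eval t * g.eval t) := by
    intro t; rw [h.Xell_eval hy hz]; ring
  rw [Fr.I_congr e, Fr.I_smul, h.orth n g hg, mul_zero]

lemma I_ell_aux (k : Fin n) {g : ℝ[X]} (hg : g.natDegree ≤ n) (h0 : g.eval (y k) = 0) : F.I (fun t => (ell y k).eval t * g.eval t) = 0 := by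
  obtain ⟨s, hs⟩ := dvd_iff_isRoot.2 h0
  have hsd : s.degree < n := by
    by_cases hs0 : s = 0
    · rw [hs0]; simp
    · rw [← natDegree_lt_iff_degree_lt hs0]
      have : g.natDegree = 1 + s.natDegree := by
        rw [hs, natDegree_mul (X_sub_C_ne_zero _) hs0, natDegree_X_sub_C]
      omega
  rw [← h.I_Xell hy hz k hsd]
  apply Fr.I_congr
  intro t; rw [hs]; simp; ring

lemma I_ell (k : Fin n) {g : ℝ[X]} (hg : g.natDegree ≤ n) : F.I (fun t => (ell y k).eval t * g.eval t) = g.eval (y k) * lam F y k := by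
  have h1 := h.I_ell_aux hy hz k (g := g - C (g.eval (y k)) * ell y k) (by
    refine (natDegree_sub_le _ _).trans (max_le hg ?_)
    refine (natDegree_C_mul_le _ _).trans ?_
    rw [ell_natDegree hy]; omega) (by simp [ell_self hy])
  have e : ∀ t, (ell y k).eval t * (g - C (g.eval (y k)) * ell y k).eval t = (ell y k).eval t * g.eval t - g.eval (y k) * (ell y k).eval t ^ 2 := by
    intro t; simp; ring
  rw [Fr.I_congr e, Fr.I_sub (by fun_prop) (by fun_prop), Fr.I_smul] at h1
  unfold lam; linarith

lemma lam_le (k : Fin n) {S : ℝ[X]} (hS : S.natDegree ≤ n) (h1 : S.eval (y k) = 1) : lam F y k ≤ F.I (fun t => S.eval t ^ 2) := by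
  have h2 := h.I_ell hy hz k hS
  rw [h1, one_mul] at h2
  have h3 : F.I (fun t => (ell y k).eval t * S.eval t) ≤ F.I (fun t => (1/2) * (ell y k).eval t ^ 2 + (1/2) * S.eval t ^ 2) := by
    apply Fr.I_mono (by fun_prop) (by fun_prop)
    intro t; nlinarith [sq_nonneg ((ell y k).eval t - S.eval t)]
  rw [Fr.I_add (by fun_prop) (by fun_prop), Fr.I_smul, Fr.I_smul, h2] at h3
  unfold lam at *; linarith

lemma I_t (k : Fin n) : F.I (fun t => (t - y k) * (ell y k).eval t ^ 2) = 0 := by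
  have hk := k.pos
  rw [← h.I_Xell hy hz k (g := ell y k)]
  · apply Fr.I_congr; intro t; ring
  · rw [← natDegree_lt_iff_degree_lt (ell_ne0 hy k), ell_natDegree hy]; omega

lemma I_tQ1 (k : Fin n) : F.I (fun t => (t - y k) * F.Q1 t * (ell y k).eval t ^ 2) = lam F y k := by
  have hk := k.pos
  have h1 := Fr.I_parts (F := F) ((X - C (y k)) * ell y k ^ 2)
  have e : ∀ t, (derivative ((X - C (y k)) * ell y k ^ 2)).eval t = (ell y k).eval t ^ 2 + 2 * ((t - y k) * (ell y k).eval t * (derivative (ell y k)).eval t) := by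
    intro t; simp [derivative_mul, derivative_pow]; ring
  rw [Fr.I_congr e, Fr.I_add (by fun_prop) (by fun_prop), Fr.I_smul, h.I_Xell hy hz k] at h1
  · rw [mul_zero, add_zero] at h1
    rw [lam, h1]
    apply Fr.I_congr; intro t; simp; ring
  · refine degree_derivative_le.trans_lt ?_
    rw [← natDegree_lt_iff_degree_lt (ell_ne0 hy k), ell_natDegree hy]; omega

lemma I_Q1ell (k : Fin n) : F.I (fun t => F.Q1 t * (ell y k).eval t ^ 2) = 2 * (ell y k).derivative.eval (y k) * lam F y k := by
  have h1 := Fr.I_parts (F := F) (ell y k ^ 2)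
  have e : ∀ t, (derivative (ell y k ^ 2)).eval t = 2 * ((ell y k).eval t * (derivative (ell y k)).eval t) := by
    intro t; simp [derivative_pow]; ring
  rw [Fr.I_congr e, Fr.I_smul, h.I_ell hy hz k] at h1
  · rw [mul_assoc, h1]
    apply Fr.I_congr; intro t; simp; ring
  · have := natDegree_derivative_le (ell y k)
    rw [ell_natDegree hy] at this; omega

lemma I_conv (k : Fin n) : F.I (fun t => (t - y k) * (F.Q1 t - F.Q1 (y k)) * (ell y k).eval t ^ 2) = lam F y k := by
  have e : ∀ t, (t - y k) * (F.Q1 t - F.Q1 (y k)) * (ell y k).eval t ^ 2 = (t - y k) * F.Q1 t * (ell y k).eval t ^ 2 - F.Q1 (y k) * ((t - y k) * (ell y k).eval t ^ 2) := by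
    intro t; ring
  rw [Fr.I_congr e, Fr.I_sub (by fun_prop) (by fun_prop), Fr.I_smul, h.I_t hy hz, h.I_tQ1 hy hz]; ring

lemma estA {a : ℝ} (hn : 1 ≤ n) (ha : 0 < a) (hRa : F.R a = n) (k : Fin n) :
    n / (16 * a^2) ≤ lam F y k * (P n).derivative.eval (y k) ^ 2 := by
  obtain ⟨m, hm⟩ : ∃ m, n = m + 1 := ⟨n-1, by omega⟩
  have hH := h.H_ge hn ha hRa hm
  have hp := (h.Xell hy hz k).1
  set p := (P n).derivative.eval (y k)
  have h1 : F.I (fun t => (1/(2*p^2)) * (F.q t * (P n).eval t ^ 2)) ≤ lam F y k := by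
    rw [← h.I_conv hy hz k]
    apply Fr.I_mono (by fun_prop) (by fun_prop)
    intro t
    have e := h.Xell_eval hy hz k t
    have hc := F.conv1 t (y k)
    have e2 : (P n).eval t = (t - y k) * (ell y k).eval t * p := by rw [e, div_mul_cancel₀ _ hp]
    calc (1/(2*p^2)) * (F.q t * (P n).eval t ^ 2) = ((t - y k)^2 * F.q t / 2) * (ell y k).eval t ^ 2 := by
          rw [e2]; field_simp
      _ ≤ _ := by gcongr
  rw [Fr.I_smul] at h1
  have hp2 : 0 < p^2 := by positivity
  calc (n:ℝ)/(16*a^2) = (1/(2*p^2)) * (n/(8*a^2)) * p^2 := by field_simp; ring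
    _ ≤ lam F y k * p^2 := by
      gcongr
      refine le_trans ?_ h1
      gcongr
end ON

namespace Fr
variable (F : Fr)

lemma D1 : (1:ℝ) ≤ (F.D:ℝ) - 1 := by
  have : (2:ℝ) ≤ F.D := by exact_mod_cast F.hD
  linarith

lemma Q2_le {s : ℝ} (hs : 0 < s) : F.Q2 s ≤ (F.D - 1) * F.q s := by
  have := F.hi s hs
  rw [q, mul_div_assoc', le_div_iff₀ hs]; linarith

lemma bk_far {t y : ℝ} (hy : 2 ≤ y) (ht : y/2 ≤ |t - y|) :
    |F.Q1 t - F.Q1 y - (t - y) * F.Q2 y| ≤ (2 + 4 * (F.D - 1)) / y * ((t - y) * (F.Q1 t - F.Q1 y)) := by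
  have hD := F.D1
  have hc := F.conv2 t y
  have h0 := F.conv0 t y
  have hQ2 := F.Q2_le (s := y) (by linarith)
  have hq := F.q_pos (t := y) (by linarith)
  have e : (t - y) * (F.Q1 t - F.Q1 y) = |t - y| * |F.Q1 t - F.Q1 y| := by
    rw [← abs_mul, abs_of_nonneg h0]
  have h1 : |F.Q1 t - F.Q1 y| ≤ 2/y * ((t - y) * (F.Q1 t - F.Q1 y)) := by
    rw [e]
    calc |F.Q1 t - F.Q1 y| = 2/y * (y/2 * |F.Q1 t - F.Q1 y|) := by field_simp
      _ ≤ _ := by gcongr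
  have h2 : |(t-y) * F.Q2 y| ≤ 4 * (F.D - 1)/y * ((t - y) * (F.Q1 t - F.Q1 y)) := by
    rw [abs_mul, abs_of_nonneg (F.Q2_nonneg y)]
    have hs : |t-y| * (y/2) ≤ (t-y)^2 := by rw [← sq_abs, sq]; gcongr
    calc |t-y| * F.Q2 y ≤ |t-y| * ((F.D - 1) * F.q y) := by gcongr
      _ = 4 * (F.D - 1)/y * ((|t-y| * (y/2)) * F.q y / 2) := by field_simp; norm_num
      _ ≤ 4 * (F.D - 1)/y * ((t-y)^2 * F.q y / 2) := by gcongr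
      _ ≤ _ := by gcongr
  calc _ ≤ |F.Q1 t - F.Q1 y| + |(t-y) * F.Q2 y| := abs_sub _ _
    _ ≤ _ := by rw [add_div, add_mul]; linarith

lemma q_upper {s t : ℝ} (hs : 0 < s) (hst : s ≤ t) : F.q t ≤ (t/s)^F.D * F.q s := by
  have ht := lt_of_lt_of_le hs hst
  have := F.R_upper hs hst
  have e1 : F.q t = F.R t / t^2 := by rw [← q_mul_sq]; field_simp
  have e2 : F.q s = F.R s / s^2 := by rw [← q_mul_sq]; field_simp
  have hR := F.R_nonneg s
  calc F.q t = F.R t / t^2 := e1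
    _ ≤ ((t/s)^F.D * F.R s) / t^2 := by gcongr
    _ ≤ ((t/s)^F.D * F.R s) / s^2 := by gcongr
    _ = _ := by rw [e2]; ring

lemma bk_near {t y : ℝ} (hy : 2 ≤ y) (ht : |t - y| ≤ y/2) :
    |F.Q1 t - F.Q1 y - (t - y) * F.Q2 y| ≤ (4 * F.c * (F.D - 1) * (3/2)^F.D) / y * ((t - y) * (F.Q1 t - F.Q1 y)) := by
  have hD := F.D1
  have hcc := F.hc
  have hc := F.conv2 t y
  have hq := F.q_pos (t := y) (by linarith)
  set K := F.c * (F.D - 1) * (3/2)^F.D * (2/y) * F.q y with hK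
  have hK0 : 0 ≤ K := by positivity
  have hin : ∀ s ∈ Icc (y/2) (3*y/2), |F.Q3 s| ≤ K := by
    intro s hs
    have s1 : 1 ≤ s := by linarith [hs.1]
    have h1 := F.hc3 s s1
    have h2 := F.Q2_le (s := s) (by linarith)
    have h3 : F.q s ≤ (3/2)^F.D * F.q y := by
      have a1 := F.q_mono (s := s) (t := 3*y/2) (by linarith) hs.2
      have a2 := F.q_upper (s := y) (t := 3*y/2) (by linarith) (by linarith)
      have : 3*y/2/y = 3/2 := by field_simp
      rw [this] at a2; linarith
    rw [abs_mul, abs_of_pos (by linarith : 0 < s)] at h1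
    have h4 : F.c * F.Q2 s ≤ F.c * ((F.D-1) * ((3/2)^F.D * F.q y)) := by
      gcongr
      exact h2.trans (by gcongr)
    have h5 : y/2 * |F.Q3 s| ≤ s * |F.Q3 s| := by gcongr; exact hs.1
    have h6 : y/2 * K = F.c * ((F.D-1) * ((3/2)^F.D * F.q y)) := by rw [hK]; field_simp
    have : y/2 * |F.Q3 s| ≤ y/2 * K := by linarith
    exact le_of_mul_le_mul_left this (by linarith)
  have hyI : y ∈ Icc (y/2) (3*y/2) := ⟨by linarith, by linarith⟩
  have htI : t ∈ Icc (y/2) (3*y/2) := by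
    have := abs_le.1 ht
    exact ⟨by linarith, by linarith⟩
  have l1 : ∀ s ∈ Icc (y/2) (3*y/2), |F.Q2 s - F.Q2 y| ≤ K * |s - y| := by
    intro s hs
    have := (convex_Icc (y/2) (3*y/2)).norm_image_sub_le_of_norm_hasDerivWithin_le (f := F.Q2) (f' := F.Q3) (C := K)
      (fun x _ => (F.d3 x).hasDerivWithinAt) (fun x hx => hin x hx) hyI hs
    simpa using this
  have l2 : |F.Q1 t - t * F.Q2 y - (F.Q1 y - y * F.Q2 y)| ≤ K * |t - y| * |t - y| := by
    have hsub : uIcc y t ⊆ Icc (y/2) (3*y/2) := (convex_Icc _ _).ordConnected.uIcc_subset hyI htI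
    have := (convex_uIcc y t).norm_image_sub_le_of_norm_hasDerivWithin_le (f := fun s => F.Q1 s - s * F.Q2 y) (f' := fun s => F.Q2 s - F.Q2 y) (C := K * |t - y|)
      (fun x _ => (((F.d2 x).sub ((hasDerivAt_id x).mul_const (F.Q2 y))).congr_deriv (by ring)).hasDerivWithinAt)
      (fun x hx => by
        refine (l1 x (hsub hx)).trans ?_
        exact mul_le_mul_of_nonneg_left (abs_sub_left_of_mem_uIcc hx) hK0) left_mem_uIcc right_mem_uIcc
    simpa using this
  have e : F.Q1 t - F.Q1 y - (t - y) * F.Q2 y = F.Q1 t - t * F.Q2 y - (F.Q1 y - y * F.Q2 y) := by ring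
  rw [e]
  refine l2.trans ?_
  have : K * |t - y| * |t - y| = (4 * F.c * (F.D - 1) * (3/2)^F.D) / y * ((t-y)^2 * F.q y / 2) := by
    rw [mul_assoc, ← sq, sq_abs, hK]; field_simp; ring
  rw [this]
  gcongr

noncomputable def cbk : ℝ := (2 + 4 * (F.D - 1)) + (4 * F.c * (F.D - 1) * (3/2)^F.D)

lemma cbk_pos : 0 < F.cbk := by
  have hD := F.D1
  have hcc := F.hc
  unfold cbk
  have : (0:ℝ) ≤ F.D - 1 := by linarith
  positivity

lemma bk_pos {t y : ℝ} (hy : 2 ≤ y) :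
    |F.Q1 t - F.Q1 y - (t - y) * F.Q2 y| ≤ F.cbk / y * ((t - y) * (F.Q1 t - F.Q1 y)) := by
  have hD := F.D1
  have hcc := F.hc
  have h0 := F.conv0 t y
  have hD0 : (0:ℝ) ≤ F.D - 1 := by linarith
  rcases le_total |t-y| (y/2) with h | h
  · refine (F.bk_near hy h).trans ?_
    gcongr
    unfold cbk; linarith
  · refine (F.bk_far hy h).trans ?_
    gcongr
    unfold cbk
    have : 0 ≤ 4 * F.c * (F.D - 1) * (3/2)^F.D := by positivity
    linarith

lemma bk {t y : ℝ} (hy : 2 ≤ |y|) :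
    |y| * |F.Q1 t - F.Q1 y - (t - y) * F.Q2 y| ≤ F.cbk * ((t - y) * (F.Q1 t - F.Q1 y)) := by
  rcases le_total 0 y with h | h
  · rw [abs_of_nonneg h] at *
    have := F.bk_pos (t := t) hy
    calc _ ≤ y * (F.cbk / y * ((t - y) * (F.Q1 t - F.Q1 y))) := by gcongr
      _ = _ := by field_simp
  · rw [abs_of_nonpos h] at hy ⊢
    have := F.bk_pos (t := -t) hy
    rw [F.Q1_neg, F.Q1_neg, F.Q2_neg] at this
    have e1 : |F.Q1 t - F.Q1 y - (t - y) * F.Q2 y| = |-F.Q1 t - -F.Q1 y - (-t - -y) * F.Q2 y| := by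
      rw [← abs_neg]; ring_nf
    rw [e1]
    calc _ ≤ (-y) * (F.cbk / (-y) * ((-t - -y) * (-F.Q1 t - -F.Q1 y))) := by
            apply mul_le_mul_of_nonneg_left this; linarith
      _ = _ := by
        have : -y ≠ 0 := by linarith
        rw [← mul_assoc, mul_div_cancel₀ _ this]; ring
end Fr

namespace ON
variable {F : Fr} {P : ℕ → ℝ[X]} (h : ON F P) {n : ℕ} {y : Fin n → ℝ} (hy : Function.Injective y)
  (hz : ∀ k, (P n).eval (y k) = 0)
include h hy hz

lemma estBK (k : Fin n) : |2 * y k * (ell y k).derivative.eval (y k) - F.R (y k)| ≤ F.cbk + 2 + 4 * F.Q1 3 := by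
  have hQ3 := F.pos 3 (by norm_num)
  have hcb := F.cbk_pos
  have hlam := lam_pos (F := F) hy k
  have h1 := h.I_Q1ell hy hz k
  have h2 := h.I_conv hy hz k
  have h3 := h.I_t hy hz k
  set b := (ell y k).derivative.eval (y k)
  set Y := y k
  set L := lam F y k with hL
  have hbase : ∀ s, (2 * Y * b - F.R Y) * L = F.I (fun t => Y * (F.Q1 t - F.Q1 Y - (t - Y) * s) * (ell y k).eval t ^ 2) := by
    intro s
    have e : ∀ t, Y * (F.Q1 t - F.Q1 Y - (t - Y) * s) * (ell y k).eval t ^ 2 = Y * (F.Q1 t * (ell y k).eval t ^ 2) - Y * F.Q1 Y * (ell y k).eval t ^ 2 - Y * s * ((t - Y) * (ell y k).eval t ^ 2) := by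
      intro t; ring
    rw [Fr.I_congr e, Fr.I_sub (by fun_prop) (by fun_prop), Fr.I_sub (by fun_prop) (by fun_prop), Fr.I_smul, Fr.I_smul, Fr.I_smul, h1, h3, ← lam, ← hL, Fr.R]
    ring
  have hfin : ∀ K, |(2 * Y * b - F.R Y) * L| ≤ K * L → |2 * Y * b - F.R Y| ≤ K := by
    intro K hK
    rw [abs_mul, abs_of_pos hlam] at hK
    exact le_of_mul_le_mul_right hK hlam
  have habs : ∀ f g : ℝ → ℝ, PG f → PG g → (∀ t, |f t| ≤ g t) → |F.I f| ≤ F.I g := by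
    intro f g hf hg hfg
    rw [abs_le]
    constructor
    · rw [← Fr.I_neg]; exact Fr.I_mono hg.neg hf fun t => by have := abs_le.1 (hfg t); linarith
    · exact Fr.I_mono hf hg fun t => (abs_le.1 (hfg t)).2
  rcases le_total 2 |Y| with hY | hY
  · refine (hfin F.cbk ?_).trans (by linarith)
    rw [hbase (F.Q2 Y), ← h2, ← Fr.I_smul]
    apply habs _ _ (by fun_prop) (by fun_prop)
    intro t
    have := F.bk (t := t) hY
    rw [abs_mul, abs_mul, abs_of_nonneg (sq_nonneg ((ell y k).eval t)), ← mul_assoc]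
    gcongr
  · refine (hfin (2 + 4 * F.Q1 3) ?_).trans (by linarith)
    rw [hbase 0]
    have e : (2 + 4 * F.Q1 3) * L = F.I (fun t => 2 * ((t - Y) * (F.Q1 t - F.Q1 Y) * (ell y k).eval t ^ 2) + 4 * F.Q1 3 * (ell y k).eval t ^ 2) := by
      rw [Fr.I_add (by fun_prop) (by fun_prop), Fr.I_smul, Fr.I_smul, h2, ← lam]; ring
    rw [e]
    apply habs _ _ (by fun_prop) (by fun_prop)
    intro t
    rw [mul_zero, sub_zero, abs_mul, abs_mul, abs_of_nonneg (sq_nonneg ((ell y k).eval t))]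
    have key : |F.Q1 t - F.Q1 Y| ≤ (t - Y) * (F.Q1 t - F.Q1 Y) + 2 * F.Q1 3 := by
      have h0 := F.conv0 t Y
      have e : (t - Y) * (F.Q1 t - F.Q1 Y) = |t - Y| * |F.Q1 t - F.Q1 Y| := by
        rw [← abs_mul, abs_of_nonneg h0]
      rcases le_total 1 |t - Y| with h5 | h5
      · rw [e]; nlinarith [abs_nonneg (F.Q1 t - F.Q1 Y)]
      · have t1 : |t| ≤ 3 := by
          have := abs_add_le (t - Y) Y
          rw [sub_add_cancel] at this; linarith
        have a1 := F.Q1_mono.monotone t1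
        have a2 := F.Q1_mono.monotone (hY.trans (by norm_num : (2:ℝ) ≤ 3))
        rw [F.Q1_abs] at a1 a2
        have := abs_sub (F.Q1 t) (F.Q1 Y)
        linarith
    have hsq := sq_nonneg ((ell y k).eval t)
    calc |Y| * |F.Q1 t - F.Q1 Y| * (ell y k).eval t ^ 2 ≤ 2 * ((t - Y) * (F.Q1 t - F.Q1 Y) + 2 * F.Q1 3) * (ell y k).eval t ^ 2 := by gcongr
      _ = _ := by ring
end ON
end GW
end

section
namespace GW
open MeasureTheory Real Set Polynomial
open Polynomial.Chebyshev (measureT T integral_measureT_eq_integral_cos)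

lemma tau_bd (k : ℕ) : π/2 ≤ ∫ x, (T ℝ k).eval x * (T ℝ k).eval x ∂measureT ∧ ∫ x, (T ℝ k).eval x * (T ℝ k).eval x ∂measureT ≤ π := by
  have := pi_pos
  by_cases hk : k = 0
  · subst hk
    have := Polynomial.Chebyshev.integral_eval_T_real_mul_self_measureT_zero
    simp only [Nat.cast_zero]
    rw [this]; constructor <;> linarith
  · rw [Polynomial.Chebyshev.integral_T_real_mul_self_measureT_of_ne_zero hk]; constructor <;> linarith

lemma cheb_sq (N : ℕ) (c : ℕ → ℝ) :
    ∫ x, (∑ k ∈ Finset.range N, c k * (T ℝ k).eval x)^2 ∂measureT =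
      ∑ k ∈ Finset.range N, c k ^ 2 * ∫ x, (T ℝ k).eval x * (T ℝ k).eval x ∂measureT := by
  have e : ∀ x, (∑ k ∈ Finset.range N, c k * (T ℝ k).eval x)^2 = ∑ i ∈ Finset.range N, ∑ j ∈ Finset.range N, c i * c j * ((T ℝ i).eval x * (T ℝ j).eval x) := by
    intro x
    rw [sq, Finset.sum_mul_sum]
    refine Finset.sum_congr rfl fun i _ => Finset.sum_congr rfl fun j _ => by ring
  simp_rw [e]
  have hint : ∀ i j : ℕ, Integrable (fun x => c i * c j * ((T ℝ i).eval x * (T ℝ j).eval x)) measureT := by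
    intro i j
    apply Polynomial.Chebyshev.integrable_measureT
    fun_prop
  rw [integral_finsetSum _ (fun i _ => integrable_finsetSum _ fun j _ => hint i j)]
  refine Finset.sum_congr rfl fun i hi => ?_
  rw [integral_finsetSum _ fun j _ => hint i j]
  rw [Finset.sum_eq_single i]
  · rw [integral_const_mul]; ring
  · intro j _ hj
    rw [integral_const_mul, Polynomial.Chebyshev.integral_eval_T_real_mul_eval_T_real_measureT_of_ne (Ne.symm hj), mul_zero]
  · intro h; exact absurd hi h

lemma cheb_nik {N : ℕ} {g : ℝ[X]} (hg : g.natDegree ≤ N) {x : ℝ} (hx : |x| ≤ 1) :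
    g.eval x ^ 2 ≤ (N+1) * (2/π) * ∫ θ in 0..π, g.eval (cos θ) ^ 2 := by
  have hpi := pi_pos
  have hmem : g ∈ degreeLT ℝ (N+1) := by
    rw [mem_degreeLT]
    exact lt_of_le_of_lt (degree_le_of_natDegree_le hg) (by exact_mod_cast Nat.lt_succ_self N)
  rw [← Sequence.span_degreeLT (Polynomial.Chebyshev.chebyshevTsequence ℝ) (by simp),
    show Set.Iio (N+1) = Finset.range (N+1) by simp,
    Submodule.mem_span_image_finset_iff_exists_fun'] at hmem
  obtain ⟨c, hc⟩ := hmem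
  have ev : ∀ t, g.eval t = ∑ k ∈ Finset.range (N+1), c k * (T ℝ k).eval t := by
    intro t
    rw [← hc, eval_finsetSum]
    simp [Polynomial.Chebyshev.chebyshevTsequence]
  have h1 : ∫ θ in 0..π, g.eval (cos θ) ^ 2 = ∑ k ∈ Finset.range (N+1), c k ^ 2 * ∫ x, (T ℝ k).eval x * (T ℝ k).eval x ∂measureT := by
    rw [← cheb_sq, integral_measureT_eq_integral_cos]
    simp_rw [ev]
  have h2 : (π/2) * ∑ k ∈ Finset.range (N+1), c k ^ 2 ≤ ∫ θ in 0..π, g.eval (cos θ) ^ 2 := by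
    rw [h1, Finset.mul_sum]
    refine Finset.sum_le_sum fun k _ => ?_
    rw [mul_comm]
    exact mul_le_mul_of_nonneg_left (tau_bd k).1 (sq_nonneg _)
  have h3 : g.eval x ^ 2 ≤ (N+1) * ∑ k ∈ Finset.range (N+1), c k ^ 2 := by
    rw [ev]
    have := sq_sum_le_card_mul_sum_sq (s := Finset.range (N+1)) (f := fun k => c k * (T ℝ k).eval x)
    rw [Finset.card_range] at this
    push_cast at this
    refine this.trans ?_
    refine mul_le_mul_of_nonneg_left (Finset.sum_le_sum fun k _ => ?_) (by positivity)
    have hT : |(T ℝ k).eval x| ≤ 1 := by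
      have e : x = cos (arccos x) := by rw [cos_arccos (abs_le.1 hx).1 (abs_le.1 hx).2]
      rw [e, Polynomial.Chebyshev.T_real_cos]; exact abs_cos_le_one _
    rw [mul_pow]
    have : (T ℝ k).eval x ^ 2 ≤ 1 := by rw [← sq_abs]; exact pow_le_one₀ (abs_nonneg _) hT
    nlinarith [sq_nonneg (c k)]
  refine h3.trans ?_
  rw [mul_assoc]
  gcongr
  calc ∑ k ∈ Finset.range (N+1), c k ^ 2 = (2/π) * ((π/2) * ∑ k ∈ Finset.range (N+1), c k ^ 2) := by field_simp
    _ ≤ _ := by gcongr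

lemma cos_subst {f : ℝ → ℝ} (hf : Continuous f) {b : ℝ} (hb : 0 < b) :
    ∫ θ in 0..π, f (b * cos θ) * sin θ = (1/b) * ∫ t in (-b)..b, f t := by
  have h := intervalIntegral.integral_comp_mul_deriv (a := 0) (b := π) (f := fun θ => b * cos θ) (f' := fun θ => b * (- sin θ)) (g := f)
    (fun x _ => (hasDerivAt_cos x).const_mul b) (by fun_prop) hf
  simp only [cos_zero, cos_pi, mul_one] at h
  rw [show b * -1 = -b by ring] at h
  have e1 : ∫ θ in 0..π, (f ∘ fun θ => b * cos θ) θ * (b * -sin θ) = (-b) * ∫ θ in 0..π, f (b * cos θ) * sin θ := by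
    rw [← intervalIntegral.integral_const_mul]
    congr 1; ext θ; simp; ring
  rw [e1, intervalIntegral.integral_symm (-b) b] at h
  field_simp; linarith

lemma nik0 {N : ℕ} {g : ℝ[X]} (hg : g.natDegree ≤ N) {b x : ℝ} (hb : 0 < b) (hx : |x| ≤ b/2) :
    g.eval x ^ 2 ≤ 2 * (N+3) / b * ∫ t in (-b)..b, g.eval t ^ 2 := by
  have hpi := pi_pos
  set G : ℝ[X] := (g * (1 - C (1/b^2) * X^2)).comp (C b * X) with hG
  have hGd : G.natDegree ≤ N + 2 := by
    rw [hG, natDegree_comp]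
    have h1 : (C b * X).natDegree ≤ 1 := (natDegree_C_mul_le _ _).trans natDegree_X_le
    have h2 : (g * (1 - C (1/b^2) * X^2)).natDegree ≤ N + 2 := by
      refine natDegree_mul_le.trans (add_le_add hg ?_)
      refine (natDegree_sub_le _ _).trans (max_le (by simp) ?_)
      exact natDegree_C_mul_X_pow_le _ 2
    calc _ ≤ (N+2) * 1 := Nat.mul_le_mul h2 h1
      _ = _ := by ring
  have ev : ∀ s, G.eval s = g.eval (b * s) * (1 - s^2) := by
    intro s; simp [hG]; left; field_simp
  have h1 := cheb_nik hGd (x := x/b) (by rw [abs_div, abs_of_pos hb, div_le_one hb]; linarith)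
  have h2 : ∫ θ in 0..π, G.eval (cos θ) ^ 2 ≤ ∫ θ in 0..π, (fun t => g.eval t ^ 2) (b * cos θ) * sin θ := by
    apply intervalIntegral.integral_mono_on hpi.le
    · apply Continuous.intervalIntegrable; fun_prop
    · apply Continuous.intervalIntegrable; fun_prop
    · intro θ hθ
      have hs := sin_nonneg_of_mem_Icc hθ
      have hs1 := sin_le_one θ
      have e : 1 - cos θ ^ 2 = sin θ ^ 2 := by have := sin_sq_add_cos_sq θ; linarith
      rw [ev, e, mul_pow]
      simp only
      gcongr
      calc (sin θ ^ 2)^2 = sin θ * (sin θ)^3 := by ring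
        _ ≤ sin θ * 1 := by gcongr; exact pow_le_one₀ hs hs1
        _ = sin θ := mul_one _
  have hcs := cos_subst (f := fun t => g.eval t ^ 2) (by fun_prop) hb
  rw [hcs] at h2
  have hx2 : (x/b)^2 ≤ 1/4 := by
    rw [← sq_abs, abs_div, abs_of_pos hb]
    have : |x|/b ≤ 1/2 := by rw [div_le_iff₀ hb]; linarith
    calc (|x|/b)^2 ≤ (1/2)^2 := by gcongr
      _ = 1/4 := by norm_num
  have h3 : (9/16) * g.eval x ^ 2 ≤ G.eval (x/b) ^ 2 := by
    rw [ev, mul_div_cancel₀ _ hb.ne', mul_pow, mul_comm]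
    gcongr
    nlinarith
  set J := ∫ t in (-b)..b, g.eval t ^ 2
  have hJ : 0 ≤ J := by
    apply intervalIntegral.integral_nonneg (by linarith); intro t _; positivity
  have h4 : (9/16) * g.eval x ^ 2 ≤ ((N+2:ℕ)+1) * (2/π) * ((1/b) * J) := by
    refine h3.trans (h1.trans ?_)
    gcongr
  have h5 : (2/π) ≤ 9/8 := by rw [div_le_div_iff₀ hpi (by norm_num)]; linarith [pi_gt_three]
  have h6 : ((N+2:ℕ)+1) * (2/π) * ((1/b) * J) ≤ ((N+2:ℕ)+1) * (9/8) * ((1/b) * J) := by gcongr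
  push_cast at h4 h6
  have e : 2 * (N+3) / b * J = (16/9) * (((N:ℝ)+2+1) * (9/8) * ((1/b) * J)) := by ring
  rw [e]; linarith

namespace Fr
variable (F : Fr)

lemma Q2_le' {s b : ℝ} (hb : 0 < b) (hs : |s| ≤ b) : F.Q2 s ≤ (F.D - 1) * F.q b := by
  have hD := F.D1
  have key : ∀ s, 0 < s → s ≤ b → F.Q2 s ≤ (F.D - 1) * F.q b := by
    intro s h0 h1
    refine (F.Q2_le h0).trans ?_
    have := F.q_mono h0 h1
    gcongr
  have h2 : closure (Ioc 0 b) ⊆ {x | F.Q2 x ≤ (F.D - 1) * F.q b} :=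
    closure_minimal (fun x hx => key x hx.1 hx.2) (isClosed_le F.cQ2 continuous_const)
  rw [closure_Ioc hb.ne] at h2
  have := h2 (show |s| ∈ Icc 0 b from ⟨abs_nonneg s, hs⟩)
  simp only [mem_ofPred_eq] at this
  rcases abs_choice s with h | h <;> rw [h] at this
  · exact this
  · rwa [F.Q2_neg] at this

lemma Q_taylor {x t b : ℝ} (hb : 0 < b) (hx : |x| ≤ b) (ht : |t| ≤ b) :
    F.Q t ≤ F.Q x + F.Q1 x * (t - x) + (F.D - 1) * F.q b / 2 * (t - x)^2 := by
  set M := (F.D - 1) * F.q b with hM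
  have hI : ∀ s ∈ uIcc x t, |s| ≤ b := by
    intro s hs
    have := (convex_Icc (-b) b).ordConnected.uIcc_subset (abs_le.1 hx) (abs_le.1 ht) hs
    exact abs_le.2 this
  have g1 : ∀ s, HasDerivAt (fun s => F.Q1 s - M * s) (F.Q2 s - M) s := fun s =>
    ((F.d2 s).sub ((hasDerivAt_id s).const_mul M)).congr_deriv (by ring)
  have anti : AntitoneOn (fun s => F.Q1 s - M * s) (uIcc x t) := by
    apply antitoneOn_of_deriv_nonpos (convex_uIcc x t)
    · intro s _; exact (g1 s).continuousAt.continuousWithinAt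
    · intro s _; exact (g1 s).differentiableAt.differentiableWithinAt
    · intro s hs
      rw [(g1 s).deriv]
      have := F.Q2_le' hb (hI s (interior_subset hs)); linarith
  have g2 : ∀ s, HasDerivAt (fun s => F.Q s - F.Q1 x * (s - x) - M/2 * (s-x)^2) (F.Q1 s - F.Q1 x - M * (s - x)) s := by
    intro s
    have h1 := ((hasDerivAt_id s).sub_const x)
    exact (((F.d1 s).sub (h1.const_mul (F.Q1 x))).sub ((h1.pow 2).const_mul (M/2))).congr_deriv (by simp; ring)
  rcases le_total x t with hxt | hxt
  · rw [uIcc_of_le hxt] at anti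
    have : AntitoneOn (fun s => F.Q s - F.Q1 x * (s - x) - M/2 * (s-x)^2) (Icc x t) := by
      apply antitoneOn_of_deriv_nonpos (convex_Icc x t)
      · intro s _; exact (g2 s).continuousAt.continuousWithinAt
      · intro s _; exact (g2 s).differentiableAt.differentiableWithinAt
      · intro s hs
        rw [(g2 s).deriv]
        have hs' := interior_subset hs
        have := anti (left_mem_Icc.2 hxt) hs' hs'.1
        simp only at this; linarith
    have := this (left_mem_Icc.2 hxt) (right_mem_Icc.2 hxt) hxt
    simp only [sub_self] at this; linarith
  · rw [uIcc_of_ge hxt] at anti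
    have : MonotoneOn (fun s => F.Q s - F.Q1 x * (s - x) - M/2 * (s-x)^2) (Icc t x) := by
      apply monotoneOn_of_deriv_nonneg (convex_Icc t x)
      · intro s _; exact (g2 s).continuousAt.continuousWithinAt
      · intro s _; exact (g2 s).differentiableAt.differentiableWithinAt
      · intro s hs
        rw [(g2 s).deriv]
        have hs' := interior_subset hs
        have := anti hs' (right_mem_Icc.2 hxt) hs'.2
        simp only at this; linarith
    have := this (left_mem_Icc.2 hxt) (right_mem_Icc.2 hxt) hxt
    simp only [sub_self] at this; linarith

lemma I_ge_interval {f : ℝ → ℝ} (hf : PG f) (h0 : ∀ t, 0 ≤ f t) {b : ℝ} (hb : 0 < b) :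
    ∫ t in (-b)..b, f t * F.w t ≤ F.I f := by
  rw [intervalIntegral.integral_of_le (by linarith)]
  exact setIntegral_le_integral (F.integrable hf) (Filter.Eventually.of_forall fun t => mul_nonneg (h0 t) (F.w_pos t).le)

theorem nik (K : ℕ) (hK : 1 ≤ K) : ∃ C : ℝ, 0 < C ∧ ∀ (n : ℕ) (a : ℝ), 1 ≤ n → 0 < a → F.R a = n →
    ∀ p : ℝ[X], p.natDegree ≤ n → ∀ x, |x| ≤ K * a →
      p.eval x ^ 2 * F.w x ≤ C * (n / a) * F.I (fun t => p.eval t ^ 2) := by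
  set k0 : ℕ := 8 * K^2 * F.D * (2*K)^F.D with hk0
  have hK' : (1:ℝ) ≤ K := by exact_mod_cast hK
  refine ⟨2 * (1 + 2 * k0 + 3) / (2 * K), by positivity, ?_⟩
  intro n a hn ha hRa p hp x hx
  have hn' : (1:ℝ) ≤ n := by exact_mod_cast hn
  have hD := F.D1
  set b : ℝ := 2 * K * a with hb
  have hb0 : 0 < b := by positivity
  have hqa : F.q a = n / a^2 := by rw [← hRa, ← q_mul_sq]; field_simp
  have hqb : F.q b ≤ (2*K)^F.D * (n / a^2) := by
    have := F.q_upper ha (t := b) (by rw [hb]; nlinarith)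
    rw [hqa] at this
    have e : b / a = 2 * K := by rw [hb]; field_simp
    rwa [e] at this
  have hqb0 := F.q_pos hb0
  set M := (F.D - 1) * F.q b with hM
  have hxb : |x| ≤ b := by rw [hb]; nlinarith
  have hQ1x : |F.Q1 x| ≤ F.q b * b := by
    rw [q_mul_self, ← F.Q1_abs]; exact F.Q1_mono.monotone hxb
  set m' : ℕ := k0 * n with hm'
  have hk0pos : 1 ≤ k0 := by
    rw [hk0]; have := F.hD
    have : 0 < 8 * K^2 * F.D * (2*K)^F.D := by positivity
    exact this
  have hm'0 : (1:ℝ) ≤ m' := by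
    rw [hm']; exact_mod_cast Nat.mul_pos hk0pos hn
  set Φ : ℝ → ℝ := fun t => F.Q1 x * (t - x) + M/2 * (t-x)^2 with hΦ
  have hΦle : ∀ t, |t| ≤ b → Φ t ≤ m' := by
    intro t ht
    have htx : |t - x| ≤ 4 * K * a := by
      have := abs_sub t x
      have : |x| ≤ K * a := hx
      calc |t - x| ≤ |t| + |x| := by assumption
        _ ≤ b + b := by linarith
        _ = _ := by rw [hb]; ring
    have h1 : F.Q1 x * (t - x) ≤ (F.q b * b) * (4*K*a) := by
      calc F.Q1 x * (t-x) ≤ |F.Q1 x| * |t - x| := by rw [← abs_mul]; exact le_abs_self _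
        _ ≤ _ := by gcongr
    have h2 : M/2 * (t-x)^2 ≤ M/2 * (4*K*a)^2 := by
      rw [← sq_abs]
      have : 0 ≤ M := by rw [hM]; have : (0:ℝ) ≤ F.D - 1 := by linarith
                         positivity
      gcongr
    calc Φ t ≤ (F.q b * b) * (4*K*a) + M/2 * (4*K*a)^2 := add_le_add h1 h2
      _ = 8 * K^2 * F.D * F.q b * a^2 := by rw [hM, hb]; ring
      _ ≤ 8 * K^2 * F.D * ((2*K)^F.D * (n / a^2)) * a^2 := by gcongr
      _ = m' := by rw [hm', hk0]; push_cast; field_simp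
  set S : ℝ[X] := (1 - C (1/(2*(m':ℝ))) * (C (F.Q1 x) * (X - C x) + C (M/2) * (X - C x)^2))^m' with hS
  have hSev : ∀ t, S.eval t = (1 - Φ t / (2*m'))^m' := by
    intro t; simp [hS, hΦ]; ring
  have hSd : S.natDegree ≤ 2 * m' := by
    rw [hS]
    refine natDegree_pow_le.trans ?_
    rw [mul_comm]
    apply Nat.mul_le_mul_right
    refine (natDegree_sub_le _ _).trans (max_le (by simp) ?_)
    refine (natDegree_C_mul_le _ _).trans ?_
    refine (natDegree_add_le _ _).trans (max_le ?_ ?_)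
    · refine (natDegree_C_mul_le _ _).trans ?_
      rw [natDegree_X_sub_C]; norm_num
    · refine (natDegree_C_mul_le _ _).trans ?_
      refine natDegree_pow_le.trans ?_
      rw [natDegree_X_sub_C]
  have hSx : S.eval x = 1 := by rw [hSev]; simp [hΦ]
  have hdeg : (p * S).natDegree ≤ n + 2 * m' := natDegree_mul_le.trans (add_le_add hp hSd)
  have h1 := nik0 hdeg hb0 (x := x) (by rw [hb]; linarith)
  have h2 : ∫ t in (-b)..b, (p * S).eval t ^ 2 ≤ ∫ t in (-b)..b, (Real.exp (F.Q x)) * (p.eval t ^ 2 * F.w t) := by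
    apply intervalIntegral.integral_mono_on (by linarith)
    · apply Continuous.intervalIntegrable; fun_prop
    · apply Continuous.intervalIntegrable; have := F.w_cont; fun_prop
    · intro t ht
      have ht' : |t| ≤ b := abs_le.2 ht
      have hT := F.Q_taylor hb0 hxb ht'
      have hle := hΦle t ht'
      have hnn : 0 ≤ 1 - Φ t / (2*m') := by
        have : Φ t / (2*m') ≤ 1 := by rw [div_le_one (by positivity)]; linarith
        linarith
      have hSS : S.eval t ^ 2 ≤ Real.exp (-Φ t) := by
        rw [hSev, ← pow_mul]
        have h3 : 1 - Φ t/(2*m') ≤ Real.exp (-(Φ t/(2*m'))) := by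
          have := Real.add_one_le_exp (-(Φ t/(2*m'))); linarith
        calc _ ≤ (Real.exp (-(Φ t/(2*m'))))^(m'*2) := by gcongr
          _ = _ := by
            rw [← Real.exp_nat_mul]; congr 1; push_cast; field_simp
      have hE : Real.exp (-Φ t) ≤ Real.exp (F.Q x) * F.w t := by
        rw [w, ← Real.exp_add]; apply Real.exp_le_exp.2
        simp only [hΦ]; linarith
      rw [eval_mul, mul_pow]
      calc p.eval t ^ 2 * S.eval t ^2 ≤ p.eval t ^ 2 * (Real.exp (F.Q x) * F.w t) := by
            gcongr; exact hSS.trans hE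
        _ = _ := by ring
  rw [intervalIntegral.integral_const_mul] at h2
  have h3 := F.I_ge_interval (f := fun t => p.eval t ^ 2) (by fun_prop) (fun t => sq_nonneg _) hb0
  set J := F.I (fun t => p.eval t ^ 2)
  have hJ : 0 ≤ J := Fr.I_nonneg fun t => sq_nonneg _
  rw [eval_mul, hSx, mul_one] at h1
  have h4 : p.eval x ^ 2 ≤ 2 * ((n + 2 * m' : ℕ) + 3) / b * (Real.exp (F.Q x) * J) := by
    refine h1.trans ?_
    gcongr
    exact h2.trans (by gcongr)
  have h5 : 2 * (((n + 2 * m' : ℕ):ℝ) + 3) / b ≤ 2 * (1 + 2 * k0 + 3) / (2 * K) * (n/a) := by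
    have : 2 * (1 + 2 * k0 + 3) / (2 * K) * (n/a) = 2 * (n + 2 * (k0 * n) + 3 * n) / b := by
      rw [hb]; field_simp
    rw [this, hm']; push_cast
    gcongr; linarith
  have e : Real.exp (F.Q x) * F.w x = 1 := by rw [w, ← Real.exp_add]; simp
  calc p.eval x ^ 2 * F.w x ≤ (2 * (1 + 2 * k0 + 3) / (2 * K) * (n/a) * (Real.exp (F.Q x) * J)) * F.w x := by
        apply mul_le_mul_of_nonneg_right _ (F.w_pos x).le
        refine h4.trans ?_
        gcongr
    _ = 2 * (1 + 2 * k0 + 3) / (2 * K) * (n/a) * J * (Real.exp (F.Q x) * F.w x) := by ring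
    _ = _ := by rw [e, mul_one]
end Fr
end GW
end

section
namespace GW
open MeasureTheory Real Set Polynomial
set_option linter.unusedSectionVars false

noncomputable def Fr.N (F : Fr) : ℝ := Classical.choose (F.nik 12 (by norm_num))
lemma Fr.N_pos (F : Fr) : 0 < F.N := (Classical.choose_spec (F.nik 12 (by norm_num))).1
lemma Fr.nik' (F : Fr) {n : ℕ} {a : ℝ} (hn : 1 ≤ n) (ha : 0 < a) (hRa : F.R a = n) {p : ℝ[X]} (hp : p.natDegree ≤ n)
    {x : ℝ} (hx : |x| ≤ 12 * a) : p.eval x ^ 2 * F.w x ≤ F.N * (n / a) * F.I (fun t => p.eval t ^ 2) :=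
  (Classical.choose_spec (F.nik 12 (by norm_num))).2 n a hn ha hRa p hp x (by exact_mod_cast hx)
lemma Fr.exp_w (F : Fr) (x : ℝ) : Real.exp (F.Q x) * F.w x = 1 := by rw [w, ← Real.exp_add]; simp

namespace ON
variable {F : Fr} {P : ℕ → ℝ[X]} (h : ON F P) {n : ℕ} {a : ℝ} (hn : 1 ≤ n) (ha : 0 < a) (hRa : F.R a = n)
include h hn ha hRa

lemma p_le {x : ℝ} (hx : |x| ≤ 12 * a) : (P n).eval x ^ 2 * F.w x ≤ F.N * (n/a) := by
  have := F.nik' hn ha hRa (h.deg n).le hx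
  rwa [h.norm, mul_one] at this

lemma nik_sum {y : Fin n → ℝ} (hy : Function.Injective y) (hz : ∀ k, (P n).eval (y k) = 0) {x : ℝ} (hx : |x| ≤ 12 * a) :
    (∑ k, (ell y k).eval x ^ 2 / lam F y k) * F.w x ≤ F.N * (n/a) := by
  have hl : ∀ k, 0 < lam F y k := fun k => lam_pos hy k
  set S : ℝ[X] := ∑ k, C ((ell y k).eval x / lam F y k) * ell y k with hS
  set s := ∑ k, (ell y k).eval x ^ 2 / lam F y k with hs
  have hSd : S.natDegree ≤ n := by
    refine natDegree_sum_le_of_forall_le _ _ fun k _ => ?_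
    refine (natDegree_C_mul_le _ _).trans ?_
    rw [ell_natDegree hy]; omega
  have hSx : S.eval x = s := by
    rw [hS, hs, eval_finsetSum]
    refine Finset.sum_congr rfl fun k _ => ?_
    rw [eval_mul, eval_C]; ring
  have hSy : ∀ k, S.eval (y k) = (ell y k).eval x / lam F y k := by
    intro k
    rw [hS, eval_finsetSum, Finset.sum_eq_single k]
    · rw [eval_mul, eval_C, ell_self hy, mul_one]
    · intro j _ hj
      rw [eval_mul, eval_C, ell_ne hy hj, mul_zero]
    · simp
  have hI : F.I (fun t => S.eval t ^ 2) = s := by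
    have e : ∀ t, S.eval t ^ 2 = ∑ k, ((ell y k).eval x / lam F y k) * ((ell y k).eval t * S.eval t) := by
      intro t
      rw [sq]
      nth_rewrite 1 [hS]
      rw [eval_finsetSum, Finset.sum_mul]
      refine Finset.sum_congr rfl fun k _ => ?_
      rw [eval_mul, eval_C]; ring
    rw [Fr.I_congr e, Fr.I_sum _ (fun k => by fun_prop)]
    refine Finset.sum_congr rfl fun k _ => ?_
    rw [Fr.I_smul, h.I_ell hy hz k hSd, hSy]
    have := (hl k).ne'
    field_simp
  have h1 := F.nik' hn ha hRa hSd hx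
  rw [hSx, hI] at h1
  have hs0 : 0 ≤ s := Finset.sum_nonneg fun k _ => div_nonneg (sq_nonneg _) (hl k).le
  rcases hs0.eq_or_lt with h0 | h0
  · rw [← h0, zero_mul]; have := F.N_pos; positivity
  · have : s * (s * F.w x) ≤ s * (F.N * (n/a)) := by nlinarith
    exact le_of_mul_le_mul_left this h0

set_option maxHeartbeats 1000000 in
lemma e5_aux {m : ℕ} (hm : n = m + 1) {x : ℝ} (hx : |x| ≤ a/72) (hB : (P m).eval x ≠ 0) :
    (P n).eval x ^ 2 * F.w x ≤ 432 * F.N / a := by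
  have hn' : (1:ℝ) ≤ n := by exact_mod_cast hn
  have hw := F.w_pos x
  have hr := h.al_ge hn ha hRa hm
  have hr0 := h.al_pos m
  set A := (P n).eval x with hA
  set B := (P m).eval x with hBd
  set r := al P m with hrd
  set E : ℝ[X] := C B * P n - C A * P m with hE
  have hroot : E.IsRoot x := by simp [hE, IsRoot.def, ← hA, ← hBd]; ring
  obtain ⟨S, hS⟩ := dvd_iff_isRoot.2 hroot
  have hEd : E.natDegree ≤ n := by
    refine (natDegree_sub_le _ _).trans (max_le ?_ ?_)
    · exact (natDegree_C_mul_le _ _).trans (h.deg n).le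
    · refine (natDegree_C_mul_le _ _).trans ?_
      rw [h.deg]; omega
  have degAux : ∀ {g : ℝ[X]} {N : ℕ}, ((X - C x) * g).natDegree ≤ N + 1 → g.natDegree ≤ N := by
    intro g N hg
    by_cases h0 : g = 0
    · simp [h0]
    · rw [natDegree_mul (X_sub_C_ne_zero x) h0, natDegree_X_sub_C] at hg; omega
  have hSd : S.natDegree ≤ m := degAux (by rw [← hS]; omega)
  have hSev : ∀ t, (t - x) * S.eval t = B * (P n).eval t - A * (P m).eval t := by
    intro t
    have := congrArg (eval t) hS
    simp [hE] at this; linarith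
  have hgn := h.ga_pos n
  have hgm := h.ga_pos m
  have hScoeff : S.coeff m = B * (P n).coeff n := by
    have h1 := congrArg (fun p => coeff p n) hS
    simp only [hE, coeff_sub, coeff_C_mul] at h1
    rw [coeff_eq_zero_of_natDegree_lt (p := P m) (by rw [h.deg]; omega)] at h1
    rw [sub_mul, coeff_sub, coeff_C_mul, coeff_eq_zero_of_natDegree_lt (p := S) (n := n) (by omega), hm, coeff_X_mul] at h1
    rw [hm]; linarith
  have hr_eq : r = (P m).coeff m / (P n).coeff n := by rw [hrd, al, hm]
  have IPmS : F.I (fun t => (P m).eval t * S.eval t) = B / r := by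
    rw [h.tool hSd, hScoeff, hr_eq]; field_simp
  have IPnS : F.I (fun t => (P n).eval t * S.eval t) = 0 := by
    apply h.orth
    exact lt_of_le_of_lt (degree_le_of_natDegree_le hSd) (by rw [hm]; exact_mod_cast Nat.lt_succ_self m)
  have Ilow : ∀ g : ℝ[X], g.degree < m → F.I (fun t => (t - x) * S.eval t * g.eval t) = 0 := by
    intro g hg
    have e : ∀ t, (t - x) * S.eval t * g.eval t = B * ((P n).eval t * g.eval t) - A * ((P m).eval t * g.eval t) := by
      intro t; rw [hSev]; ring
    rw [Fr.I_congr e, Fr.I_sub (by fun_prop) (by fun_prop), Fr.I_smul, Fr.I_smul, h.orth m g hg, h.orth n g (hg.trans (by rw [hm]; exact_mod_cast Nat.lt_succ_self m))]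
    ring
  have ES : F.I (fun t => (t - x) * S.eval t ^ 2) = - (A * B / r) := by
    have e : ∀ t, (t - x) * S.eval t ^ 2 = B * ((P n).eval t * S.eval t) - A * ((P m).eval t * S.eval t) := by
      intro t; rw [sq, ← mul_assoc, hSev]; ring
    rw [Fr.I_congr e, Fr.I_sub (by fun_prop) (by fun_prop), Fr.I_smul, Fr.I_smul, IPnS, IPmS]; ring
  have key : ∀ g : ℝ[X], g.natDegree ≤ m → F.I (fun t => S.eval t * g.eval t) = g.eval x * F.I (fun t => S.eval t) := by
    intro g hg
    obtain ⟨u, hu⟩ := dvd_iff_isRoot.2 (show (g - C (g.eval x)).IsRoot x by simp)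
    have hud : u.degree < m := by
      by_cases h0 : u = 0
      · rw [h0, degree_zero]; exact WithBot.bot_lt_coe m
      have h1 : (g - C (g.eval x)).natDegree ≤ m := by
        refine (natDegree_sub_le _ _).trans (max_le hg (by simp))
      rw [hu, natDegree_mul (X_sub_C_ne_zero x) h0, natDegree_X_sub_C] at h1
      rw [degree_eq_natDegree h0]
      exact_mod_cast (by omega : u.natDegree < m)
    have e : ∀ t, S.eval t * g.eval t = g.eval x * S.eval t + (t - x) * S.eval t * u.eval t := by
      intro t
      have := congrArg (eval t) hu
      simp at this
      linear_combination (S.eval t) * this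
    rw [Fr.I_congr e, Fr.I_add (by fun_prop) (by fun_prop), Fr.I_smul, Ilow u hud, add_zero]
  have IS : F.I (fun t => S.eval t) = 1 / r := by
    have h1 := key (P m) (h.deg m).le
    have h2 : F.I (fun t => S.eval t * (P m).eval t) = B / r := by
      rw [← IPmS]; exact Fr.I_congr fun t => mul_comm _ _
    rw [h2] at h1
    apply mul_left_cancel₀ hB
    rw [← h1]; ring
  have IS2 : F.I (fun t => S.eval t ^ 2) = S.eval x / r := by
    have h1 := key S hSd
    rw [IS] at h1
    rw [Fr.I_congr (g := fun t => S.eval t * S.eval t) (fun t => sq _), h1]; ring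
  have IQ : F.I (fun t => (t - x) * F.Q1 t * S.eval t ^ 2) = F.I (fun t => S.eval t ^ 2) := by
    have h1 := Fr.I_parts (F := F) ((X - C x) * S ^ 2)
    have e1 : ∀ t, ((X - C x) * S ^ 2).derivative.eval t = S.eval t ^ 2 + 2 * ((t - x) * S.eval t * S.derivative.eval t) := by
      intro t; simp [derivative_mul, derivative_pow]; ring
    have e2 : ∀ t, ((X - C x) * S ^ 2).eval t * F.Q1 t = (t - x) * F.Q1 t * S.eval t ^ 2 := by
      intro t; simp; ring
    have hd : S.derivative.degree < m := by
      by_cases h0 : S = 0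
      · rw [h0]; simp
      · exact lt_of_lt_of_le (degree_derivative_lt h0) (degree_le_of_natDegree_le hSd)
    rw [Fr.I_congr e1, Fr.I_congr e2, Fr.I_add (by fun_prop) (by fun_prop), Fr.I_smul, Ilow _ hd] at h1
    linarith
  have hpQ := F.pg_Q1
  have hpq := F.pg_q
  have IC : F.I (fun t => (t - x) * (F.Q1 t - F.Q1 x) * S.eval t ^ 2) = F.I (fun t => S.eval t ^ 2) + F.Q1 x * (A * B / r) := by
    have e : ∀ t, (t - x) * (F.Q1 t - F.Q1 x) * S.eval t ^ 2 = (t - x) * F.Q1 t * S.eval t ^ 2 - F.Q1 x * ((t-x) * S.eval t ^ 2) := by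
      intro t; ring
    rw [Fr.I_congr e, Fr.I_sub (by fun_prop) (by fun_prop), Fr.I_smul, IQ, ES]; ring
  have Iodd : F.I (fun t => F.q t * ((P n).eval t * (P m).eval t)) = 0 := by
    apply Fr.I_odd
    intro t
    rw [F.q_neg, h.parity, h.parity, hm]
    have : ((-1:ℝ)^m)^2 = 1 := by rw [← pow_mul, mul_comm, pow_mul]; simp
    rw [pow_succ]; linear_combination (- F.q t * ((P (m+1)).eval t * (P m).eval t)) * this
  have IE : F.I (fun t => (1/2) * ((t-x)^2 * F.q t * S.eval t ^ 2)) = (1/2) * (B^2 * F.I (fun t => F.q t * (P n).eval t ^ 2) + A^2 * F.I (fun t => F.q t * (P m).eval t ^ 2)) := by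
    have e : ∀ t, (t-x)^2 * F.q t * S.eval t ^ 2 = B^2 * (F.q t * (P n).eval t ^ 2) + A^2 * (F.q t * (P m).eval t ^ 2) - (2 * A * B) * (F.q t * ((P n).eval t * (P m).eval t)) := by
      intro t
      have := hSev t
      calc (t-x)^2 * F.q t * S.eval t ^ 2 = F.q t * ((t - x) * S.eval t)^2 := by ring
        _ = _ := by rw [this]; ring
    rw [Fr.I_smul, Fr.I_congr e, Fr.I_sub (by fun_prop) (by fun_prop), Fr.I_add (by fun_prop) (by fun_prop), Fr.I_smul, Fr.I_smul, Fr.I_smul, Iodd]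
    ring
  have hmain : F.I (fun t => (1/2) * ((t-x)^2 * F.q t * S.eval t ^ 2)) ≤ F.I (fun t => (t - x) * (F.Q1 t - F.Q1 x) * S.eval t ^ 2) := by
    apply Fr.I_mono (by fun_prop) (by fun_prop)
    intro t
    have := F.conv1 t x
    have := mul_le_mul_of_nonneg_right this (sq_nonneg (S.eval t))
    linarith
  rw [IE, IC] at hmain
  have hH := h.H_ge hn ha hRa hm
  have hH' := h.H_ge' hn ha hRa hm
  have hlow : n / (24 * a^2) * (A^2 + B^2) ≤ (1/2) * (B^2 * F.I (fun t => F.q t * (P n).eval t ^ 2) + A^2 * F.I (fun t => F.q t * (P m).eval t ^ 2)) := by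
    have h1 : B^2 * (n / (8*a^2)) ≤ B^2 * F.I (fun t => F.q t * (P n).eval t ^ 2) := by gcongr
    have h2 : A^2 * (n / (12*a^2)) ≤ A^2 * F.I (fun t => F.q t * (P m).eval t ^ 2) := by gcongr
    have h3 : n / (24 * a^2) * (A^2 + B^2) = (1/2) * (A^2 * (n / (12*a^2)) + B^2 * (n / (8*a^2))) - B^2 * (n/(48*a^2)) := by
      field_simp; ring
    have h4 : 0 ≤ B^2 * (n/(48*a^2)) := by positivity
    linarith
  have hQ1x : |F.Q1 x| ≤ n / (72 * a) := by
    rw [← F.Q1_abs, ← F.q_mul_self]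
    have h1 : F.q |x| ≤ F.q a := F.q_mono' (by rw [abs_abs, abs_of_pos ha]; linarith)
    have h2 : F.q a = n / a^2 := by rw [← hRa, ← F.q_mul_sq]; field_simp
    rw [h2] at h1
    calc F.q |x| * |x| ≤ n/a^2 * (a/72) := by gcongr
      _ = _ := by field_simp
  have hAB : F.Q1 x * (A * B / r) ≤ n / (48 * a^2) * (A^2 + B^2) := by
    have h1 : F.Q1 x * (A*B/r) ≤ |F.Q1 x| * (|A * B| / r) := by
      calc _ ≤ |F.Q1 x * (A * B/r)| := le_abs_self _
        _ = _ := by rw [abs_mul, abs_div, abs_of_pos hr0]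
    have h2 : |A * B| ≤ (A^2+B^2)/2 := by
      have := two_mul_le_add_sq |A| |B|
      rw [sq_abs, sq_abs] at this
      rw [abs_mul]; linarith only [this]
    calc _ ≤ |F.Q1 x| * (|A * B| / r) := h1
      _ ≤ n / (72*a) * (((A^2+B^2)/2) / (a/3)) := by gcongr
      _ = _ := by field_simp; ring
  have hnik := F.nik' hn ha hRa (p := S) (by omega) (x := x) (by linarith)
  rw [IS2] at hnik hmain
  have hSx0 : 0 ≤ S.eval x := by
    have : 0 ≤ S.eval x / r := by rw [← IS2]; exact Fr.I_nonneg fun t => sq_nonneg _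
    rw [div_nonneg_iff] at this
    rcases this with h1 | h1
    · exact h1.1
    · linarith
  have hN := F.N_pos
  have hSle : S.eval x * F.w x ≤ F.N * (n/a) * (3/a) := by
    have hri : 1 / r ≤ 3 / a := by rw [div_le_div_iff₀ hr0 ha]; linarith
    rcases hSx0.eq_or_lt with h0 | h0
    · rw [← h0, zero_mul]; positivity
    · have h1 : S.eval x * F.w x ≤ F.N * (n/a) * (1/r) := by
        apply le_of_mul_le_mul_left _ h0
        calc _ = S.eval x ^ 2 * F.w x := by ring
          _ ≤ _ := hnik
          _ = _ := by ring
      refine h1.trans ?_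
      gcongr
  have hfin : n / (48 * a^2) * (A^2 + B^2) ≤ S.eval x / r := by
    have : n / (24 * a^2) * (A^2+B^2) = 2 * (n / (48 * a^2) * (A^2 + B^2)) := by field_simp; ring
    linarith
  have hfin2 : n / (48 * a^2) * (A^2 * F.w x) ≤ F.N * (n/a) * (3/a) * (3/a) := by
    calc n / (48 * a^2) * (A^2 * F.w x) ≤ n / (48 * a^2) * (A^2 + B^2) * F.w x := by
          rw [mul_assoc]; gcongr; nlinarith [sq_nonneg B]
      _ ≤ S.eval x / r * F.w x := by gcongr
      _ = S.eval x * F.w x * (1 / r) := by ring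
      _ ≤ F.N * (n/a) * (3/a) * (3/a) := by
        have hri : 1 / r ≤ 3 / a := by rw [div_le_div_iff₀ hr0 ha]; linarith
        gcongr
  have e : n / (48 * a^2) * (432 * F.N / a) = F.N * (n/a) * (3/a) * (3/a) := by field_simp; ring
  rw [← e] at hfin2
  exact le_of_mul_le_mul_left hfin2 (by positivity)

lemma e5 {x : ℝ} (hx : |x| < a/72) : (P n).eval x ^ 2 * F.w x ≤ 432 * F.N / a := by
  obtain ⟨m, hm⟩ : ∃ m, n = m + 1 := ⟨n-1, by omega⟩
  by_contra hcon
  push Not at hcon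
  have hw := F.w_cont
  have ho : IsOpen ({x : ℝ | |x| < a/72} ∩ {x | 432 * F.N / a < (P n).eval x ^ 2 * F.w x}) :=
    (isOpen_lt (by fun_prop) (by fun_prop)).inter (isOpen_lt (by fun_prop) (by fun_prop))
  have hfinite : {x | (P m).IsRoot x}.Finite := finite_setOfPred_isRoot (h.ne0 m)
  have hd := hfinite.countable.dense_compl ℝ
  obtain ⟨z, hz1, hz2⟩ := hd.inter_open_nonempty _ ho ⟨x, hx, hcon⟩
  have := h.e5_aux hn ha hRa hm (x := z) (le_of_lt hz1.1) hz2
  exact absurd hz1.2 (not_lt.2 this)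

end ON
end GW
end

section
namespace GW
open MeasureTheory Real Set Polynomial
open Polynomial.Chebyshev (measureT T integral_measureT_eq_integral_cos)
set_option linter.unusedSectionVars false

lemma T_big {s : ℝ} (hs : 1 ≤ |s|) (k : ℕ) : |(T ℝ k).eval s| ≤ (3 * |s|)^k := by
  have key : ∀ k : ℕ, |(T ℝ k).eval s| ≤ (3 * |s|)^k ∧ |(T ℝ (k+1 : ℕ)).eval s| ≤ (3 * |s|)^(k+1) := by
    intro k
    induction k with
    | zero => simp; linarith
    | succ k ih =>
      refine ⟨ih.2, ?_⟩
      have e : (T ℝ ((k+1+1 : ℕ):ℤ)).eval s = 2 * s * (T ℝ ((k+1:ℕ):ℤ)).eval s - (T ℝ (k:ℤ)).eval s := by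
        have := Polynomial.Chebyshev.T_add_two ℝ k
        push_cast
        rw [show (k:ℤ) + 1 + 1 = k + 2 by ring, this]; simp
      rw [e]
      have h1 := abs_sub (2 * s * (T ℝ ((k+1:ℕ):ℤ)).eval s) ((T ℝ (k:ℤ)).eval s)
      rw [abs_mul, abs_mul, abs_two] at h1
      have h2 : 2 * |s| * |(T ℝ ((k+1:ℕ):ℤ)).eval s| ≤ 2 * |s| * (3 * |s|)^(k+1) := by gcongr; exact ih.2
      have h3 := ih.1
      have h4 : (3*|s|)^k ≤ |s| * (3*|s|)^(k+1) := by
        rw [pow_succ]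
        have : 0 ≤ (3*|s|)^k := by positivity
        nlinarith [mul_nonneg this (by nlinarith : 0 ≤ |s| * (3*|s|) - 1)]
      calc _ ≤ 2 * |s| * (3 * |s|)^(k+1) + |s| * (3*|s|)^(k+1) := by linarith
        _ = _ := by ring
  exact (key k).1

lemma cos_sum {θ : ℝ} (hθ : cos θ ^ 2 ≤ 1/64) (L : ℕ) : (L:ℝ)/4 ≤ ∑ k ∈ Finset.range (2*L), cos (k * θ) ^ 2 := by
  induction L with
  | zero => simp
  | succ L ih =>
    rw [show 2 * (L+1) = 2*L+1+1 by ring, Finset.sum_range_succ, Finset.sum_range_succ]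
    have e : cos (((2*L+1:ℕ):ℝ) * θ) = cos (((2*L:ℕ):ℝ) * θ) * cos θ - sin (((2*L:ℕ):ℝ) * θ) * sin θ := by
      rw [← cos_add]; congr 1; push_cast; ring
    have h1 := sin_sq_add_cos_sq (((2*L:ℕ):ℝ) * θ)
    have h2 := sin_sq_add_cos_sq θ
    set u := cos (((2*L:ℕ):ℝ) * θ)
    set v := cos (((2*L+1:ℕ):ℝ) * θ)
    set s := sin (((2*L:ℕ):ℝ) * θ)
    have h3 : s^2 * sin θ ^ 2 ≤ 2 * (u^2 * cos θ^2) + 2 * v^2 := by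
      have : s * sin θ = u * cos θ - v := by linarith
      have h4 : s^2 * sin θ^2 = (u * cos θ - v)^2 := by rw [← this]; ring
      rw [h4]; nlinarith [sq_nonneg (u * cos θ + v)]
    have h5 : s^2 * (63/64) ≤ s^2 * sin θ^2 := by gcongr; linarith
    have h6 : u^2 * cos θ^2 ≤ u^2 * (1/64) := by gcongr
    push_cast
    nlinarith [sq_nonneg u, sq_nonneg v]

namespace Fr
variable (F : Fr)
lemma Q1_small {n : ℕ} {a x ρ : ℝ} (ha : 0 < a) (hRa : F.R a = n) (h1 : ρ ≤ 1) (hx : |x| ≤ ρ * a) : |F.Q1 x| ≤ ρ * (n / a) := by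
  rw [← F.Q1_abs, ← F.q_mul_self]
  have h1 : F.q |x| ≤ F.q a := F.q_mono' (by rw [abs_abs, abs_of_pos ha]; nlinarith)
  have h2 : F.q a = n / a^2 := by rw [← hRa, ← F.q_mul_sq]; field_simp
  rw [h2] at h1
  calc F.q |x| * |x| ≤ n/a^2 * (ρ * a) := by gcongr
    _ = _ := by field_simp

set_option maxHeartbeats 1000000 in
lemma e1 {n : ℕ} {a x : ℝ} (hn : 8 ≤ n) (ha : 0 < a) (hRa : F.R a = n) (hx : |x| ≤ a / 20) :
    ∃ S : ℝ[X], S.natDegree ≤ n ∧ S.eval x = 1 ∧ F.I (fun t => S.eval t ^ 2) * Real.exp (F.Q x) ≤ 1200 * (a / n) := by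
  have hn' : (8:ℝ) ≤ n := by exact_mod_cast hn
  set L := n / 8 with hL
  have hL1 : (n:ℝ) ≤ 16 * L := by exact_mod_cast (by omega : n ≤ 16 * (n/8))
  have hL2 : 8 * (L:ℝ) ≤ n := by exact_mod_cast (by omega : 8 * (n/8) ≤ n)
  set m := n / 4 with hm
  have hm1 : (n:ℝ) ≤ 8 * m := by exact_mod_cast (by omega : n ≤ 8 * (n/4))
  have hm0 : (0:ℝ) < m := by linarith
  have hL0 : (0:ℝ) < L := by linarith
  set b := 4 * a with hb
  have hb0 : 0 < b := by positivity
  have hxb : |x / b| ≤ 1/80 := by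
    rw [abs_div, abs_of_pos hb0, div_le_iff₀ hb0]; linarith
  set θ := arccos (x/b) with hθ
  have hcos : cos θ = x / b := cos_arccos (by linarith [(abs_le.1 hxb).1]) (by linarith [(abs_le.1 hxb).2])
  have hcs : cos θ ^ 2 ≤ 1/64 := by
    rw [hcos, ← sq_abs]
    calc |x/b|^2 ≤ (1/80)^2 := by gcongr
      _ ≤ _ := by norm_num
  set Z := ∑ k ∈ Finset.range (2*L), cos (k * θ) ^ 2 with hZ
  have hZ1 : (L:ℝ)/4 ≤ Z := cos_sum hcs L
  have hZ0 : 0 < Z := by linarith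
  set y : ℝ → ℝ := fun t => F.Q1 x * (t - x) with hyd
  set S1 : ℝ[X] := (1 + C (F.Q1 x / (2*(m:ℝ))) * (X - C x))^m with hS1
  set K : ℝ[X] := ∑ k ∈ Finset.range (2*L), C (cos (k * θ) / Z) * (T ℝ k).comp (C (1/b) * X) with hK
  have hS1ev : ∀ t, S1.eval t = (1 + y t / (2*m))^m := by
    intro t; simp [hS1, hyd]; ring
  have hKev : ∀ t, K.eval t = ∑ k ∈ Finset.range (2*L), (cos (k * θ) / Z) * (T ℝ k).eval (t/b) := by
    intro t
    rw [hK, eval_finsetSum]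
    refine Finset.sum_congr rfl fun k _ => ?_
    simp only [eval_mul, eval_C, eval_comp, eval_X]
    rw [show 1 / b * t = t / b by ring]
  have hS1d : S1.natDegree ≤ m := by
    rw [hS1]
    refine natDegree_pow_le.trans ?_
    have : (1 + C (F.Q1 x / (2*(m:ℝ))) * (X - C x)).natDegree ≤ 1 := by
      refine (natDegree_add_le _ _).trans (max_le (by simp) ?_)
      refine (natDegree_C_mul_le _ _).trans ?_
      rw [natDegree_X_sub_C]
    nlinarith
  have hKd : K.natDegree ≤ 2 * L := by
    refine natDegree_sum_le_of_forall_le _ _ fun k hk => ?_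
    refine (natDegree_C_mul_le _ _).trans ?_
    rw [natDegree_comp]
    have h1 : (C (1/b) * X).natDegree ≤ 1 := (natDegree_C_mul_le _ _).trans natDegree_X_le
    have h2 : (T ℝ k).natDegree ≤ k := by
      rw [Polynomial.Chebyshev.natDegree_T]; simp
    have h3 := Finset.mem_range.1 hk
    calc _ ≤ k * 1 := Nat.mul_le_mul h2 h1
      _ ≤ _ := by omega
  have hKx : K.eval x = 1 := by
    rw [hKev, ← hcos]
    have : ∀ k ∈ Finset.range (2*L), (cos (k * θ) / Z) * (T ℝ k).eval (cos θ) = cos (k * θ) ^ 2 / Z := by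
      intro k _
      rw [Polynomial.Chebyshev.T_real_cos]; push_cast; ring
    rw [Finset.sum_congr rfl this, ← Finset.sum_div, ← hZ, div_self hZ0.ne']
  refine ⟨S1 * K, natDegree_mul_le.trans (by omega), ?_, ?_⟩
  · rw [eval_mul, hKx, hS1ev]; simp [hyd]
  have hQ1 := F.Q1_small ha hRa (x := x) (ρ := 1/20) (by norm_num) (by linarith)
  have hxa : |x| ≤ a := by linarith
  have hy1 : ∀ t, |y t| ≤ 1/20 * (n/a) * (|t| + a) := by
    intro t
    rw [hyd, abs_mul]
    gcongr
    exact (abs_sub t x).trans (by linarith)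
  have inside : ∀ t, |t| ≤ b → S1.eval t ^ 2 * F.w t * Real.exp (F.Q x) ≤ 1 := by
    intro t ht
    have h1 : |y t| ≤ 2 * m := by
      refine (hy1 t).trans ?_
      calc 1/20 * (n/a) * (|t| + a) ≤ 1/20*(n/a) * (4 * a + a) := by gcongr
        _ = n / 4 := by field_simp; ring
        _ ≤ _ := by linarith
    have h2 : S1.eval t ^ 2 ≤ Real.exp (y t) := by
      rw [hS1ev, ← pow_mul]
      have h0 : 0 ≤ 1 + y t / (2*m) := by
        have : -1 ≤ y t / (2*m) := by rw [le_div_iff₀ (by positivity)]; linarith [(abs_le.1 h1).1]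
        linarith
      have h3 : 1 + y t / (2*m) ≤ Real.exp (y t / (2*m)) := by
        have := Real.add_one_le_exp (y t / (2*m)); linarith
      calc _ ≤ (Real.exp (y t / (2*m)))^(m*2) := by gcongr
        _ = _ := by rw [← Real.exp_nat_mul]; congr 1; push_cast; field_simp
    have hT := F.Q_tangent x t
    calc S1.eval t ^ 2 * F.w t * Real.exp (F.Q x) ≤ Real.exp (y t) * Real.exp (-F.Q t) * Real.exp (F.Q x) := by
          simp only [w]; gcongr
      _ = Real.exp (y t - F.Q t + F.Q x) := by rw [← Real.exp_add, ← Real.exp_add]; congr 1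
      _ ≤ Real.exp 0 := by apply Real.exp_le_exp.2; simp only [hyd]; linarith
      _ = 1 := Real.exp_zero
  have outside : ∀ t, b ≤ |t| → (S1 * K).eval t ^ 2 * F.w t * Real.exp (F.Q x) ≤ 8 / n * Real.exp (-(1/(8*a^2)) * t^2) := by
    intro t ht
    set s := |t| / a with hs
    have hs4 : 4 ≤ s := by rw [hs, le_div_iff₀ ha]; exact ht
    have hts : |t| = s * a := by rw [hs]; field_simp
    have h1 : S1.eval t ^ 2 ≤ Real.exp (n * (s/10)) := by
      rw [hS1ev, ← pow_mul]
      have h3 : |1 + y t / (2*m)| ≤ Real.exp (|y t| / (2*m)) := by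
        have := Real.add_one_le_exp (|y t| / (2*m))
        have h4 := abs_add_le 1 (y t / (2*m))
        rw [abs_one, abs_div, abs_of_pos (by positivity : (0:ℝ) < 2*m)] at h4
        linarith
      calc (1 + y t / (2*m))^(m*2) ≤ |(1 + y t / (2*m))^(m*2)| := le_abs_self _
        _ = |1 + y t / (2*m)|^(m*2) := abs_pow _ _
        _ ≤ (Real.exp (|y t| / (2*m)))^(m*2) := by gcongr
        _ = Real.exp |y t| := by rw [← Real.exp_nat_mul]; congr 1; push_cast; field_simp
        _ ≤ _ := by
          apply Real.exp_le_exp.2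
          refine (hy1 t).trans ?_
          rw [hts]
          calc 1/20 * (n/a) * (s * a + a) = n * ((s + 1)/20) := by field_simp
            _ ≤ n * (s/10) := mul_le_mul_of_nonneg_left (by linarith) (by positivity)
    have htb : 1 ≤ |t / b| := by rw [abs_div, abs_of_pos hb0, le_div_iff₀ hb0]; linarith
    have h3tb : 3 * |t/b| = 3 * s / 4 := by rw [abs_div, abs_of_pos hb0, hts, hb]; field_simp
    have h2 : K.eval t ^ 2 ≤ 8 * Real.exp (n * (3*s/8 - 1/2)) := by
      have e : K.eval t = (∑ k ∈ Finset.range (2*L), cos (k * θ) * (T ℝ k).eval (t/b)) / Z := by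
        rw [hKev, Finset.sum_div]
        refine Finset.sum_congr rfl fun k _ => by ring
      have cs := Finset.sum_mul_sq_le_sq_mul_sq (Finset.range (2*L)) (fun k => cos (k*θ)) (fun k => (T ℝ k).eval (t/b))
      have hT : ∑ k ∈ Finset.range (2*L), (T ℝ k).eval (t/b) ^ 2 ≤ (2*L) * Real.exp (n * (3*s/8 - 1/2)) := by
        calc _ ≤ ∑ k ∈ Finset.range (2*L), Real.exp (n * (3*s/8 - 1/2)) := by
              refine Finset.sum_le_sum fun k hk => ?_
              have hk' := Finset.mem_range.1 hk
              have h5 := T_big htb k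
              rw [h3tb] at h5
              rw [← sq_abs]
              have h6 : 3*s/4 ≤ Real.exp (3*s/4 - 1) := by have := Real.add_one_le_exp (3*s/4-1); linarith
              have h7 : (1:ℝ) ≤ 3*s/4 := by linarith
              calc |(T ℝ k).eval (t/b)|^2 ≤ ((3*s/4)^k)^2 := by gcongr
                _ = (3*s/4)^(k*2) := by rw [← pow_mul]
                _ ≤ (3*s/4)^(4*L) := pow_le_pow_right₀ h7 (by omega)
                _ ≤ (Real.exp (3*s/4-1))^(4*L) := by gcongr
                _ = Real.exp ((4*L) * (3*s/4-1)) := by rw [← Real.exp_nat_mul]; push_cast; rfl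
                _ ≤ _ := by
                  apply Real.exp_le_exp.2
                  nlinarith [mul_nonneg (by linarith : 0 ≤ n - 8*(L:ℝ)) (by linarith : 0 ≤ 3*s/4-1)]
          _ = _ := by rw [Finset.sum_const, Finset.card_range]; simp
      rw [e, div_pow, div_le_iff₀ (by positivity)]
      calc _ ≤ Z * ∑ k ∈ Finset.range (2*L), (T ℝ k).eval (t/b) ^ 2 := cs
        _ ≤ Z * ((2*L) * Real.exp (n * (3*s/8 - 1/2))) := by gcongr
        _ ≤ Z * ((8 * Z) * Real.exp (n * (3*s/8 - 1/2))) := by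
            refine mul_le_mul_of_nonneg_left (mul_le_mul_of_nonneg_right (by linarith) (by positivity)) hZ0.le
        _ = _ := by ring
    have h3 : F.w t * Real.exp (F.Q x) ≤ Real.exp (-(n/2 * (s^2-1))) := by
      have hq := F.Q_quad ha (t := t) (by rw [hts]; nlinarith)
      rw [hRa] at hq
      have hmono := F.Q_mono (s := x) (t := a) (by rwa [abs_of_pos ha])
      have e : (t/a)^2 = s^2 := by rw [← sq_abs, abs_div, abs_of_pos ha]
      rw [e] at hq
      rw [w, ← Real.exp_add]; apply Real.exp_le_exp.2; linarith
    have e8 : (1/(8*a^2)) * t^2 = s^2/8 := by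
      rw [← sq_abs t, hts]; field_simp
    have h9 : Real.exp (-(2*(n:ℝ))) ≤ 1 / n := by
      rw [Real.exp_neg, one_div]
      have := Real.add_one_le_exp (2*(n:ℝ))
      gcongr; linarith
    calc (S1 * K).eval t ^ 2 * F.w t * Real.exp (F.Q x) = S1.eval t ^ 2 * K.eval t ^ 2 * (F.w t * Real.exp (F.Q x)) := by
          rw [eval_mul]; ring
      _ ≤ Real.exp (n * (s/10)) * (8 * Real.exp (n * (3*s/8 - 1/2))) * Real.exp (-(n/2 * (s^2-1))) := by
          have := F.w_pos t
          gcongr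
      _ = 8 * Real.exp (n * (s/10) + n * (3*s/8 - 1/2) + -(n/2 * (s^2-1))) := by
          rw [Real.exp_add, Real.exp_add]; ring
      _ ≤ 8 * Real.exp (-(2*n) + -(s^2/8)) := by
          refine mul_le_mul_of_nonneg_left (Real.exp_le_exp.2 ?_) (by norm_num)
          have : n * (s/10) + n * (3*s/8 - 1/2) + -(n/2 * (s^2-1)) = n * (s/10 + 3*s/8 - s^2/2) := by ring
          rw [this]
          have h5 : s/10 + 3*s/8 - s^2/2 ≤ -(2 + s^2/8) := by nlinarith
          have h6 : (n:ℝ) * (s/10 + 3*s/8 - s^2/2) ≤ n * (-(2 + s^2/8)) := by gcongr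
          nlinarith [sq_nonneg s]
      _ = 8 * (Real.exp (-(2*n)) * Real.exp (-(s^2/8))) := by rw [Real.exp_add]
      _ ≤ 8 * (1/n * Real.exp (-(s^2/8))) := by gcongr
      _ = _ := by rw [neg_mul, e8]; ring
  have hgi : Integrable (fun t : ℝ => 8 / (n:ℝ) * Real.exp (-(1/(8*a^2)) * t^2)) :=
    (integrable_exp_neg_mul_sq (by positivity)).const_mul _
  have hki : Integrable ((Icc (-b) b).indicator (fun t => K.eval t ^ 2)) := by
    rw [integrable_indicator_iff measurableSet_Icc]
    exact ContinuousOn.integrableOn_Icc (by fun_prop)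
  have hle : F.I (fun t => (S1 * K).eval t ^ 2) * Real.exp (F.Q x) ≤
      (∫ t, (Icc (-b) b).indicator (fun t => K.eval t ^ 2) t) + ∫ t, 8 / (n:ℝ) * Real.exp (-(1/(8*a^2)) * t^2) := by
    rw [← integral_add hki hgi, I, ← integral_mul_const]
    apply integral_mono
    · exact (F.integrable (f := fun t => (S1 * K).eval t ^ 2) (by fun_prop)).mul_const _
    · exact hki.add hgi
    · intro t
      simp only
      have hpos : 0 ≤ 8 / (n:ℝ) * Real.exp (-(1/(8*a^2)) * t^2) := by positivity
      by_cases ht : t ∈ Icc (-b) b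
      · rw [indicator_of_mem ht]
        have h1 := inside t (abs_le.2 ht)
        have h2 := mul_le_mul_of_nonneg_left h1 (sq_nonneg (K.eval t))
        rw [eval_mul, mul_pow]
        calc _ = K.eval t ^ 2 * (S1.eval t ^ 2 * F.w t * Real.exp (F.Q x)) := by ring
          _ ≤ _ := by linarith
      · rw [indicator_of_notMem ht, zero_add]
        apply outside
        by_contra hh
        push Not at hh
        exact ht (abs_le.1 hh.le)
  refine hle.trans ?_
  have hI1 : ∫ t, (Icc (-b) b).indicator (fun t => K.eval t ^ 2) t ≤ b * (π / Z) := by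
    rw [integral_indicator measurableSet_Icc, integral_Icc_eq_integral_Ioc, ← intervalIntegral.integral_of_le (by linarith)]
    have hcs := cos_subst (f := fun t => K.eval t ^ 2) (by fun_prop) hb0
    have h1 : ∫ t in (-b)..b, K.eval t ^ 2 = b * ∫ θ in 0..π, K.eval (b * cos θ) ^ 2 * sin θ := by
      rw [hcs]; field_simp
    rw [h1]
    gcongr
    have h2 : ∫ θ in 0..π, K.eval (b * cos θ) ^ 2 * sin θ ≤ ∫ φ in 0..π, (∑ k ∈ Finset.range (2*L), (cos (k * θ) / Z) * (T ℝ k).eval (cos φ))^2 := by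
      apply intervalIntegral.integral_mono_on pi_pos.le
      · apply Continuous.intervalIntegrable; fun_prop
      · apply Continuous.intervalIntegrable; fun_prop
      · intro φ hφ
        have : K.eval (b * cos φ) = ∑ k ∈ Finset.range (2*L), (cos (k * θ) / Z) * (T ℝ k).eval (cos φ) := by
          rw [hKev]; rw [mul_div_cancel_left₀ _ hb0.ne']
        rw [this]
        have := sin_le_one φ
        exact mul_le_of_le_one_right (sq_nonneg _) this
    refine h2.trans ?_
    have h9 := cheb_sq (2*L) (fun k => cos (k*θ)/Z)
    rw [integral_measureT_eq_integral_cos] at h9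
    rw [h9]
    calc _ ≤ ∑ k ∈ Finset.range (2*L), (cos (k * θ) / Z) ^ 2 * π := by
          refine Finset.sum_le_sum fun k _ => ?_
          exact mul_le_mul_of_nonneg_left (tau_bd k).2 (sq_nonneg _)
      _ = (∑ k ∈ Finset.range (2*L), cos (k * θ) ^ 2) / Z^2 * π := by
          rw [Finset.sum_div, Finset.sum_mul]
          refine Finset.sum_congr rfl fun k _ => by ring
      _ = _ := by rw [← hZ]; field_simp
  have hI2 : ∫ t, 8 / (n:ℝ) * Real.exp (-(1/(8*a^2)) * t^2) ≤ 8 / n * (6 * a) := by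
    rw [integral_const_mul, integral_gaussian]
    gcongr
    apply Real.sqrt_le_iff.2 ⟨by positivity, ?_⟩
    have : π / (1/(8*a^2)) = 8 * π * a^2 := by field_simp
    rw [this]
    have := Real.pi_lt_four
    nlinarith [sq_nonneg a]
  have hpiZ : π / Z ≤ 4 * 64 / n := by
    rw [div_le_div_iff₀ hZ0 (by linarith)]
    have := Real.pi_lt_four
    have h0 := pi_pos
    have h1 : (n:ℝ) ≤ 64 * Z := by linarith
    nlinarith
  calc _ ≤ b * (4 * 64 / n) + 8 / n * (6 * a) := by
        refine add_le_add (hI1.trans ?_) hI2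
        gcongr
    _ = 1072 * (a/n) := by rw [hb]; field_simp; ring
    _ ≤ _ := by gcongr; norm_num
end Fr

namespace ON
lemma lam_small {F : Fr} {P : ℕ → ℝ[X]} (h : ON F P) {n : ℕ} {a : ℝ} (hn : 8 ≤ n) (ha : 0 < a) (hRa : F.R a = n)
    {y : Fin n → ℝ} (hy : Function.Injective y) (hz : ∀ k, (P n).eval (y k) = 0) (k : Fin n) (hk : |y k| ≤ a / 20) :
    lam F y k * Real.exp (F.Q (y k)) ≤ 1200 * (a / n) := by
  obtain ⟨S, hS, hS1, hS2⟩ := F.e1 hn ha hRa hk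
  have := h.lam_le hy hz k hS hS1
  refine le_trans ?_ hS2
  gcongr
end ON
end GW
end

section
namespace GW
open MeasureTheory Real Set Polynomial
set_option linter.unusedSectionVars false

lemma rolle_iter (g : ℝ[X]) (N : ℕ) : Multiset.card g.roots ≤ Multiset.card (derivative^[N] g).roots + N := by
  induction N with
  | zero => simp
  | succ N ih =>
    rw [Function.iterate_succ_apply']
    have := Polynomial.card_roots_le_derivative (derivative^[N] g)
    omega

noncomputable def Her {n : ℕ} (y : Fin n → ℝ) (G : ℝ[X]) : ℝ[X] :=
  ∑ k, ell y k ^ 2 * (C (G.eval (y k)) + C (G.derivative.eval (y k) - 2 * (ell y k).derivative.eval (y k) * G.eval (y k)) * (X - C (y k)))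

lemma Her_eval {n : ℕ} (y : Fin n → ℝ) (G : ℝ[X]) (t : ℝ) : (Her y G).eval t =
    ∑ k, (ell y k).eval t ^ 2 * (G.eval (y k) + (G.derivative.eval (y k) - 2 * (ell y k).derivative.eval (y k) * G.eval (y k)) * (t - y k)) := by
  rw [Her, eval_finsetSum]
  refine Finset.sum_congr rfl fun k _ => by simp

namespace ON
variable {F : Fr} {P : ℕ → ℝ[X]} (h : ON F P) {n : ℕ} (hn : 1 ≤ n) {y : Fin n → ℝ} (hy : Function.Injective y)
  (hz : ∀ k, (P n).eval (y k) = 0)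
include h hn hy hz

lemma Her_y (G : ℝ[X]) (j : Fin n) : (Her y G).eval (y j) = G.eval (y j) := by
  rw [Her_eval, Finset.sum_eq_single j]
  · rw [ell_self hy]; ring
  · intro k _ hk
    rw [ell_ne hy hk]; ring
  · simp

lemma Her_y' (G : ℝ[X]) (j : Fin n) : (Her y G).derivative.eval (y j) = G.derivative.eval (y j) := by
  rw [Her, derivative_sum, eval_finsetSum, Finset.sum_eq_single j]
  · simp [derivative_mul, derivative_pow, ell_self hy]
    try ring
  · intro k _ hk
    simp [derivative_mul, derivative_pow, ell_ne hy hk]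
  · simp

lemma Her_deg (G : ℝ[X]) : (Her y G).natDegree < 2 * n := by
  have : (Her y G).natDegree ≤ 2 * n - 1 := by
    refine natDegree_sum_le_of_forall_le _ _ fun k _ => ?_
    refine natDegree_mul_le.trans ?_
    have h1 : (ell y k ^ 2).natDegree ≤ 2 * (n - 1) := natDegree_pow_le.trans (by rw [ell_natDegree hy])
    have h2 : (C (G.eval (y k)) + C (G.derivative.eval (y k) - 2 * (ell y k).derivative.eval (y k) * G.eval (y k)) * (X - C (y k))).natDegree ≤ 1 := by
      refine (natDegree_add_le _ _).trans (max_le (by simp) ?_)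
      refine (natDegree_C_mul_le _ _).trans ?_
      rw [natDegree_X_sub_C]
    omega
  omega

lemma Her_le {G : ℝ[X]} (hG : ∀ t, 0 ≤ (derivative^[2*n] G).eval t) (x : ℝ) : (Her y G).eval x ≤ G.eval x := by
  by_cases hx : ∃ j, x = y j
  · obtain ⟨j, rfl⟩ := hx
    exact (h.Her_y hn hy hz G j).le
  push Not at hx
  have hPx : (P n).eval x ≠ 0 := by
    intro h0
    have hc : (Finset.univ.image y ∪ {x}).card ≤ n := by
      have hsub : (Finset.univ.image y ∪ {x}) ⊆ (P n).roots.toFinset := by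
        intro t ht
        rw [Multiset.mem_toFinset, mem_roots (h.ne0 n), IsRoot.def]
        rcases Finset.mem_union.1 ht with h1 | h1
        · obtain ⟨k, _, rfl⟩ := Finset.mem_image.1 h1
          exact hz k
        · rw [Finset.mem_singleton.1 h1]; exact h0
      calc _ ≤ (P n).roots.toFinset.card := Finset.card_le_card hsub
        _ ≤ Multiset.card (P n).roots := Multiset.toFinset_card_le _
        _ ≤ (P n).natDegree := card_roots' _
        _ = n := h.deg n
    rw [Finset.card_union_of_disjoint, Finset.card_image_of_injective _ hy] at hc
    · simp at hc
    · rw [Finset.disjoint_singleton_right]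
      intro h1
      obtain ⟨k, _, hk⟩ := Finset.mem_image.1 h1
      exact hx k hk.symm
  set c := (G.eval x - (Her y G).eval x) / (P n).eval x ^ 2 with hc
  set g : ℝ[X] := G - Her y G - C c * (P n)^2 with hg
  have hgx : g.eval x = 0 := by
    simp [hg, hc]; field_simp; ring
  have hgy : ∀ j, g.eval (y j) = 0 := by
    intro j; simp [hg, hz, h.Her_y hn hy hz]
  have hgy' : ∀ j, g.derivative.eval (y j) = 0 := by
    intro j; simp [hg, hz, h.Her_y' hn hy hz, derivative_pow]
  have hP2 : (derivative^[2*n] ((P n)^2)) = C ((2*n).descFactorial (2*n) • ((P n).coeff n)^2) := by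
    have hd : ((P n)^2).natDegree ≤ 2 * n := natDegree_pow_le.trans (by rw [h.deg])
    have h0 : (derivative^[2*n] ((P n)^2)).natDegree ≤ 0 := by
      refine (natDegree_iterate_derivative _ _).trans ?_
      omega
    rw [eq_C_of_natDegree_le_zero h0, coeff_iterate_derivative, zero_add]
    congr 2
    rw [coeff_pow_of_natDegree_le (h.deg n).le]
  have hdg : derivative^[2*n] g = derivative^[2*n] G - C (c * ((2*n).descFactorial (2*n) • ((P n).coeff n)^2)) := by
    rw [hg, iterate_derivative_sub, iterate_derivative_sub, iterate_derivative_C_mul, hP2,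
      iterate_derivative_eq_zero (h.Her_deg hn hy hz G), sub_zero, C_mul]
  have hroot : ∃ ξ, (derivative^[2*n] g).eval ξ = 0 := by
    by_cases hg0 : g = 0
    · exact ⟨0, by rw [hg0]; simp⟩
    have hcard : 2 * n + 1 ≤ Multiset.card g.roots := by
      have hsub : insert x (Finset.univ.image y) ⊆ g.roots.toFinset := by
        intro t ht
        rw [Multiset.mem_toFinset, mem_roots hg0, IsRoot.def]
        rcases Finset.mem_insert.1 ht with h1 | h1
        · rw [h1]; exact hgx
        · obtain ⟨k, _, rfl⟩ := Finset.mem_image.1 h1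
          exact hgy k
      rw [← Multiset.toFinset_sum_count_eq]
      refine le_trans ?_ (Finset.sum_le_sum_of_subset hsub)
      rw [Finset.sum_insert, Finset.sum_image (fun i _ j _ hij => hy hij)]
      · have h1 : 1 ≤ Multiset.count x g.roots := Multiset.one_le_count_iff_mem.2 ((mem_roots hg0).2 hgx)
        have h2 : ∑ k : Fin n, 2 ≤ ∑ k : Fin n, Multiset.count (y k) g.roots := by
          refine Finset.sum_le_sum fun k _ => ?_
          rw [count_roots]
          exact (one_lt_rootMultiplicity_iff_isRoot hg0).2 ⟨hgy k, hgy' k⟩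
        rw [Finset.sum_const, Finset.card_univ, Fintype.card_fin, smul_eq_mul] at h2
        omega
      · intro h1
        obtain ⟨k, _, hk⟩ := Finset.mem_image.1 h1
        exact hx k hk.symm
    have hr := rolle_iter g (2*n)
    have : 0 < Multiset.card (derivative^[2*n] g).roots := by omega
    obtain ⟨ξ, hξ⟩ := Multiset.card_pos_iff_exists_mem.1 this
    exact ⟨ξ, isRoot_of_mem_roots hξ⟩
  obtain ⟨ξ, hξ⟩ := hroot
  rw [hdg, eval_sub, eval_C] at hξ
  have hpos : 0 < (((2*n).descFactorial (2*n) • ((P n).coeff n)^2) : ℝ) := by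
    have h1 : 0 < (2*n).descFactorial (2*n) := by rw [Nat.descFactorial_self]; exact Nat.factorial_pos _
    have := h.ga_pos n
    rw [nsmul_eq_mul]
    have h2 : (0:ℝ) < ((2*n).descFactorial (2*n) : ℕ) := by exact_mod_cast h1
    positivity
  have hc0 : 0 ≤ c := by
    by_contra hneg
    push Not at hneg
    have := mul_neg_of_neg_of_pos hneg hpos
    have := hG ξ
    linarith
  have hP : 0 < (P n).eval x ^ 2 := by positivity
  have : G.eval x - (Her y G).eval x = c * (P n).eval x ^ 2 := by rw [hc]; field_simp
  nlinarith

lemma quad_le {G : ℝ[X]} (hG : ∀ t, 0 ≤ (derivative^[2*n] G).eval t) :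
    ∑ k, lam F y k * G.eval (y k) ≤ F.I (fun t => G.eval t) := by
  have h1 : F.I (fun t => (Her y G).eval t) ≤ F.I (fun t => G.eval t) :=
    Fr.I_mono (by fun_prop) (by fun_prop) (h.Her_le hn hy hz hG)
  refine le_trans (le_of_eq ?_) h1
  rw [Fr.I_congr (Her_eval y G), Fr.I_sum _ (fun k => by fun_prop)]
  refine Finset.sum_congr rfl fun k _ => ?_
  have e : ∀ t, (ell y k).eval t ^ 2 * (G.eval (y k) + (G.derivative.eval (y k) - 2 * (ell y k).derivative.eval (y k) * G.eval (y k)) * (t - y k))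
     = G.eval (y k) * (ell y k).eval t ^ 2 + (G.derivative.eval (y k) - 2 * (ell y k).derivative.eval (y k) * G.eval (y k)) * ((t - y k) * (ell y k).eval t ^ 2) := by
    intro t; ring
  rw [Fr.I_congr e, Fr.I_add (by fun_prop) (by fun_prop), Fr.I_smul, Fr.I_smul, h.I_t hy hz, lam]; ring

lemma sym_le {G : ℝ[X]} (hG : ∀ t, 0 ≤ (derivative^[2*n] G).eval t) (hGe : ∀ t, G.eval (-t) = G.eval t) {x : ℝ}
    (hx : (P n).eval x ≠ 0) :
    ∑ k, ((ell y k).eval x ^ 2 + (ell y k).eval (-x) ^ 2) * (G.eval (y k) + (x^2 - y k^2)/(x^2 + y k^2) *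
      (y k * G.derivative.eval (y k) - 2 * y k * (ell y k).derivative.eval (y k) * G.eval (y k))) ≤ 2 * G.eval x := by
  have h1 := h.Her_le hn hy hz hG x
  have h2 := h.Her_le hn hy hz hG (-x)
  rw [hGe] at h2
  rw [Her_eval] at h1 h2
  refine le_trans (le_of_eq ?_) (add_le_add h1 h2 |>.trans (by linarith))
  rw [← Finset.sum_add_distrib]
  refine Finset.sum_congr rfl fun k _ => ?_
  have e1 := h.Xell_eval hy hz k x
  have e2 := h.Xell_eval hy hz k (-x)
  rw [h.parity] at e2
  have hx1 : x - y k ≠ 0 := by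
    intro h0; rw [sub_eq_zero.1 h0] at hx; exact hx (hz k)
  have hx2 : x + y k ≠ 0 := by
    intro h0
    have : x = - y k := by linarith
    rw [this, h.parity, hz k] at hx; simp at hx
  set p := (P n).eval x / (P n).derivative.eval (y k) with hp
  have hs : ((-1:ℝ)^n)^2 = 1 := by rw [← pow_mul, mul_comm, pow_mul]; simp
  have E1 : (ell y k).eval x ^ 2 = p^2 / (x - y k)^2 := by
    rw [← e1]; field_simp
  have E2 : (ell y k).eval (-x) ^ 2 = p^2 / (x + y k)^2 := by
    have : (x + y k)^2 * (ell y k).eval (-x) ^ 2 = p^2 := by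
      calc _ = ((-x - y k) * (ell y k).eval (-x))^2 := by ring
        _ = ((-1)^n * (P n).eval x / (P n).derivative.eval (y k))^2 := by rw [e2]
        _ = ((-1:ℝ)^n)^2 * p^2 := by rw [hp]; ring
        _ = _ := by rw [hs, one_mul]
    rw [← this]; field_simp
  rw [E1, E2]
  have hsum : x^2 + y k^2 ≠ 0 := by
    intro h0
    apply hx1
    have hx0 : x = 0 := by nlinarith [sq_nonneg x, sq_nonneg (y k)]
    have hy0 : y k = 0 := by nlinarith [sq_nonneg x, sq_nonneg (y k)]
    rw [hx0, hy0]; ring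
  generalize G.eval (y k) = g at *
  generalize G.derivative.eval (y k) = g' at *
  generalize (ell y k).derivative.eval (y k) = b at *
  generalize y k = z at *
  clear_value p
  field_simp
  ring
end ON
end GW
end

section
namespace GW
open MeasureTheory Real Set Polynomial
set_option linter.unusedSectionVars false

namespace Fr
variable (F : Fr)

noncomputable def R1 (t : ℝ) : ℝ := F.Q1 t + t * F.Q2 t
lemma dR (t : ℝ) : HasDerivAt F.R (F.R1 t) t :=
  ((hasDerivAt_id t).mul (F.d2 t)).congr_deriv (by simp [R1])
lemma dR1 (t : ℝ) : HasDerivAt F.R1 (2 * F.Q2 t + t * F.Q3 t) t :=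
  ((F.d2 t).add ((hasDerivAt_id t).mul (F.d3 t))).congr_deriv (by simp; ring)
lemma R1_le {t : ℝ} (ht : 0 < t) : F.R1 t ≤ F.D * F.Q1 t := by
  have := F.hi t ht; unfold R1; linarith
lemma R1_ge {t : ℝ} (ht : 0 < t) : 2 * F.Q1 t ≤ F.R1 t := by
  have := F.lo t ht; unfold R1; linarith

lemma err {A0 A1 s t : ℝ} (h1 : 1 ≤ A0) (hs0 : A0 ≤ s) (hs1 : s ≤ A1) (ht0 : A0 ≤ t) (ht1 : t ≤ A1) :
    |F.R s - F.R t - t * F.R1 t / 2 * (1 - (t/s)^2)| ≤ (s - t)^2 * (F.q A1 * ((2 + F.c) * F.D + 2 * F.D * (A1/A0)^2)) := by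
  have hD := F.D1
  have hA0 : 0 < A0 := by linarith
  have hs : 0 < s := by linarith
  have ht : 0 < t := by linarith
  have hc := F.hc
  have hA1 : 0 < A1 := by linarith
  have hq1 := F.q_pos hA1
  set B := (2 + F.c) * (F.D * F.q A1) with hB
  have hsub : ∀ u ∈ uIcc t s, A0 ≤ u ∧ u ≤ A1 := by
    intro u hu
    exact (convex_Icc A0 A1).ordConnected.uIcc_subset ⟨ht0, ht1⟩ ⟨hs0, hs1⟩ hu
  have hR2 : ∀ u ∈ uIcc t s, ‖2 * F.Q2 u + u * F.Q3 u‖ ≤ B := by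
    intro u hu
    obtain ⟨hu0, hu1⟩ := hsub u hu
    have h2 := F.hc3 u (by linarith)
    have h3 := F.Q2_le (s := u) (by linarith)
    have h4 := F.q_mono (s := u) (t := A1) (by linarith) hu1
    have h5 := F.Q2_nonneg u
    have h6 : F.Q2 u ≤ F.D * F.q A1 := by
      calc F.Q2 u ≤ (F.D - 1) * F.q u := h3
        _ ≤ (F.D - 1) * F.q A1 := mul_le_mul_of_nonneg_left h4 (by linarith)
        _ ≤ F.D * F.q A1 := by nlinarith
    rw [Real.norm_eq_abs]
    calc |2 * F.Q2 u + u * F.Q3 u| ≤ |2 * F.Q2 u| + |u * F.Q3 u| := abs_add_le _ _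
      _ ≤ 2 * F.Q2 u + F.c * F.Q2 u := by rw [abs_of_nonneg (by positivity)]; linarith
      _ = (2 + F.c) * F.Q2 u := by ring
      _ ≤ B := by rw [hB]; gcongr
  have hB0 : 0 ≤ B := by positivity
  have hR1 : ∀ u ∈ uIcc t s, ‖F.R1 u - F.R1 t‖ ≤ B * |s - t| := by
    intro u hu
    have h2 := (convex_uIcc t s).norm_image_sub_le_of_norm_hasDerivWithin_le (f := F.R1)
      (fun v _ => (F.dR1 v).hasDerivWithinAt) hR2 left_mem_uIcc hu
    refine h2.trans ?_
    rw [Real.norm_eq_abs]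
    have := abs_sub_left_of_mem_uIcc hu
    gcongr
  have hR : |F.R s - F.R t - F.R1 t * (s - t)| ≤ B * (s-t)^2 := by
    have h2 := (convex_uIcc t s).norm_image_sub_le_of_norm_hasDerivWithin_le (f := fun u => F.R u - F.R1 t * u)
      (f' := fun u => F.R1 u - F.R1 t)
      (fun v _ => (((F.dR v).sub ((hasDerivAt_id v).const_mul (F.R1 t))).congr_deriv (by ring)).hasDerivWithinAt) hR1 left_mem_uIcc right_mem_uIcc
    rw [Real.norm_eq_abs, Real.norm_eq_abs] at h2
    calc _ = |F.R s - F.R1 t * s - (F.R t - F.R1 t * t)| := by congr 1; ring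
      _ ≤ _ := h2
      _ = _ := by rw [mul_assoc, ← sq, sq_abs]
  have e : t * F.R1 t / 2 * (1 - (t/s)^2) = F.R1 t * (s - t) - F.R1 t * ((s-t)^2 * (2*s+t) / (2*s^2)) := by
    field_simp; ring
  have hR1t : F.R1 t ≤ F.D * (F.q A1 * A1) := by
    refine (F.R1_le ht).trans ?_
    rw [F.q_mul_self]
    gcongr
    exact F.Q1_mono.monotone ht1
  have hR1t0 : 0 ≤ F.R1 t := le_trans (by have := F.pos t ht; positivity) (F.R1_ge ht)
  have h3 : F.R1 t * ((s-t)^2 * (2*s+t) / (2*s^2)) ≤ (s-t)^2 * (F.q A1 * (2 * F.D * (A1/A0)^2)) := by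
    have h4 : (2*s+t) / (2*s^2) ≤ 2 * A1 / A0^2 := by
      rw [div_le_div_iff₀ (by positivity) (by positivity)]
      have : A0^2 ≤ s^2 := by gcongr
      have h5 : 2 * s + t ≤ 3 * A1 := by linarith
      calc (2*s+t) * A0^2 ≤ (3 * A1) * s^2 := by gcongr
        _ ≤ 2 * A1 * (2 * s^2) := by nlinarith [mul_pos hA1 (by positivity : 0 < s^2)]
    calc _ = F.R1 t * ((s-t)^2 * ((2*s+t) / (2*s^2))) := by ring
      _ ≤ (F.D * (F.q A1 * A1)) * ((s-t)^2 * (2 * A1 / A0^2)) := by gcongr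
      _ = _ := by field_simp
  have h30 : 0 ≤ F.R1 t * ((s-t)^2 * (2*s+t) / (2*s^2)) := by positivity
  calc _ = |(F.R s - F.R t - F.R1 t * (s - t)) + F.R1 t * ((s-t)^2 * (2*s+t) / (2*s^2))| := by rw [e]; congr 1; ring
    _ ≤ |F.R s - F.R t - F.R1 t * (s - t)| + |F.R1 t * ((s-t)^2 * (2*s+t) / (2*s^2))| := abs_add_le _ _
    _ ≤ B * (s-t)^2 + (s-t)^2 * (F.q A1 * (2 * F.D * (A1/A0)^2)) := by
      rw [abs_of_nonneg h30]; linarith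
    _ = _ := by rw [hB]; ring

lemma R_slope {A0 s t : ℝ} (h0 : 0 < A0) (hs : A0 ≤ s) (ht : A0 ≤ t) : 2 * F.q A0 * A0 * |s - t| ≤ |F.R s - F.R t| := by
  have key : ∀ s t, A0 ≤ t → t ≤ s → 2 * F.q A0 * A0 * (s - t) ≤ F.R s - F.R t := by
    intro s t ht hts
    have : MonotoneOn (fun u => F.R u - 2 * F.q A0 * A0 * u) (Icc t s) := by
      have hd : ∀ u, HasDerivAt (fun u => F.R u - 2 * F.q A0 * A0 * u) (F.R1 u - 2 * F.q A0 * A0) u := fun u =>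
        ((F.dR u).sub ((hasDerivAt_id u).const_mul _)).congr_deriv (by ring)
      apply monotoneOn_of_deriv_nonneg (convex_Icc t s)
      · intro u _; exact (hd u).continuousAt.continuousWithinAt
      · intro u _; exact (hd u).differentiableAt.differentiableWithinAt
      · intro u hu
        have hu' := interior_subset hu
        rw [(hd u).deriv]
        have h2 := F.R1_ge (t := u) (by linarith [hu'.1])
        have h3 := F.Q1_mono.monotone (show A0 ≤ u by linarith [hu'.1])
        have h4 := F.q_mul_self A0
        nlinarith
    have := this (left_mem_Icc.2 hts) (right_mem_Icc.2 hts) hts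
    simp only at this; linarith
  rcases le_total t s with h | h
  · rw [abs_of_nonneg (by linarith : 0 ≤ s - t)]
    exact (key s t ht h).trans (le_abs_self _)
  · rw [abs_sub_comm, abs_of_nonneg (by linarith : 0 ≤ t - s), abs_sub_comm (F.R s)]
    exact (key t s hs h).trans (le_abs_self _)

lemma one_sub_pow_le {y : ℝ} (h0 : 0 ≤ y) (k : ℕ) : 1 - y^k ≤ k * (1 - y) := by
  have := one_add_mul_le_pow (a := y - 1) (by linarith) k
  rw [add_sub_cancel] at this
  linarith

lemma wt {s t M : ℝ} (hs : 0 < s) (ht : 0 < t) (hsM : F.R s ≤ M) (htM : F.R t ≤ M) :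
    (F.R s - F.R t)^2 ≤ F.D * M * ((F.R s - F.R t) * (1 - (t/s)^2)) := by
  have hRs := F.R_pos hs
  have hRt := F.R_pos ht
  have hM : 0 < M := by linarith
  have hD0 : (0:ℝ) ≤ F.D := Nat.cast_nonneg _
  rcases le_total t s with h | h
  · have h1 := F.R_upper ht h
    have hmono : F.R t ≤ F.R s := F.R_mono (by rw [abs_of_pos hs, abs_of_pos ht]; exact h)
    have hy0 : 0 ≤ t / s := by positivity
    have hy1 : t / s ≤ 1 := by rw [div_le_one hs]; exact h
    have h2 : (t/s)^F.D * F.R s ≤ F.R t := by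
      have h3 : (t/s)^F.D * (s/t)^F.D = 1 := by rw [← mul_pow]; field_simp; simp
      calc (t/s)^F.D * F.R s ≤ (t/s)^F.D * ((s/t)^F.D * F.R t) := by gcongr
        _ = ((t/s)^F.D * (s/t)^F.D) * F.R t := by ring
        _ = _ := by rw [h3, one_mul]
    have h4 := one_sub_pow_le hy0 F.D
    have h5 : 1 - t/s ≤ 1 - (t/s)^2 := by nlinarith
    have h6 : F.R s - F.R t ≤ M * (F.D * (1 - (t/s)^2)) := by
      calc F.R s - F.R t ≤ F.R s * (1 - (t/s)^F.D) := by linarith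
        _ ≤ F.R s * (F.D * (1 - (t/s)^2)) := by
          apply mul_le_mul_of_nonneg_left _ hRs.le
          exact h4.trans (mul_le_mul_of_nonneg_left h5 hD0)
        _ ≤ _ := by
          apply mul_le_mul_of_nonneg_right hsM
          apply mul_nonneg hD0; nlinarith
    nlinarith [mul_le_mul_of_nonneg_left h6 (sub_nonneg.2 hmono)]
  · have h1 := F.R_upper hs h
    have hmono : F.R s ≤ F.R t := F.R_mono (by rw [abs_of_pos hs, abs_of_pos ht]; exact h)
    have hy0 : 0 ≤ s / t := by positivity
    have hy1 : s / t ≤ 1 := by rw [div_le_one ht]; exact h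
    have h2 : (s/t)^F.D * F.R t ≤ F.R s := by
      have h3 : (s/t)^F.D * (t/s)^F.D = 1 := by rw [← mul_pow]; field_simp; simp
      calc (s/t)^F.D * F.R t ≤ (s/t)^F.D * ((t/s)^F.D * F.R s) := by gcongr
        _ = ((s/t)^F.D * (t/s)^F.D) * F.R s := by ring
        _ = _ := by rw [h3, one_mul]
    have h4 := one_sub_pow_le hy0 F.D
    have h7 : 1 ≤ t / s := by rw [le_div_iff₀ hs]; linarith
    have h5 : 1 - s/t ≤ (t/s)^2 - 1 := by
      have h8 : (s/t) * (t/s) = 1 := by field_simp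
      nlinarith
    have h6 : F.R t - F.R s ≤ M * (F.D * ((t/s)^2 - 1)) := by
      calc F.R t - F.R s ≤ F.R t * (1 - (s/t)^F.D) := by linarith
        _ ≤ F.R t * (F.D * ((t/s)^2 - 1)) := by
          apply mul_le_mul_of_nonneg_left _ hRt.le
          exact h4.trans (mul_le_mul_of_nonneg_left h5 hD0)
        _ ≤ _ := by
          apply mul_le_mul_of_nonneg_right htM
          apply mul_nonneg hD0; nlinarith
    nlinarith [mul_le_mul_of_nonneg_left h6 (sub_nonneg.2 hmono)]

noncomputable def ta (j : ℕ) : ℝ := if hj : 0 < j then Classical.choose (F.exists_a (y := 2 * (j:ℝ)) (by positivity)) else 1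
lemma ta_pos (j : ℕ) : 0 < F.ta j := by
  unfold ta
  split_ifs with hj
  · exact (Classical.choose_spec (F.exists_a (y := 2 * (j:ℝ)) (by positivity))).1
  · exact one_pos
lemma R_ta {j : ℕ} (hj : 0 < j) : F.R (F.ta j) = 2 * j := by
  unfold ta
  rw [dif_pos hj]
  exact (Classical.choose_spec (F.exists_a (y := 2 * (j:ℝ)) (by positivity))).2
noncomputable def be : ℕ → ℝ
  | 0 => 1
  | j+1 => be j / (F.ta j)^2
lemma be_pos (j : ℕ) : 0 < F.be j := by
  induction j with
  | zero => exact one_pos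
  | succ j ih => rw [be]; have := F.ta_pos j; positivity
noncomputable def Tf (j : ℕ) (t : ℝ) : ℝ := F.be j * t^(2*j)
lemma Tf_succ (j : ℕ) (t : ℝ) : F.Tf (j+1) t = F.Tf j t * (t / F.ta j)^2 := by
  have := F.ta_pos j
  rw [Tf, Tf, be]; field_simp; ring
lemma Tf_nonneg (j : ℕ) (t : ℝ) : 0 ≤ F.Tf j t := by
  have := F.be_pos j
  rw [Tf, pow_mul]; positivity
noncomputable def GG (j m : ℕ) : ℝ[X] := ∑ i ∈ Finset.range (m+1), C (F.be (j+i)) * X^(2*(j+i))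
lemma GG_eval (j m : ℕ) (t : ℝ) : (F.GG j m).eval t = ∑ i ∈ Finset.range (m+1), F.Tf (j+i) t := by
  rw [GG, eval_finsetSum]
  exact Finset.sum_congr rfl fun i _ => by simp [Tf]
lemma GG_deriv (j m : ℕ) (t : ℝ) : t * (F.GG j m).derivative.eval t = ∑ i ∈ Finset.range (m+1), (2 * ((j+i:ℕ):ℝ)) * F.Tf (j+i) t := by
  rw [GG, derivative_sum, eval_finsetSum, Finset.mul_sum]
  refine Finset.sum_congr rfl fun i _ => ?_
  simp only [derivative_C_mul, derivative_X_pow, eval_mul, eval_C, eval_pow, eval_X, Tf]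
  rcases Nat.eq_zero_or_pos (j+i) with h0 | h0
  · rw [h0]; simp
  · have : t^(2*(j+i)) = t * t^(2*(j+i)-1) := by rw [← pow_succ']; congr 1; omega
    rw [this]; push_cast; ring
lemma GG_even (j m : ℕ) (t : ℝ) : (F.GG j m).eval (-t) = (F.GG j m).eval t := by
  rw [GG_eval, GG_eval]
  refine Finset.sum_congr rfl fun i _ => ?_
  rw [Tf, Tf, pow_mul, pow_mul, neg_sq]
lemma GG_nonneg (j m : ℕ) (t : ℝ) : 0 ≤ (F.GG j m).eval t := by
  rw [GG_eval]; exact Finset.sum_nonneg fun i _ => F.Tf_nonneg _ _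
lemma GG_pos (j m : ℕ) {t : ℝ} (ht : 0 < t) : 0 < (F.GG j m).eval t := by
  rw [GG_eval]
  refine Finset.sum_pos (fun i _ => ?_) ⟨0, by simp⟩
  have := F.be_pos (j+i)
  rw [Tf]; positivity
lemma GG_iter (j m N : ℕ) (t : ℝ) : 0 ≤ (derivative^[2*N] (F.GG j m)).eval t := by
  rw [GG, iterate_derivative_sum, eval_finsetSum]
  refine Finset.sum_nonneg fun i _ => ?_
  have := F.be_pos (j+i)
  rw [iterate_derivative_C_mul, iterate_derivative_X_pow_eq_smul]
  simp only [eval_mul, eval_C, eval_smul, eval_pow, eval_X]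
  rw [← Nat.mul_sub, pow_mul]
  rw [smul_eq_mul]
  positivity

lemma abel (T e : ℕ → ℝ) (he : ∀ i, e (i+1) = e i + 2) (m : ℕ) :
    ∑ i ∈ Finset.range (m+1), e i * (T i - T (i+1)) = e 0 * T 0 + 2 * (∑ i ∈ Finset.range (m+1), T i - T 0) - e m * T (m+1) := by
  induction m with
  | zero => simp; ring
  | succ m ih =>
    rw [Finset.sum_range_succ, ih, Finset.sum_range_succ _ (m+1), he m]; ring

end Fr
end GW
end

section
namespace GW
open MeasureTheory Real Set Polynomial
set_option linter.unusedSectionVars false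

namespace Fr
variable (F : Fr)

lemma le_of_R_le {s t : ℝ} (hs : 0 < s) (ht : 0 < t) (h : F.R s ≤ F.R t) : s ≤ t := by
  by_contra hc
  push Not at hc
  have h1 := F.R_lower ht hc.le
  have h2 := F.R_pos ht
  have : 1 < s / t := by rw [lt_div_iff₀ ht]; linarith
  have h3 : 1 < (s/t)^2 := by nlinarith
  nlinarith
lemma R_le_of_le {s t : ℝ} (hs : 0 < s) (h : s ≤ t) : F.R s ≤ F.R t :=
  F.R_mono (by rw [abs_of_pos hs, abs_of_pos (by linarith)]; exact h)
lemma ta_mono {j k : ℕ} (hj : 0 < j) (h : j ≤ k) : F.ta j ≤ F.ta k := by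
  apply F.le_of_R_le (F.ta_pos _) (F.ta_pos _)
  rw [F.R_ta hj, F.R_ta (by omega)]
  have : (j:ℝ) ≤ k := by exact_mod_cast h
  linarith

lemma dr_sum (j m : ℕ) (t : ℝ) : t * (F.GG j m).derivative.eval t - F.R t * (F.GG j m).eval t =
    ∑ i ∈ Finset.range (m+1), (2 * ((j+i:ℕ):ℝ) - F.R t) * F.Tf (j+i) t := by
  rw [GG_deriv, GG_eval, Finset.mul_sum, ← Finset.sum_sub_distrib]
  exact Finset.sum_congr rfl fun i _ => by ring

noncomputable def Cdr (ν : ℝ) : ℝ := ((2 + F.c) * F.D + 2 * F.D * ν) * F.D * ν^2 / 2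

lemma ta_ratio {j m : ℕ} (hj : 0 < j) {ν : ℝ} (hν : ((j+m:ℕ):ℝ) ≤ ν * j) : (F.ta (j+m) / F.ta j)^2 ≤ ν := by
  have h1 := F.R_lower (F.ta_pos j) (F.ta_mono hj (Nat.le_add_right j m))
  rw [F.R_ta hj, F.R_ta (by omega)] at h1
  have hj' : (0:ℝ) < j := by exact_mod_cast hj
  have h2 : (F.ta (j+m) / F.ta j)^2 * (2 * j) ≤ ν * (2 * j) := by linarith
  exact le_of_mul_le_mul_right h2 (by linarith)

set_option maxHeartbeats 1000000 in
lemma drift {j m : ℕ} (hj : 0 < j) {ν : ℝ} (hν : ((j+m:ℕ):ℝ) ≤ ν * j) (hA : F.R 1 ≤ 2 * j) {t : ℝ} (ht : 0 < t)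
    (h1 : 2 * (j:ℝ) ≤ F.R t) (h2 : F.R t ≤ 2 * ((j+m:ℕ):ℝ)) :
    (F.R t - 2 * j) * F.Tf j t + (2 * ((j+m:ℕ):ℝ) - F.R t) * F.Tf (j+m+1) t ≤ 2 * (F.GG j m).eval t ∧
    |t * (F.GG j m).derivative.eval t - F.R t * (F.GG j m).eval t - t * F.R1 t / 2 * (F.Tf j t - F.Tf (j+m+1) t)|
      ≤ F.Cdr ν * (F.GG j m).eval t := by
  have hj' : (0:ℝ) < j := by exact_mod_cast hj
  have hjm : (j:ℝ) ≤ ((j+m:ℕ):ℝ) := by push_cast; linarith [Nat.cast_nonneg (α := ℝ) m]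
  have hν0 : 0 < ν := by
    by_contra hc; push Not at hc; nlinarith
  have hc := F.hc
  have hD0 : (0:ℝ) ≤ F.D := Nat.cast_nonneg _
  set A0 := F.ta j with hA0
  set A1 := F.ta (j+m) with hA1
  have pA0 : 0 < A0 := F.ta_pos _
  have pA1 : 0 < A1 := F.ta_pos _
  have RA0 : F.R A0 = 2 * j := F.R_ta hj
  have RA1 : F.R A1 = 2 * ((j+m:ℕ):ℝ) := F.R_ta (by omega)
  have A01 : A0 ≤ A1 := F.ta_mono hj (Nat.le_add_right j m)
  have one : 1 ≤ A0 := F.le_of_R_le one_pos pA0 (by rw [RA0]; exact hA)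
  have tA0 : A0 ≤ t := F.le_of_R_le pA0 ht (by rw [RA0]; exact h1)
  have tA1 : t ≤ A1 := F.le_of_R_le ht pA1 (by rw [RA1]; exact h2)
  have hrat : (A1 / A0)^2 ≤ ν := F.ta_ratio hj hν
  have q0 : F.q A0 * A0^2 = 2 * j := by rw [F.q_mul_sq, RA0]
  have q1 : F.q A1 * A1^2 = 2 * ((j+m:ℕ):ℝ) := by rw [F.q_mul_sq, RA1]
  have pq0 := F.q_pos pA0
  have pq1 := F.q_pos pA1
  have qq : F.q A1 ≤ ν * F.q A0 := by
    have e1 : F.q A1 * A0^2 ≤ F.q A1 * A1^2 := by gcongr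
    have e2 : F.q A1 * A0^2 ≤ (ν * F.q A0) * A0^2 := by
      rw [mul_assoc, q0]; linarith
    exact le_of_mul_le_mul_right e2 (by positivity)
  set C1 := (2 + F.c) * F.D + 2 * F.D * ν with hC1
  have hC10 : 0 ≤ C1 := by positivity
  set e : ℕ → ℝ := fun i => 2 * ((j+i:ℕ):ℝ) - F.R t with he
  set T : ℕ → ℝ := fun i => F.Tf (j+i) t with hT
  set G := (F.GG j m).eval t with hG
  have hGT : G = ∑ i ∈ Finset.range (m+1), T i := F.GG_eval j m t
  have hTn : ∀ i, 0 ≤ T i := fun i => F.Tf_nonneg _ _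
  have hTd : ∀ i, T i - T (i+1) = T i * (1 - (t / F.ta (j+i))^2) := by
    intro i
    simp only [hT]; rw [← add_assoc, F.Tf_succ]; ring
  have hab := abel T e (fun i => by simp only [he]; push_cast; ring) m
  have heR : ∀ i, e i = F.R (F.ta (j+i)) - F.R t := fun i => by rw [F.R_ta (by omega)]
  have sM : ∀ i ∈ Finset.range (m+1), F.ta (j+i) ≤ A1 ∧ A0 ≤ F.ta (j+i) := by
    intro i hi
    rw [Finset.mem_range] at hi
    exact ⟨F.ta_mono (by omega) (by omega), F.ta_mono hj (by omega)⟩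
  have hw : ∀ i ∈ Finset.range (m+1), (e i)^2 * T i ≤ F.D * (2 * ((j+m:ℕ):ℝ)) * (e i * (T i - T (i+1))) := by
    intro i hi
    have := F.wt (s := F.ta (j+i)) (t := t) (M := 2 * ((j+m:ℕ):ℝ)) (F.ta_pos _) ht
      (by rw [← RA1]; exact F.R_le_of_le (F.ta_pos _) (sM i hi).1) h2
    rw [← heR] at this
    rw [hTd]
    calc _ ≤ (F.D * (2 * ((j+m:ℕ):ℝ)) * (e i * (1 - (t / F.ta (j+i))^2))) * T i := mul_le_mul_of_nonneg_right this (hTn i)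
      _ = _ := by ring
  have hterm0 : 0 ≤ ∑ i ∈ Finset.range (m+1), e i * (T i - T (i+1)) := by
    refine Finset.sum_nonneg fun i hi => ?_
    rw [hTd, heR]
    have hti := F.ta_pos (j+i)
    rcases le_total t (F.ta (j+i)) with hh | hh
    · have h5 := F.R_le_of_le ht hh
      have h6 : t / F.ta (j+i) ≤ 1 := by rw [div_le_one hti]; exact hh
      have h7 : 0 ≤ t / F.ta (j+i) := by positivity
      exact mul_nonneg (by linarith) (mul_nonneg (hTn i) (by nlinarith))
    · have h5 := F.R_le_of_le hti hh
      have h6 : 1 ≤ t / F.ta (j+i) := by rw [le_div_iff₀ hti]; linarith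
      exact mul_nonneg_of_nonpos_of_nonpos (by linarith) (mul_nonpos_of_nonneg_of_nonpos (hTn i) (by nlinarith))
  rw [← hGT] at hab
  have he0 : e 0 = 2 * j - F.R t := by simp [he]
  have hem : e m = 2 * ((j+m:ℕ):ℝ) - F.R t := rfl
  have hT0 : T 0 = F.Tf j t := rfl
  have hTm : T (m+1) = F.Tf (j+m+1) t := rfl
  have hsum2 : ∑ i ∈ Finset.range (m+1), e i * (T i - T (i+1)) ≤ 2 * G := by
    rw [hab]
    have a1 : e 0 * T 0 ≤ 0 := mul_nonpos_of_nonpos_of_nonneg (by linarith) (hTn 0)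
    have a2 : 0 ≤ e m * T (m+1) := mul_nonneg (by linarith) (hTn _)
    have := hTn 0
    linarith
  refine ⟨?_, ?_⟩
  · rw [hab] at hterm0
    have := hTn 0
    rw [← hT0, ← hTm]
    have e1 : (F.R t - 2 * j) * T 0 = - (e 0 * T 0) := by rw [he0]; ring
    have e2 : (2 * ((j+m:ℕ):ℝ) - F.R t) * T (m+1) = e m * T (m+1) := by rw [hem]
    linarith
  · have hmom : ∑ i ∈ Finset.range (m+1), (e i)^2 * T i ≤ 4 * F.D * (ν * j) * G := by
      calc _ ≤ ∑ i ∈ Finset.range (m+1), F.D * (2 * ((j+m:ℕ):ℝ)) * (e i * (T i - T (i+1))) := Finset.sum_le_sum hw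
        _ = F.D * (2 * ((j+m:ℕ):ℝ)) * ∑ i ∈ Finset.range (m+1), e i * (T i - T (i+1)) := by rw [Finset.mul_sum]
        _ ≤ F.D * (2 * (ν * j)) * (2 * G) := by
          apply mul_le_mul _ hsum2 hterm0 (by positivity)
          apply mul_le_mul_of_nonneg_left _ hD0
          linarith
        _ = _ := by ring
    have herr : ∀ i ∈ Finset.range (m+1), |e i * T i - t * F.R1 t / 2 * (T i - T (i+1))| ≤ C1 * ν / (8 * j) * ((e i)^2 * T i) := by
      intro i hi
      obtain ⟨s1, s0⟩ := sM i hi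
      have a1 := F.err one s0 s1 tA0 tA1
      have a2 := F.R_slope pA0 s0 tA0
      rw [← heR] at a1 a2
      set s := F.ta (j+i)
      have a3 : 8 * j * F.q A0 * (s - t)^2 ≤ (e i)^2 := by
        have := pow_le_pow_left₀ (by positivity) a2 2
        rw [sq_abs, mul_pow, sq_abs] at this
        have e3 : (2 * F.q A0 * A0)^2 = 8 * j * F.q A0 := by
          calc _ = 4 * F.q A0 * (F.q A0 * A0^2) := by ring
            _ = _ := by rw [q0]; ring
        rwa [e3] at this
      have a4 : (s - t)^2 * (F.q A1 * ((2 + F.c) * F.D + 2 * F.D * (A1/A0)^2)) ≤ C1 * ν / (8 * j) * (e i)^2 := by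
        calc _ ≤ (s - t)^2 * ((ν * F.q A0) * C1) := by
              apply mul_le_mul_of_nonneg_left _ (sq_nonneg _)
              apply mul_le_mul qq _ (by positivity) (by positivity)
              have : 2 * (F.D:ℝ) * (A1/A0)^2 ≤ 2 * F.D * ν := mul_le_mul_of_nonneg_left hrat (by positivity)
              linarith
          _ = C1 * ν / (8 * j) * (8 * j * F.q A0 * (s - t)^2) := by field_simp
          _ ≤ _ := mul_le_mul_of_nonneg_left a3 (by positivity)
      rw [hTd]
      calc _ = |(e i - t * F.R1 t / 2 * (1 - (t / s)^2)) * T i| := by congr 1; ring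
        _ = |e i - t * F.R1 t / 2 * (1 - (t / s)^2)| * T i := by rw [abs_mul, abs_of_nonneg (hTn i)]
        _ ≤ (C1 * ν / (8 * j) * (e i)^2) * T i := mul_le_mul_of_nonneg_right (a1.trans a4) (hTn i)
        _ = _ := by ring
    have htel : ∑ i ∈ Finset.range (m+1), (T i - T (i+1)) = T 0 - T (m+1) := Finset.sum_range_sub' T (m+1)
    rw [F.dr_sum, ← hT0, ← hTm, ← htel, Finset.mul_sum, ← Finset.sum_sub_distrib]
    calc _ ≤ ∑ i ∈ Finset.range (m+1), |e i * T i - t * F.R1 t / 2 * (T i - T (i+1))| := Finset.abs_sum_le_sum_abs _ _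
      _ ≤ ∑ i ∈ Finset.range (m+1), C1 * ν / (8 * j) * ((e i)^2 * T i) := Finset.sum_le_sum herr
      _ = C1 * ν / (8 * j) * ∑ i ∈ Finset.range (m+1), (e i)^2 * T i := by rw [Finset.mul_sum]
      _ ≤ C1 * ν / (8 * j) * (4 * F.D * (ν * j) * G) := mul_le_mul_of_nonneg_left hmom (by positivity)
      _ = _ := by rw [Cdr, ← hC1]; field_simp; ring

end Fr
end GW
end

section
namespace GW
open MeasureTheory Real Set Polynomial
set_option linter.unusedSectionVars false

namespace Fr
variable (F : Fr)

lemma Cdr_nonneg {ν : ℝ} (h : 1 ≤ ν) : 0 ≤ F.Cdr ν := by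
  have := F.hc
  unfold Cdr; positivity
noncomputable def C3 (ν : ℝ) : ℝ := F.Cdr ν + 2 * F.D
lemma C3_nonneg {ν : ℝ} (h : 1 ≤ ν) : 0 ≤ F.C3 ν := by
  have := F.Cdr_nonneg h
  unfold C3; positivity

lemma dr_nonneg (j m : ℕ) {t : ℝ} (h : F.R t ≤ 2 * j) :
    0 ≤ t * (F.GG j m).derivative.eval t - F.R t * (F.GG j m).eval t := by
  rw [dr_sum]
  refine Finset.sum_nonneg fun i _ => mul_nonneg ?_ (F.Tf_nonneg _ _)
  push_cast; linarith [Nat.cast_nonneg (α := ℝ) i]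
lemma dr_le (j m : ℕ) {t δ : ℝ} (h : 2 * ((j+m:ℕ):ℝ) + δ ≤ F.R t) :
    t * (F.GG j m).derivative.eval t - F.R t * (F.GG j m).eval t ≤ - δ * (F.GG j m).eval t := by
  rw [dr_sum, GG_eval, Finset.mul_sum]
  refine Finset.sum_le_sum fun i hi => mul_le_mul_of_nonneg_right ?_ (F.Tf_nonneg _ _)
  rw [Finset.mem_range] at hi
  have : (i:ℝ) ≤ m := by exact_mod_cast Nat.lt_succ_iff.1 hi
  push_cast at *; linarith

lemma dr_up {j m : ℕ} (hj : 0 < j) {ν : ℝ} (hν1 : 1 ≤ ν) (hν : ((j+m:ℕ):ℝ) ≤ ν * j) (hA : F.R 1 ≤ 2 * j) {t : ℝ} (ht : 0 < t)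
    (h1 : 4 * (j:ℝ) ≤ F.R t) :
    t * (F.GG j m).derivative.eval t - F.R t * (F.GG j m).eval t ≤ F.C3 ν * (F.GG j m).eval t := by
  have hG := F.GG_nonneg j m t
  rcases le_total (2 * ((j+m:ℕ):ℝ)) (F.R t) with h2 | h2
  · have := F.dr_le j m (t := t) (δ := 0) (by linarith)
    have h3 := mul_nonneg (F.C3_nonneg hν1) hG
    linarith
  · obtain ⟨a, b⟩ := F.drift hj hν hA ht (by linarith [Nat.cast_nonneg (α := ℝ) j]) h2
    have hk : t * F.R1 t / 2 ≤ F.D * F.R t / 2 := by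
      have := mul_le_mul_of_nonneg_left (F.R1_le ht) ht.le
      unfold R; linarith
    have hk0 : 0 ≤ t * F.R1 t / 2 := by
      have h5 := F.R1_ge ht
      have h6 := F.pos t ht
      have : 0 ≤ F.R1 t := by linarith
      positivity
    have T0 := F.Tf_nonneg j t
    have T1 := F.Tf_nonneg (j+m+1) t
    have hR : F.R t * F.Tf j t ≤ 4 * (F.GG j m).eval t := by
      have := mul_nonneg (sub_nonneg.2 h2) T1
      nlinarith
    have h7 := (abs_le.1 b).2
    have h8 : t * F.R1 t / 2 * (F.Tf j t - F.Tf (j+m+1) t) ≤ F.D * (2 * (F.GG j m).eval t) := by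
      calc _ ≤ t * F.R1 t / 2 * F.Tf j t := mul_le_mul_of_nonneg_left (by linarith) hk0
        _ ≤ F.D * F.R t / 2 * F.Tf j t := mul_le_mul_of_nonneg_right hk T0
        _ = F.D * ((F.R t * F.Tf j t) / 2) := by ring
        _ ≤ _ := mul_le_mul_of_nonneg_left (by linarith) (Nat.cast_nonneg _)
    unfold C3; linarith

lemma dr_low {j m : ℕ} (hj : 0 < j) {ν : ℝ} (hν1 : 1 ≤ ν) (hν : ((j+m:ℕ):ℝ) ≤ ν * j) (hA : F.R 1 ≤ 2 * j) {t : ℝ} (ht : 0 < t)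
    (h1 : F.R t ≤ ((j+m:ℕ):ℝ)) :
    - (F.C3 ν) * (F.GG j m).eval t ≤ t * (F.GG j m).derivative.eval t - F.R t * (F.GG j m).eval t := by
  have hG := F.GG_nonneg j m t
  have hR0 := F.R_pos ht
  rcases le_total (F.R t) (2 * (j:ℝ)) with h2 | h2
  · have := F.dr_nonneg j m (t := t) h2
    have h3 := mul_nonneg (F.C3_nonneg hν1) hG
    linarith
  · obtain ⟨a, b⟩ := F.drift hj hν hA ht h2 (by linarith)
    have hk : t * F.R1 t / 2 ≤ F.D * F.R t / 2 := by
      have := mul_le_mul_of_nonneg_left (F.R1_le ht) ht.le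
      unfold R; linarith
    have hk0 : 0 ≤ t * F.R1 t / 2 := by
      have h5 := F.R1_ge ht
      have h6 := F.pos t ht
      have : 0 ≤ F.R1 t := by linarith
      positivity
    have T0 := F.Tf_nonneg j t
    have T1 := F.Tf_nonneg (j+m+1) t
    have hR : F.R t * F.Tf (j+m+1) t ≤ 4 * (F.GG j m).eval t := by
      have := mul_nonneg (sub_nonneg.2 h2) T0
      nlinarith
    have h7 := (abs_le.1 b).1
    have h8 : t * F.R1 t / 2 * (F.Tf (j+m+1) t - F.Tf j t) ≤ F.D * (2 * (F.GG j m).eval t) := by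
      calc _ ≤ t * F.R1 t / 2 * F.Tf (j+m+1) t := mul_le_mul_of_nonneg_left (by linarith) hk0
        _ ≤ F.D * F.R t / 2 * F.Tf (j+m+1) t := mul_le_mul_of_nonneg_right hk T1
        _ = F.D * ((F.R t * F.Tf (j+m+1) t) / 2) := by ring
        _ ≤ _ := mul_le_mul_of_nonneg_left (by linarith) (Nat.cast_nonneg _)
    unfold C3; linarith

noncomputable def ph (j m : ℕ) (t : ℝ) : ℝ := (F.GG j m).eval t * F.w t

lemma dw (t : ℝ) : HasDerivAt F.w (-F.Q1 t * F.w t) t := by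
  have := ((F.d1 t).neg).exp
  exact this.congr_deriv (by simp only [w]; rw [mul_comm]; rfl)

lemma dph (j m : ℕ) (C : ℝ) {t : ℝ} (ht : 0 < t) : HasDerivAt (fun u => F.ph j m u * u ^ C)
    ((t * (F.GG j m).derivative.eval t - F.R t * (F.GG j m).eval t + C * (F.GG j m).eval t) * (F.w t * t^C / t)) t := by
  have h1 := (((F.GG j m).hasDerivAt t).mul (F.dw t)).mul (Real.hasDerivAt_rpow_const (p := C) (Or.inl ht.ne'))
  refine h1.congr_deriv ?_
  rw [Real.rpow_sub_one ht.ne']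
  simp only [Pi.mul_apply]
  unfold R
  field_simp
  ring

lemma ph_mono (j m : ℕ) (C : ℝ) {s t : ℝ} (hs : 0 < s) (hst : s ≤ t)
    (h : ∀ u, s ≤ u → u ≤ t → - C * (F.GG j m).eval u ≤ u * (F.GG j m).derivative.eval u - F.R u * (F.GG j m).eval u) :
    F.ph j m s * s^C ≤ F.ph j m t * t^C := by
  have : MonotoneOn (fun u => F.ph j m u * u ^ C) (Icc s t) := by
    apply monotoneOn_of_deriv_nonneg (convex_Icc s t)
    · intro u hu; exact (F.dph j m C (by linarith [hu.1])).continuousAt.continuousWithinAt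
    · intro u hu
      have hu := interior_subset hu
      exact (F.dph j m C (by linarith [hu.1])).differentiableAt.differentiableWithinAt
    · intro u hu
      have hu := interior_subset hu
      have hu0 : 0 < u := by linarith [hu.1]
      rw [(F.dph j m C hu0).deriv]
      have := h u hu.1 hu.2
      have hw := F.w_pos u
      apply mul_nonneg (by linarith)
      positivity
  exact this (left_mem_Icc.2 hst) (right_mem_Icc.2 hst) hst

lemma ph_anti (j m : ℕ) (C : ℝ) {s t : ℝ} (hs : 0 < s) (hst : s ≤ t)
    (h : ∀ u, s ≤ u → u ≤ t → u * (F.GG j m).derivative.eval u - F.R u * (F.GG j m).eval u ≤ - C * (F.GG j m).eval u) :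
    F.ph j m t * t^C ≤ F.ph j m s * s^C := by
  have : AntitoneOn (fun u => F.ph j m u * u ^ C) (Icc s t) := by
    apply antitoneOn_of_deriv_nonpos (convex_Icc s t)
    · intro u hu; exact (F.dph j m C (by linarith [hu.1])).continuousAt.continuousWithinAt
    · intro u hu
      have hu := interior_subset hu
      exact (F.dph j m C (by linarith [hu.1])).differentiableAt.differentiableWithinAt
    · intro u hu
      have hu := interior_subset hu
      have hu0 : 0 < u := by linarith [hu.1]
      rw [(F.dph j m C hu0).deriv]
      have := h u hu.1 hu.2
      have hw := F.w_pos u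
      apply mul_nonpos_of_nonpos_of_nonneg (by linarith)
      positivity
  exact this (left_mem_Icc.2 hst) (right_mem_Icc.2 hst) hst

lemma ph_nonneg (j m : ℕ) (t : ℝ) : 0 ≤ F.ph j m t := mul_nonneg (F.GG_nonneg _ _ _) (F.w_pos _).le
lemma ph_pos (j m : ℕ) {t : ℝ} (ht : 0 < t) : 0 < F.ph j m t := mul_pos (F.GG_pos _ _ ht) (F.w_pos _)
lemma ph_neg (j m : ℕ) (t : ℝ) : F.ph j m (-t) = F.ph j m t := by
  rw [ph, ph, F.GG_even, F.w_neg]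
lemma ph_abs (j m : ℕ) (t : ℝ) : F.ph j m |t| = F.ph j m t := by
  rcases abs_choice t with h | h <;> rw [h]
  exact F.ph_neg _ _ _

noncomputable def C4 (ν : ℝ) : ℝ := ν ^ (F.C3 ν)
lemma C4_pos {ν : ℝ} (h : 1 ≤ ν) : 0 < F.C4 ν := Real.rpow_pos_of_pos (by linarith) _
lemma div_rpow_le {ν C a b A0 A1 : ℝ} (hν : 1 ≤ ν) (hC : 0 ≤ C) (hA : 0 < A0) (hr : (A1/A0)^2 ≤ ν) (ha : 0 ≤ a) (haA : a ≤ A1) (hb : A0 ≤ b) : (a/b)^C ≤ ν^C := by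
  have hb0 : 0 < b := by linarith
  have hA1 : 0 ≤ A1 := by linarith
  apply Real.rpow_le_rpow (by positivity) _ hC
  calc a / b ≤ A1 / A0 := by gcongr
    _ ≤ ν := by nlinarith [sq_nonneg (A1/A0 - 1)]

lemma ph_le {j m : ℕ} (hj : 0 < j) {ν : ℝ} (hν1 : 1 ≤ ν) (hν : ((j+m:ℕ):ℝ) ≤ ν * j) (hA : F.R 1 ≤ 2 * j) {x t : ℝ} (hx : 0 < x)
    (h1 : 4 * (j:ℝ) ≤ F.R x) (h2 : F.R x ≤ ((j+m:ℕ):ℝ)) (ht : 0 < t) : F.ph j m t ≤ F.C4 ν * F.ph j m x := by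
  have hj' : (0:ℝ) < j := by exact_mod_cast hj
  set A0 := F.ta j with hA0
  set A1 := F.ta (j+m) with hA1
  have pA0 : 0 < A0 := F.ta_pos _
  have pA1 : 0 < A1 := F.ta_pos _
  have RA0 : F.R A0 = 2 * j := F.R_ta hj
  have RA1 : F.R A1 = 2 * ((j+m:ℕ):ℝ) := F.R_ta (by omega)
  have hrat : (A1 / A0)^2 ≤ ν := F.ta_ratio hj hν
  have xA0 : A0 ≤ x := F.le_of_R_le pA0 hx (by linarith)
  have xA1 : x ≤ A1 := F.le_of_R_le hx pA1 (by linarith)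
  have hC := F.C3_nonneg hν1
  have hpx := F.ph_nonneg j m x
  have L : ∀ s, A0 ≤ s → s ≤ x → F.ph j m s ≤ F.C4 ν * F.ph j m x := by
    intro s hs hsx
    have hs0 : 0 < s := by linarith
    have h3 := F.ph_mono j m (F.C3 ν) hs0 hsx (fun u hu1 hu2 =>
      F.dr_low hj hν1 hν hA (by linarith) ((F.R_le_of_le (by linarith) hu2).trans h2))
    have h4 : 0 < s^(F.C3 ν) := Real.rpow_pos_of_pos hs0 _
    calc F.ph j m s ≤ F.ph j m x * x^(F.C3 ν) / s^(F.C3 ν) := by rw [le_div_iff₀ h4]; exact h3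
      _ = (x/s)^(F.C3 ν) * F.ph j m x := by rw [Real.div_rpow hx.le hs0.le]; ring
      _ ≤ _ := mul_le_mul_of_nonneg_right (div_rpow_le hν1 hC pA0 hrat hx.le xA1 hs) hpx
  have U : ∀ s, x ≤ s → s ≤ A1 → F.ph j m s ≤ F.C4 ν * F.ph j m x := by
    intro s hs hsx
    have hs0 : 0 < s := by linarith
    have h3 := F.ph_anti j m (-F.C3 ν) hx hs (fun u hu1 hu2 => by
      rw [neg_neg]
      exact F.dr_up hj hν1 hν hA (by linarith) (h1.trans (F.R_le_of_le hx hu1)))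
    rw [Real.rpow_neg hs0.le, Real.rpow_neg hx.le] at h3
    have h4 : 0 < s^(F.C3 ν) := Real.rpow_pos_of_pos hs0 _
    calc F.ph j m s = F.ph j m s * (s^(F.C3 ν))⁻¹ * s^(F.C3 ν) := by field_simp
      _ ≤ F.ph j m x * (x^(F.C3 ν))⁻¹ * s^(F.C3 ν) := mul_le_mul_of_nonneg_right h3 h4.le
      _ = (s/x)^(F.C3 ν) * F.ph j m x := by rw [Real.div_rpow hs0.le hx.le]; ring
      _ ≤ _ := mul_le_mul_of_nonneg_right (div_rpow_le hν1 hC pA0 hrat hs0.le hsx xA0) hpx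
  rcases le_total t x with htx | htx
  · rcases le_total A0 t with h | h
    · exact L t h htx
    · have h3 := F.ph_mono j m 0 ht h (fun u hu1 hu2 => by
        rw [neg_zero, zero_mul]
        exact F.dr_nonneg j m ((F.R_le_of_le (by linarith) hu2).trans RA0.le))
      simp only [Real.rpow_zero, mul_one] at h3
      exact h3.trans (L A0 le_rfl xA0)
  · rcases le_total t A1 with h | h
    · exact U t htx h
    · have h3 := F.ph_anti j m 0 pA1 h (fun u hu1 hu2 => by
        exact F.dr_le j m (by rw [add_zero, ← RA1]; exact F.R_le_of_le pA1 hu1))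
      simp only [Real.rpow_zero, mul_one] at h3
      exact h3.trans (U A1 xA1 le_rfl)

lemma I_GG {j m : ℕ} (hj : 0 < j) {ν : ℝ} (hν1 : 1 ≤ ν) (hν : ((j+m:ℕ):ℝ) ≤ ν * j) (hA : F.R 1 ≤ 2 * j) {x : ℝ} (hx : 0 < x)
    (h1 : 4 * (j:ℝ) ≤ F.R x) (h2 : F.R x ≤ ((j+m:ℕ):ℝ)) :
    F.I (fun t => (F.GG j m).eval t) ≤ 4 * π * F.C4 ν * F.ta (j+m) * F.ph j m x := by
  set A1 := F.ta (j+m) with hA1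
  have pA1 : 0 < A1 := F.ta_pos _
  have RA1 : F.R A1 = 2 * ((j+m:ℕ):ℝ) := F.R_ta (by omega)
  set b := 2 * A1 with hb
  have pb : 0 < b := by positivity
  set K := F.C4 ν * F.ph j m x with hK
  have hK0 : 0 ≤ K := mul_nonneg (F.C4_pos hν1).le (F.ph_nonneg _ _ _)
  have hRb : 2 * ((j+m:ℕ):ℝ) + 2 ≤ F.R b := by
    have := F.R_lower pA1 (show A1 ≤ b by linarith)
    rw [RA1, hb, mul_div_assoc, div_self pA1.ne'] at this
    have hj' : (1:ℝ) ≤ ((j+m:ℕ):ℝ) := by exact_mod_cast (by omega : 1 ≤ j + m)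
    linarith
  have key : ∀ t : ℝ, F.ph j m t ≤ 2 * K * (1 + (t * b⁻¹)^2)⁻¹ := by
    intro t
    wlog ht : 0 ≤ t generalizing t
    · have := this (-t) (by linarith)
      rw [F.ph_neg] at this
      simpa using this
    rcases ht.eq_or_lt with h0 | ht
    · rw [← h0]
      have : F.ph j m 0 = 0 := by
        rw [ph, GG_eval, Finset.sum_eq_zero, zero_mul]
        intro i _
        rw [Tf, zero_pow (by omega), mul_zero]
      rw [this]; positivity
    rw [← div_eq_mul_inv, ← div_eq_mul_inv, le_div_iff₀ (by positivity)]
    rcases le_total t b with h | h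
    · have h3 := F.ph_le hj hν1 hν hA hx h1 h2 ht
      have h4 : t / b ≤ 1 := by rw [div_le_one pb]; exact h
      have h5 : 0 ≤ t / b := by positivity
      have h6 : 1 + (t/b)^2 ≤ 2 := by nlinarith
      calc _ ≤ K * 2 := mul_le_mul h3 h6 (by positivity) hK0
        _ = _ := by ring
    · have h3 := F.ph_anti j m 2 pb h (fun u hu1 hu2 => F.dr_le j m (hRb.trans (F.R_le_of_le pb hu1)))
      have h4 := F.ph_le hj hν1 hν hA hx h1 h2 pb
      rw [Real.rpow_two, Real.rpow_two] at h3
      have h5 : F.ph j m t * (t/b)^2 ≤ K := by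
        rw [div_pow, ← mul_div_assoc, div_le_iff₀ (by positivity)]
        exact h3.trans (mul_le_mul_of_nonneg_right h4 (by positivity))
      have h6 := F.ph_le hj hν1 hν hA hx h1 h2 ht
      linarith
  have hint : Integrable (fun t : ℝ => 2 * K * (1 + (t * b⁻¹)^2)⁻¹) :=
    ((integrable_inv_one_add_sq).comp_mul_right' (inv_ne_zero pb.ne')).const_mul _
  calc F.I (fun t => (F.GG j m).eval t) = ∫ t, F.ph j m t := rfl
    _ ≤ ∫ t, 2 * K * (1 + (t * b⁻¹)^2)⁻¹ := by
      apply integral_mono_of_nonneg _ hint (Filter.Eventually.of_forall key)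
      exact Filter.Eventually.of_forall fun t => F.ph_nonneg _ _ _
    _ = 2 * K * (b * π) := by
      rw [integral_const_mul, Measure.integral_comp_mul_right (fun u : ℝ => (1 + u^2)⁻¹), integral_univ_inv_one_add_sq, inv_inv, abs_of_pos pb, smul_eq_mul]
    _ = _ := by rw [hK, hb]; ring

end Fr
end GW
end

section
namespace GW
open MeasureTheory Real Set Polynomial
set_option linter.unusedSectionVars false

namespace Fr
variable (F : Fr)

noncomputable def nu : ℝ := 8 * 1920^F.D
lemma nu_one : 1 ≤ F.nu := by
  have : (1:ℝ) ≤ 1920^F.D := one_le_pow₀ (by norm_num)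
  unfold nu; linarith
noncomputable def n0 : ℕ := 4 * 160^F.D * (1 + ⌈F.R 1⌉₊)
lemma n0_ge : 8 ≤ F.n0 := by
  have h1 : 160^1 ≤ 160^F.D := Nat.pow_le_pow_right (by norm_num) (by have := F.hD; omega)
  unfold n0
  nlinarith [Nat.zero_le ⌈F.R 1⌉₊]

lemma choice {n : ℕ} (hn : F.n0 ≤ n) {a : ℝ} (ha : 0 < a) (hRa : F.R a = n) :
    ∃ j m : ℕ, 0 < j ∧ ((j+m:ℕ):ℝ) ≤ F.nu * j ∧ F.R 1 ≤ 2 * j ∧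
      (∀ x : ℝ, a/160 ≤ |x| → 4 * (j:ℝ) ≤ F.R x) ∧ (∀ x : ℝ, |x| ≤ 12 * a → F.R x ≤ ((j+m:ℕ):ℝ)) ∧
      F.ta (j+m) ≤ 2 * 12^F.D * a := by
  set M := 4 * 160^F.D with hM
  have hM0 : 0 < M := by positivity
  set j := n / M with hj
  have hj1 : 1 + ⌈F.R 1⌉₊ ≤ j := by
    rw [hj, Nat.le_div_iff_mul_le hM0, mul_comm]; exact hn
  have hjn : j * M ≤ n := Nat.div_mul_le_self n M
  have hnj : n < (j+1) * M := by
    have := Nat.lt_succ_iff.2 (le_refl (n / M))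
    exact (Nat.div_lt_iff_lt_mul hM0).1 this
  have hle : j ≤ 12^F.D * n := by
    calc j ≤ n := Nat.div_le_self _ _
      _ ≤ 12^F.D * n := Nat.le_mul_of_pos_left _ (by positivity)
  have hjR : (1:ℝ) + F.R 1 ≤ j := by
    have h1 : ((1 + ⌈F.R 1⌉₊ : ℕ):ℝ) ≤ j := by exact_mod_cast hj1
    have := Nat.le_ceil (F.R 1)
    push_cast at h1; linarith
  have hR1 := F.R_pos one_pos
  refine ⟨j, 12^F.D * n - j, by omega, ?_, by linarith, ?_, ?_, ?_⟩
  all_goals try rw [Nat.add_sub_cancel' hle]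
  · have h1 : (n:ℝ) ≤ (j+1) * M := by exact_mod_cast hnj.le
    have h2 : (M:ℝ) = 4 * 160^F.D := by rw [hM]; push_cast; ring
    rw [h2] at h1
    have h3 : (0:ℝ) < 160^F.D := by positivity
    push_cast
    calc (12:ℝ)^F.D * n ≤ 12^F.D * ((j + 1) * (4 * 160^F.D)) := by gcongr
      _ ≤ 12^F.D * ((2 * j) * (4 * 160^F.D)) := by gcongr; linarith
      _ = F.nu * j := by
        unfold nu
        rw [show (1920:ℝ) = 12 * 160 by norm_num, mul_pow]; ring
  · intro x hx
    rw [← F.R_abs x]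
    have h1 := F.R_upper (s := a/160) (t := a) (by positivity) (by linarith)
    rw [hRa, show a / (a/160) = 160 by field_simp] at h1
    have h2 := F.R_le_of_le (by positivity) hx
    have h3 : (j:ℝ) * (4 * 160^F.D) ≤ n := by exact_mod_cast hjn
    have h4 : (0:ℝ) < 160^F.D := by positivity
    have h5 : (4 * (j:ℝ)) * 160^F.D ≤ F.R |x| * 160^F.D := by nlinarith
    exact le_of_mul_le_mul_right h5 h4
  · intro x hx
    have h1 := F.R_upper (s := a) (t := 12 * a) ha (by linarith)
    rw [hRa, show 12 * a / a = 12 by field_simp] at h1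
    have h2 : F.R x ≤ F.R (12 * a) := F.R_mono (by rw [abs_of_pos (show 0 < 12 * a by positivity)]; exact hx)
    push_cast; linarith
  · by_contra hc
    push Not at hc
    have h12 : (1:ℝ) ≤ 12^F.D := one_le_pow₀ (by norm_num)
    have hat : a ≤ F.ta (12^F.D * n) := by nlinarith
    have h1 := F.R_lower ha hat
    have hn0 : 0 < n := by have := F.n0_ge; omega
    have hn' : (0:ℝ) < n := by exact_mod_cast hn0
    rw [F.R_ta (by positivity), hRa] at h1
    have h3 : 2 * 12^F.D < F.ta (12^F.D * n) / a := by rw [lt_div_iff₀ ha]; exact hc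
    push_cast at h1
    have h4 : (F.ta (12^F.D * n) / a)^2 ≤ 2 * 12^F.D := by
      have : (F.ta (12^F.D * n) / a)^2 * n ≤ (2 * 12^F.D) * n := by linarith
      exact le_of_mul_le_mul_right this hn'
    nlinarith

lemma GG_deriv_abs (j m : ℕ) (t : ℝ) : |t| * (F.GG j m).derivative.eval |t| = t * (F.GG j m).derivative.eval t := by
  rw [GG_deriv, GG_deriv]
  refine Finset.sum_congr rfl fun i _ => ?_
  rw [Tf, Tf, pow_mul, pow_mul, sq_abs]
lemma GG_abs (j m : ℕ) (t : ℝ) : (F.GG j m).eval |t| = (F.GG j m).eval t := by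
  rcases abs_choice t with h | h <;> rw [h]
  exact F.GG_even _ _ _
lemma GG_zero {j : ℕ} (hj : 0 < j) (m : ℕ) : (F.GG j m).eval 0 = 0 := by
  rw [GG_eval, Finset.sum_eq_zero]
  intro i _
  rw [Tf, zero_pow (by omega), mul_zero]
lemma GG_ph (j m : ℕ) (t : ℝ) : (F.GG j m).eval t = F.ph j m t * Real.exp (F.Q t) := by
  rw [ph, mul_assoc, mul_comm (F.w t), F.exp_w, mul_one]

noncomputable def CV : ℝ := 1200 + 4 * π * F.C4 F.nu ^ 2 * (2 * 12^F.D)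
lemma CV_pos : 0 < F.CV := by
  have := F.C4_pos F.nu_one
  unfold CV; positivity
end Fr

namespace ON
variable {F : Fr} {P : ℕ → ℝ[X]} (h : ON F P) {n : ℕ} (hn : F.n0 ≤ n) {a : ℝ} (ha : 0 < a) (hRa : F.R a = n)
  {y : Fin n → ℝ} (hy : Function.Injective y) (hz : ∀ k, (P n).eval (y k) = 0)
include h hn ha hRa hy hz

lemma node_lt (k : Fin n) : |y k| < 4 * a := h.zero_lt (by have := F.n0_ge; omega) ha hRa (hz k)

lemma Vsum : ∑ k, lam F y k * Real.exp (F.Q (y k)) ≤ F.CV * a := by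
  obtain ⟨j, m, hj, hν, hA, hlo, hup, hta⟩ := F.choice hn ha hRa
  have hn8 := F.n0_ge
  have hn0 : (0:ℝ) < n := by exact_mod_cast (by omega : 0 < n)
  have hl : ∀ k, 0 < lam F y k := fun k => lam_pos hy k
  have hC4 := F.C4_pos F.nu_one
  have hpa := F.ph_pos j m ha
  have h1 : ∀ k, lam F y k * Real.exp (F.Q (y k)) ≤ 1200 * (a/n) + F.C4 F.nu / F.ph j m a * (lam F y k * (F.GG j m).eval (y k)) := by
    intro k
    have hG := F.GG_nonneg j m (y k)
    rcases le_total |y k| (a/20) with hk | hk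
    · have := h.lam_small (by omega) ha hRa hy hz k hk
      have h3 : 0 ≤ F.C4 F.nu / F.ph j m a * (lam F y k * (F.GG j m).eval (y k)) := by
        have := hl k; positivity
      linarith
    · have hk4 := h.node_lt hn ha hRa hy hz k
      have h3 := F.ph_le hj F.nu_one hν hA (x := |y k|) (t := a) (by linarith) (by rw [F.R_abs]; exact hlo _ (by linarith))
        (by rw [F.R_abs]; exact hup _ (by linarith)) ha
      rw [F.ph_abs] at h3
      rw [F.GG_ph]
      have h4 : 1 ≤ F.C4 F.nu / F.ph j m a * F.ph j m (y k) := by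
        rw [div_mul_eq_mul_div, le_div_iff₀ hpa, one_mul]; exact h3
      have h5 : 0 ≤ lam F y k * Real.exp (F.Q (y k)) := by have := hl k; positivity
      have h6 : 0 ≤ 1200 * (a/n) := by positivity
      nlinarith [mul_le_mul_of_nonneg_left h4 h5]
  have h2 := (h.quad_le (by omega) hy hz (F.GG_iter j m n)).trans
    (F.I_GG hj F.nu_one hν hA ha (hlo a (by rw [abs_of_pos ha]; linarith)) (hup a (by rw [abs_of_pos ha]; linarith)))
  calc _ ≤ ∑ k : Fin n, (1200 * (a/n) + F.C4 F.nu / F.ph j m a * (lam F y k * (F.GG j m).eval (y k))) := Finset.sum_le_sum fun k _ => h1 k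
    _ = 1200 * a + F.C4 F.nu / F.ph j m a * ∑ k, lam F y k * (F.GG j m).eval (y k) := by
      rw [Finset.mul_sum, Finset.sum_add_distrib, Finset.sum_const, Finset.card_univ, Fintype.card_fin, nsmul_eq_mul]
      congr 1
      field_simp
    _ ≤ 1200 * a + F.C4 F.nu / F.ph j m a * (4 * π * F.C4 F.nu * F.ta (j+m) * F.ph j m a) := by
      have : 0 ≤ F.C4 F.nu / F.ph j m a := by positivity
      linarith [mul_le_mul_of_nonneg_left h2 this]
    _ = 1200 * a + 4 * π * F.C4 F.nu ^ 2 * F.ta (j+m) := by field_simp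
    _ ≤ 1200 * a + 4 * π * F.C4 F.nu ^ 2 * (2 * 12^F.D * a) := by
      have := mul_le_mul_of_nonneg_left hta (show 0 ≤ 4 * π * F.C4 F.nu ^ 2 by positivity)
      linarith
    _ = _ := by unfold Fr.CV; ring

end ON
end GW
end

section
namespace GW
open MeasureTheory Real Set Polynomial
set_option linter.unusedSectionVars false

namespace Fr
variable (F : Fr)
noncomputable def Cd : ℝ := F.C3 F.nu + (F.cbk + 2 + 4 * F.Q1 3)
lemma Cd_pos : 0 < F.Cd := by
  have h1 := F.C3_nonneg F.nu_one
  have h2 := F.cbk_pos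
  have h3 := F.pos 3 (by norm_num)
  unfold Cd; linarith
noncomputable def de : ℝ := 1 / (320 * (1 + F.Cd))
lemma de_pos : 0 < F.de := by have := F.Cd_pos; unfold de; positivity
lemma de_le : F.de ≤ 1/320 := by
  have := F.Cd_pos
  unfold de
  apply one_div_le_one_div_of_le (by norm_num); linarith
lemma de_Cd : 160 * F.de * F.Cd ≤ 1/2 := by
  have := F.Cd_pos
  have e : 160 * F.de * F.Cd = (F.Cd / (1 + F.Cd)) / 2 := by unfold de; field_simp; norm_num
  rw [e]
  have : F.Cd / (1 + F.Cd) ≤ 1 := by rw [div_le_one (by linarith)]; linarith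
  linarith
noncomputable def C2 : ℝ := 4 * F.C4 F.nu + (1 + 2 * F.C4 F.nu^2 * F.Cd) * (32 * F.N / F.de^2 * F.CV)
lemma C2_pos : 0 < F.C2 := by
  have h1 := F.C4_pos F.nu_one
  have h2 := F.Cd_pos
  have h3 := F.de_pos
  have h4 := F.N_pos
  have h5 := F.CV_pos
  unfold C2; positivity
end Fr

namespace ON
variable {F : Fr} {P : ℕ → ℝ[X]} (h : ON F P) {n : ℕ} 
  {y : Fin n → ℝ} (hy : Function.Injective y) (hz : ∀ k, (P n).eval (y k) = 0)
include h hy hz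

lemma node_of_zero (hn : 1 ≤ n) {x : ℝ} (hx : (P n).eval x = 0) : ∃ k, x = y k := by
  by_contra hc
  push Not at hc
  have h1 : ∀ k, (ell y k).eval x = 0 := by
    intro k
    have := h.Xell_eval hy hz k x
    rw [hx, zero_div, mul_eq_zero] at this
    rcases this with h2 | h2
    · exact absurd (sub_eq_zero.1 h2) (hc k)
    · exact h2
  have h2 : ∑ k, ell y k = 1 := Lagrange.sum_basis hy.injOn ⟨⟨0, hn⟩, Finset.mem_univ _⟩
  have h3 := congrArg (eval x) h2
  rw [eval_finsetSum] at h3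
  simp [h1] at h3

lemma ell_sq_le {a : ℝ} (hn : 1 ≤ n) (ha : 0 < a) (hRa : F.R a = n) (k : Fin n) {x : ℝ} {D : ℝ} (hD : 0 < D) (hxk : D ≤ |x - y k|) :
    (ell y k).eval x ^ 2 ≤ 16 * a^2 / n * lam F y k * (P n).eval x ^ 2 / D^2 := by
  have hn0 : (0:ℝ) < n := by exact_mod_cast hn
  have h1 := h.Xell_eval hy hz k x
  have h2 := h.estA hy hz hn ha hRa k
  have hp := (h.Xell hy hz k).1
  set p' := (P n).derivative.eval (y k)
  have hp2 : 0 < p'^2 := by positivity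
  have h3 : (x - y k)^2 * (ell y k).eval x ^ 2 * p'^2 = (P n).eval x ^ 2 := by
    have : ((x - y k) * (ell y k).eval x) * p' = (P n).eval x := by rw [h1]; field_simp
    rw [← this]; ring
  have h4 : D^2 ≤ (x - y k)^2 := by rw [← sq_abs (x - y k)]; gcongr
  have hl : 0 < lam F y k := lam_pos hy k
  have h5 : 1 ≤ 16 * a^2 / n * (lam F y k * p'^2) := by
    calc (1:ℝ) = 16 * a^2 / n * (n / (16 * a^2)) := by field_simp
      _ ≤ _ := mul_le_mul_of_nonneg_left h2 (by positivity)
  rw [le_div_iff₀ (by positivity)]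
  calc (ell y k).eval x ^ 2 * D^2 ≤ (ell y k).eval x ^ 2 * (x - y k)^2 := by gcongr
    _ = (ell y k).eval x ^ 2 * (x - y k)^2 * 1 := by ring
    _ ≤ (ell y k).eval x ^ 2 * (x - y k)^2 * (16 * a^2 / n * (lam F y k * p'^2)) := mul_le_mul_of_nonneg_left h5 (by positivity)
    _ = 16 * a^2 / n * lam F y k * ((x - y k)^2 * (ell y k).eval x ^ 2 * p'^2) := by ring
    _ = _ := by rw [h3]

variable (hn : F.n0 ≤ n) {a : ℝ} (ha : 0 < a) (hRa : F.R a = n)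
include hn ha hRa

set_option maxHeartbeats 1000000 in
lemma case2_aux {x : ℝ} (hx1 : a/80 ≤ x) (hx2 : x ≤ 12 * a) (hxp : (P n).eval x ≠ 0) :
    ∑ k, ((ell y k).eval x ^ 2 + (ell y k).eval (-x) ^ 2) * Real.exp (F.Q (y k)) ≤ F.C2 * Real.exp (F.Q x) := by
  obtain ⟨j, m, hj, hν, hA, hlo, hup, hta⟩ := F.choice hn ha hRa
  have hn8 := F.n0_ge
  have hn1 : 1 ≤ n := by omega
  have hn0 : (0:ℝ) < n := by exact_mod_cast (by omega : 0 < n)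
  have hl : ∀ k, 0 < lam F y k := fun k => lam_pos hy k
  have hC4 := F.C4_pos F.nu_one
  have hCd := F.Cd_pos
  have hde := F.de_pos
  have hdl := F.de_le
  have hN := F.N_pos
  have hx : 0 < x := by linarith [show 0 < a/80 by positivity]
  have habsx : |x| = x := abs_of_pos hx
  have hpx := F.ph_pos j m hx
  set G := F.GG j m with hG
  set E := Real.exp (F.Q x) with hE
  have hE0 : 0 < E := Real.exp_pos _
  set φ := F.ph j m x with hφ
  have hRx1 : 4 * (j:ℝ) ≤ F.R x := hlo x (by rw [habsx]; linarith)
  have hRx2 : F.R x ≤ ((j+m:ℕ):ℝ) := hup x (by rw [habsx]; linarith)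
  have hGx : G.eval x = φ * E := F.GG_ph j m x
  set s : Fin n → ℝ := fun k => (ell y k).eval x ^ 2 + (ell y k).eval (-x) ^ 2 with hs
  have hs0 : ∀ k, 0 ≤ s k := fun k => by positivity
  set th : Fin n → ℝ := fun k => (x^2 - y k^2)/(x^2 + y k^2) with hth
  set Dk : Fin n → ℝ := fun k => y k * G.derivative.eval (y k) - 2 * y k * (ell y k).derivative.eval (y k) * G.eval (y k) with hDk
  have hsym := h.sym_le hn1 hy hz (G := G) (F.GG_iter j m n) (F.GG_even j m) hxp
  have hG0 : ∀ k, 0 ≤ G.eval (y k) := fun k => F.GG_nonneg _ _ _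
  have hy4 := h.node_lt hn ha hRa hy hz
  have hth1 : ∀ k, |th k| ≤ 1 := by
    intro k
    have : 0 < x^2 + y k^2 := by positivity
    rw [hth, abs_div, abs_of_pos this, div_le_one this, abs_le]
    constructor <;> nlinarith [sq_nonneg (y k), sq_nonneg x]
  have hDlow : ∀ k, - F.Cd * G.eval (y k) ≤ Dk k := by
    intro k
    by_cases h0 : y k = 0
    · simp only [hDk, h0]; rw [hG, F.GG_zero hj]; simp
    · have h1 := F.dr_low hj F.nu_one hν hA (abs_pos.2 h0) (by rw [F.R_abs]; exact hup _ (by linarith [hy4 k]))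
      rw [F.GG_deriv_abs, F.GG_abs, F.R_abs] at h1
      have h2 := (abs_le.1 (h.estBK hy hz k)).2
      have h3 := mul_le_mul_of_nonneg_right h2 (hG0 k)
      simp only [hDk, Fr.Cd]
      rw [← hG] at h1
      linarith
  have hDup : ∀ k, a/160 ≤ |y k| → Dk k ≤ F.Cd * G.eval (y k) := by
    intro k hk
    have h0 : 0 < |y k| := by linarith [show 0 < a/160 by positivity]
    have h1 := F.dr_up hj F.nu_one hν hA h0 (by rw [F.R_abs]; exact hlo _ hk)
    rw [F.GG_deriv_abs, F.GG_abs, F.R_abs] at h1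
    have h2 := (abs_le.1 (h.estBK hy hz k)).1
    have h3 := mul_le_mul_of_nonneg_right h2 (hG0 k)
    simp only [hDk, Fr.Cd]
    rw [← hG] at h1
    linarith
  have hfar : ∀ k, F.de * a ≤ |(|y k| - x)| → s k ≤ 32 * F.N / (F.de^2 * a) * E * lam F y k := by
    intro k hk
    have hd : 0 < F.de * a := by positivity
    have hp : ∀ u, |u| = x → (ell y k).eval u ^ 2 ≤ 16 * F.N / (F.de^2 * a) * E * lam F y k := by
      intro u hu
      have h1 : F.de * a ≤ |u - y k| := by
        refine hk.trans ?_
        rw [← hu, abs_sub_comm u]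
        exact abs_abs_sub_abs_le_abs_sub _ _
      have h2 := h.ell_sq_le hy hz hn1 ha hRa k hd h1
      have h3 := h.p_le hn1 ha hRa (x := u) (by rw [hu]; exact hx2)
      have h4 : (P n).eval u ^ 2 ≤ F.N * (n/a) * E := by
        have e1 : E * F.w u = 1 := by
          rw [hE, ← hu, F.Q_abs]; exact F.exp_w u
        calc (P n).eval u ^ 2 = ((P n).eval u ^ 2 * F.w u) * E := by rw [mul_assoc, mul_comm (F.w u), e1, mul_one]
          _ ≤ _ := mul_le_mul_of_nonneg_right h3 hE0.le
      refine h2.trans ?_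
      have hlk := hl k
      calc _ ≤ 16 * a^2 / n * lam F y k * (F.N * (n/a) * E) / (F.de * a)^2 := by gcongr
        _ = _ := by field_simp
    have h1 := hp x habsx
    have h2 := hp (-x) (by rw [abs_neg]; exact habsx)
    simp only [hs]
    calc _ ≤ 16 * F.N / (F.de^2 * a) * E * lam F y k + 16 * F.N / (F.de^2 * a) * E * lam F y k := add_le_add h1 h2
      _ = _ := by ring
  set K := 1 + 2 * F.C4 F.nu^2 * F.Cd with hK
  set b := 32 * F.N / (F.de^2 * a) * E with hb
  have hb0 : 0 ≤ b := by positivity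
  have key : ∀ k, s k * Real.exp (F.Q (y k)) * φ ≤ 2 * F.C4 F.nu * (s k * (G.eval (y k) + th k * Dk k))
      + K * (b * φ) * (lam F y k * Real.exp (F.Q (y k))) := by
    intro k
    have hE1 : 0 < Real.exp (F.Q (y k)) := Real.exp_pos _
    have hGk : G.eval (y k) = F.ph j m (y k) * Real.exp (F.Q (y k)) := F.GG_ph j m (y k)
    have hGk0 := hG0 k
    have hlk := hl k
    have hsk := hs0 k
    have hK0 : 0 ≤ K := by positivity
    rcases lt_or_ge |(|y k| - x)| (F.de * a) with hk | hk
    ·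
      have hk160 : a/160 ≤ |y k| := by
        have h1 := (abs_lt.1 hk).1
        have : F.de * a ≤ 1/320 * a := mul_le_mul_of_nonneg_right hdl ha.le
        linarith
      have hyk0 : 0 < |y k| := by linarith [show 0 < a/160 by positivity]
      have hph := F.ph_le hj F.nu_one hν hA (x := |y k|) (t := x) hyk0 (by rw [F.R_abs]; exact hlo _ hk160)
        (by rw [F.R_abs]; exact hup _ (by linarith [hy4 k])) hx
      rw [F.ph_abs] at hph
      have hDabs : |Dk k| ≤ F.Cd * G.eval (y k) := abs_le.2 ⟨by have := hDlow k; linarith, hDup k hk160⟩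
      have hths : |th k| ≤ 160 * F.de := by
        have hp : 0 < x^2 + y k^2 := by positivity
        rw [hth, abs_div, abs_of_pos hp, div_le_iff₀ hp]
        have e1 : x^2 - y k^2 = -((|y k| - x) * (|y k| + x)) := by rw [← sq_abs (y k)]; ring
        rw [e1, abs_neg, abs_mul, abs_of_pos (show 0 < |y k| + x by linarith)]
        have e2 : (|y k| + x) * a ≤ 160 * (x^2 + y k^2) := by
          rw [← sq_abs (y k)]
          have : a ≤ 80 * x := by linarith
          nlinarith [mul_nonneg (show 0 ≤ |y k| + x by linarith) (show 0 ≤ 80 * x - a by linarith), sq_nonneg (|y k| - x)]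
        calc _ ≤ (F.de * a) * (|y k| + x) := mul_le_mul_of_nonneg_right hk.le (by linarith)
          _ = F.de * ((|y k| + x) * a) := by ring
          _ ≤ F.de * (160 * (x^2 + y k^2)) := mul_le_mul_of_nonneg_left e2 hde.le
          _ = _ := by ring
      have hmul : |th k * Dk k| ≤ 1/2 * G.eval (y k) := by
        rw [abs_mul]
        calc _ ≤ (160 * F.de) * (F.Cd * G.eval (y k)) := mul_le_mul hths hDabs (abs_nonneg _) (by positivity)
          _ = (160 * F.de * F.Cd) * G.eval (y k) := by ring
          _ ≤ _ := mul_le_mul_of_nonneg_right F.de_Cd hGk0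
      have hhalf : 1/2 * G.eval (y k) ≤ G.eval (y k) + th k * Dk k := by
        have := (abs_le.1 hmul).1; linarith
      have hlast : 0 ≤ K * (b * φ) * (lam F y k * Real.exp (F.Q (y k))) := by positivity
      calc s k * Real.exp (F.Q (y k)) * φ ≤ s k * Real.exp (F.Q (y k)) * (F.C4 F.nu * F.ph j m (y k)) := mul_le_mul_of_nonneg_left hph (by positivity)
        _ = 2 * F.C4 F.nu * (s k * (1/2 * G.eval (y k))) := by rw [hGk]; ring
        _ ≤ 2 * F.C4 F.nu * (s k * (G.eval (y k) + th k * Dk k)) := by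
          apply mul_le_mul_of_nonneg_left _ (by positivity)
          exact mul_le_mul_of_nonneg_left hhalf hsk
        _ ≤ _ := by linarith
    ·
      have hsb := hfar k hk
      have hGup : G.eval (y k) ≤ F.C4 F.nu * φ * Real.exp (F.Q (y k)) := by
        by_cases h0 : y k = 0
        · rw [h0, hG, F.GG_zero hj]; positivity
        · have := F.ph_le hj F.nu_one hν hA hx hRx1 hRx2 (abs_pos.2 h0)
          rw [F.ph_abs] at this
          rw [hGk]
          exact mul_le_mul_of_nonneg_right this hE1.le
      have htD : - (F.Cd * G.eval (y k)) ≤ th k * Dk k := by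
        have ht1 := abs_le.1 (hth1 k)
        have hCG : 0 ≤ F.Cd * G.eval (y k) := by positivity
        rcases le_total (a/160) |y k| with hk1 | hk1
        · have hDabs : |Dk k| ≤ F.Cd * G.eval (y k) := abs_le.2 ⟨by have := hDlow k; linarith, hDup k hk1⟩
          have : |th k * Dk k| ≤ F.Cd * G.eval (y k) := by
            rw [abs_mul]
            calc _ ≤ 1 * (F.Cd * G.eval (y k)) := mul_le_mul (hth1 k) hDabs (abs_nonneg _) (by norm_num)
              _ = _ := one_mul _
          exact (abs_le.1 this).1
        · have ht0 : 0 ≤ th k := by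
            have : y k^2 ≤ x^2 := by
              rw [← sq_abs (y k)]
              apply pow_le_pow_left₀ (abs_nonneg _)
              linarith [show 0 < a/160 by positivity]
            exact div_nonneg (by linarith) (by positivity)
          have h1 := mul_le_mul_of_nonneg_left (hDlow k) ht0
          have h2 := mul_le_mul_of_nonneg_right ht1.2 hCG
          linarith
      have hterm : - (F.Cd * (F.C4 F.nu * φ * Real.exp (F.Q (y k)))) ≤ G.eval (y k) + th k * Dk k := by
        have := mul_le_mul_of_nonneg_left hGup hCd.le
        linarith
      have h1 := mul_le_mul_of_nonneg_left hterm (show 0 ≤ 2 * F.C4 F.nu * s k by positivity)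
      have h2 := mul_le_mul_of_nonneg_left hsb (show 0 ≤ K * φ * Real.exp (F.Q (y k)) by positivity)
      have e1 : K * φ * Real.exp (F.Q (y k)) * s k = s k * Real.exp (F.Q (y k)) * φ + 2 * F.C4 F.nu * s k * (F.Cd * (F.C4 F.nu * φ * Real.exp (F.Q (y k)))) := by
        rw [hK]; ring
      linarith only [h1, h2, e1]
  have hsum := Finset.sum_le_sum (fun k (_ : k ∈ Finset.univ) => key k)
  rw [Finset.sum_add_distrib, ← Finset.mul_sum, ← Finset.mul_sum, ← Finset.sum_mul] at hsum
  have hV := h.Vsum hn ha hRa hy hz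
  have hfin : (∑ k, s k * Real.exp (F.Q (y k))) * φ ≤ (F.C2 * E) * φ := by
    have h1 := mul_le_mul_of_nonneg_left hsym (show 0 ≤ 2 * F.C4 F.nu by positivity)
    have h2 := mul_le_mul_of_nonneg_left hV (show 0 ≤ K * (b * φ) by positivity)
    rw [hGx] at h1
    have e1 : (F.C2 * E) * φ = 2 * F.C4 F.nu * (2 * (φ * E)) + K * (b * φ) * (F.CV * a) := by
      rw [Fr.C2, ← hK, hb]; field_simp; ring
    rw [e1]
    exact hsum.trans (add_le_add h1 h2)
  exact le_of_mul_le_mul_right hfin hpx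

lemma case2 {x : ℝ} (hx1 : a/80 ≤ |x|) (hx2 : |x| ≤ 12 * a) :
    ∑ k, (ell y k).eval x ^ 2 * Real.exp (F.Q (y k)) ≤ (1 + F.C2) * Real.exp (F.Q x) := by
  have hn8 := F.n0_ge
  have hC2 := F.C2_pos
  have hE : 0 < Real.exp (F.Q x) := Real.exp_pos _
  by_cases hxp : (P n).eval x = 0
  · obtain ⟨k, hk⟩ := h.node_of_zero hy hz (by omega) hxp
    rw [Finset.sum_eq_single k]
    · rw [hk, ell_self hy]; rw [← hk]; nlinarith
    · intro i _ hi
      rw [hk, ell_ne hy hi]; simp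
    · simp
  · have hxp' : (P n).eval |x| ≠ 0 := by
      rcases abs_choice x with h1 | h1
      · rwa [h1]
      · rw [h1, h.parity]
        exact mul_ne_zero (pow_ne_zero _ (by norm_num)) hxp
    have h1 := h.case2_aux hy hz hn ha hRa hx1 hx2 hxp'
    rw [F.Q_abs] at h1
    calc _ ≤ ∑ k, ((ell y k).eval |x| ^ 2 + (ell y k).eval (-|x|) ^ 2) * Real.exp (F.Q (y k)) := by
          apply Finset.sum_le_sum
          intro k _
          apply mul_le_mul_of_nonneg_right _ (Real.exp_pos _).le
          rcases abs_choice x with h2 | h2 <;> rw [h2]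
          · linarith [sq_nonneg ((ell y k).eval (-x))]
          · rw [neg_neg]; linarith [sq_nonneg ((ell y k).eval (-x))]
      _ ≤ _ := h1
      _ ≤ _ := by nlinarith
end ON
end GW
end

section
namespace GW
open MeasureTheory Real Set Polynomial
set_option linter.unusedSectionVars false

namespace Fr
variable (F : Fr)
noncomputable def K1 : ℝ := 2^F.D + 1 + F.q 1
noncomputable def K2 : ℝ := 64 * 432 * F.N * ((1 / F.q 1 + 1) * 4^F.D)
noncomputable def CT : ℝ := 320^F.D * (1 + F.C2) + (F.K1 * 1200 * F.N + F.K2 * F.CV)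
lemma K1_pos : 0 < F.K1 := by have := F.q_pos one_pos; unfold K1; positivity
lemma K2_pos : 0 < F.K2 := by have := F.q_pos one_pos; have := F.N_pos; unfold K2; positivity
lemma q_upper' {s t r : ℝ} (hs : 0 < |s|) (hr : 1 ≤ r) (h : |t| ≤ r * |s|) : F.q t ≤ r^F.D * F.q s := by
  have h1 : F.q t ≤ F.q (r * |s|) := F.q_mono' (by rw [abs_of_pos (show 0 < r * |s| by positivity)]; exact h)
  have h2 := F.q_upper hs (show |s| ≤ r * |s| by nlinarith)
  rw [mul_div_cancel_right₀ _ hs.ne', F.q_abs] at h2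
  exact h1.trans h2
end Fr

namespace ON
variable {F : Fr} {P : ℕ → ℝ[X]} (h : ON F P) {n : ℕ} 
  {y : Fin n → ℝ} (hy : Function.Injective y) (hz : ∀ k, (P n).eval (y k) = 0)
  (hn : F.n0 ≤ n) {a : ℝ} (ha : 0 < a) (hRa : F.R a = n)
include h hy hz hn ha hRa

lemma case1 (ha20 : 20 ≤ a) {x : ℝ} (hx1 : |x| ≤ a/80) :
    ∑ k, (ell y k).eval x ^ 2 * (Real.exp (F.Q (y k)) * (1 + F.q (y k))) ≤ (F.K1 * 1200 * F.N + F.K2 * F.CV) * (Real.exp (F.Q x) * (1 + F.q x)) := by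
  have hn8 := F.n0_ge
  have hn1 : 1 ≤ n := by omega
  have hn0 : (0:ℝ) < n := by exact_mod_cast hn1
  have hl : ∀ k, 0 < lam F y k := fun k => lam_pos hy k
  have hK1 := F.K1_pos
  have hK2 := F.K2_pos
  have hq1 := F.q_pos one_pos
  have hN := F.N_pos
  have hqx := F.q_nonneg x
  set E := Real.exp (F.Q x) with hE
  have hE0 : 0 < E := Real.exp_pos _
  have key : ∀ k, (ell y k).eval x ^ 2 * (Real.exp (F.Q (y k)) * (1 + F.q (y k))) ≤
      F.K1 * (1 + F.q x) * (1200 * (a/n)) * ((ell y k).eval x ^ 2 / lam F y k) + F.K2 / a * E * (lam F y k * Real.exp (F.Q (y k))) := by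
    intro k
    have hlk := hl k
    have hqk := F.q_nonneg (y k)
    have hEk : 0 < Real.exp (F.Q (y k)) := Real.exp_pos _
    by_cases hc : |y k| ≤ 2 * |x| ∨ |y k| ≤ 1
    · have h20 : |y k| ≤ a/20 := by
        rcases hc with hc | hc <;> linarith
      have h1 := h.lam_small (by omega) ha hRa hy hz k h20
      have h2 : 1 + F.q (y k) ≤ F.K1 * (1 + F.q x) := by
        have h2D : (1:ℝ) ≤ 2^F.D := one_le_pow₀ (by norm_num)
        have h3 : F.q (y k) ≤ 2^F.D * F.q x + F.q 1 := by
          rcases hc with hc | hc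
          · by_cases hx0 : x = 0
            · have : y k = 0 := by rw [hx0, abs_zero, mul_zero] at hc; exact abs_nonpos_iff.1 hc
              rw [this, hx0]
              have := F.q_nonneg 0
              nlinarith
            · have := F.q_upper' (abs_pos.2 hx0) (by norm_num) hc
              linarith
          · have := F.q_mono' (s := y k) (t := 1) (by rw [abs_one]; exact hc)
            have h4 : 0 ≤ 2^F.D * F.q x := by positivity
            linarith
        unfold Fr.K1
        nlinarith
      have h4 : Real.exp (F.Q (y k)) ≤ 1200 * (a/n) / lam F y k := by
        rw [le_div_iff₀ hlk, mul_comm]; exact h1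
      have h5 : 0 ≤ F.K2 / a * E * (lam F y k * Real.exp (F.Q (y k))) := by positivity
      calc _ ≤ (ell y k).eval x ^ 2 * ((1200 * (a/n) / lam F y k) * (F.K1 * (1 + F.q x))) := by
            apply mul_le_mul_of_nonneg_left _ (sq_nonneg _)
            apply mul_le_mul h4 h2 (by positivity) (by positivity)
        _ = F.K1 * (1 + F.q x) * (1200 * (a/n)) * ((ell y k).eval x ^ 2 / lam F y k) := by ring
        _ ≤ _ := by linarith
    · push Not at hc
      obtain ⟨hc1, hc2⟩ := hc
      have hd : 1/2 ≤ |x - y k| := by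
        have := abs_sub_abs_le_abs_sub (y k) x
        rw [abs_sub_comm] at this
        linarith
      have h1 := h.ell_sq_le hy hz hn1 ha hRa k (by norm_num) hd
      have h2 := h.e5 hn1 ha hRa (x := x) (by linarith)
      have h3 : (P n).eval x ^ 2 ≤ 432 * F.N / a * E := by
        have e1 : E * F.w x = 1 := F.exp_w x
        calc (P n).eval x ^ 2 = ((P n).eval x ^ 2 * F.w x) * E := by rw [mul_assoc, mul_comm (F.w x), e1, mul_one]
          _ ≤ _ := mul_le_mul_of_nonneg_right h2 hE0.le
      have hqa : F.q a = n / a^2 := by rw [← hRa, ← F.q_mul_sq]; field_simp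
      have h4 : F.q (y k) ≤ 4^F.D * (n / a^2) := by
        rw [← hqa]
        apply F.q_upper' (by rw [abs_of_pos ha]; exact ha) (by norm_num)
        rw [abs_of_pos ha]
        exact (h.node_lt hn ha hRa hy hz k).le
      have h5 : 1 + F.q (y k) ≤ (1 / F.q 1 + 1) * (4^F.D * (n / a^2)) := by
        have h6 := F.q_mono' (s := 1) (t := y k) (by rw [abs_one]; exact hc2.le)
        have h7 : 1 ≤ 1 / F.q 1 * F.q (y k) := by
          rw [div_mul_eq_mul_div, one_mul, le_div_iff₀ hq1, one_mul]; exact h6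
        calc 1 + F.q (y k) ≤ (1 / F.q 1 + 1) * F.q (y k) := by linarith
          _ ≤ _ := mul_le_mul_of_nonneg_left h4 (by positivity)
      have h8 : 0 ≤ F.K1 * (1 + F.q x) * (1200 * (a/n)) * ((ell y k).eval x ^ 2 / lam F y k) := by positivity
      calc _ ≤ (16 * a^2 / n * lam F y k * (432 * F.N / a * E) / (1/2)^2) * (Real.exp (F.Q (y k)) * ((1 / F.q 1 + 1) * (4^F.D * (n / a^2)))) := by
            apply mul_le_mul _ _ (by positivity) (by positivity)
            · refine h1.trans ?_
              apply div_le_div_of_nonneg_right _ (by norm_num)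
              exact mul_le_mul_of_nonneg_left h3 (by positivity)
            · exact mul_le_mul_of_nonneg_left h5 hEk.le
        _ = F.K2 / a * E * (lam F y k * Real.exp (F.Q (y k))) := by
          unfold Fr.K2; field_simp; ring
        _ ≤ _ := by linarith
  have hsum := Finset.sum_le_sum (fun k (_ : k ∈ Finset.univ) => key k)
  rw [Finset.sum_add_distrib, ← Finset.mul_sum, ← Finset.mul_sum] at hsum
  have hV := h.Vsum hn ha hRa hy hz
  have hS : ∑ k, (ell y k).eval x ^ 2 / lam F y k ≤ F.N * (n/a) * E := by
    have := h.nik_sum hn1 ha hRa hy hz (x := x) (by linarith)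
    have e1 : E * F.w x = 1 := F.exp_w x
    calc _ = ((∑ k, (ell y k).eval x ^ 2 / lam F y k) * F.w x) * E := by rw [mul_assoc, mul_comm (F.w x), e1, mul_one]
      _ ≤ _ := mul_le_mul_of_nonneg_right this hE0.le
  have h1 := mul_le_mul_of_nonneg_left hS (show 0 ≤ F.K1 * (1 + F.q x) * (1200 * (a/n)) by positivity)
  have h2 := mul_le_mul_of_nonneg_left hV (show 0 ≤ F.K2 / a * E by positivity)
  have e1 : F.K1 * (1 + F.q x) * (1200 * (a/n)) * (F.N * (n/a) * E) = F.K1 * 1200 * F.N * (E * (1 + F.q x)) := by field_simp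
  have e2 : F.K2 / a * E * (F.CV * a) = F.K2 * F.CV * E := by field_simp
  have h3 : F.K2 * F.CV * E ≤ F.K2 * F.CV * (E * (1 + F.q x)) := by
    apply mul_le_mul_of_nonneg_left _ (by have := F.CV_pos; positivity)
    nlinarith
  rw [e1] at h1; rw [e2] at h2
  linarith only [hsum, h1, h2, h3]

lemma mid (ha20 : 20 ≤ a) {x : ℝ} (hx1 : |x| ≤ 12 * a) :
    ∑ k, (ell y k).eval x ^ 2 * (Real.exp (F.Q (y k)) * (1 + F.q (y k))) ≤ F.CT * (Real.exp (F.Q x) * (1 + F.q x)) := by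
  have hK1 := F.K1_pos
  have hK2 := F.K2_pos
  have hN := F.N_pos
  have hCV := F.CV_pos
  have hC2 := F.C2_pos
  have hqx := F.q_nonneg x
  have hE0 : 0 < Real.exp (F.Q x) := Real.exp_pos _
  rcases le_total |x| (a/80) with hx | hx
  · refine (h.case1 hy hz hn ha hRa ha20 hx).trans ?_
    apply mul_le_mul_of_nonneg_right _ (by positivity)
    unfold Fr.CT
    have : 0 ≤ 320^F.D * (1 + F.C2) := by positivity
    linarith
  · have h1 := h.case2 hy hz hn ha hRa hx hx1
    have hx0 : 0 < |x| := by linarith [show 0 < a/80 by positivity]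
    have h320 : (1:ℝ) ≤ 320^F.D := one_le_pow₀ (by norm_num)
    calc _ ≤ ∑ k, (320^F.D * (1 + F.q x)) * ((ell y k).eval x ^ 2 * Real.exp (F.Q (y k))) := by
          apply Finset.sum_le_sum
          intro k _
          have h2 : F.q (y k) ≤ 320^F.D * F.q x := by
            apply F.q_upper' hx0 (by norm_num)
            linarith [h.node_lt hn ha hRa hy hz k]
          have h3 : 1 + F.q (y k) ≤ 320^F.D * (1 + F.q x) := by linarith
          have h4 : 0 ≤ (ell y k).eval x ^ 2 * Real.exp (F.Q (y k)) := by positivity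
          nlinarith [mul_le_mul_of_nonneg_left h3 h4]
      _ = (320^F.D * (1 + F.q x)) * ∑ k, (ell y k).eval x ^ 2 * Real.exp (F.Q (y k)) := by rw [Finset.mul_sum]
      _ ≤ (320^F.D * (1 + F.q x)) * ((1 + F.C2) * Real.exp (F.Q x)) := mul_le_mul_of_nonneg_left h1 (by positivity)
      _ = (320^F.D * (1 + F.C2)) * (Real.exp (F.Q x) * (1 + F.q x)) := by ring
      _ ≤ _ := by
        apply mul_le_mul_of_nonneg_right _ (by positivity)
        unfold Fr.CT
        have : 0 ≤ F.K1 * 1200 * F.N + F.K2 * F.CV := by positivity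
        linarith
end ON

section tw
variable {F : Fr} {tw : ℝ → ℝ} {d : ℝ} (hd : 1 ≤ d) (pos : ∀ x, 0 < tw x) (cont : Continuous tw)
  (outer : ∀ x : ℝ, d ≤ |x| → tw x = Real.exp (-(F.Q x)) * |x| / F.Q1 |x|)
include hd pos outer

lemma tw_outer {x : ℝ} (hx : d ≤ |x|) : tw x = F.w x / F.q x := by
  have h0 : 0 < |x| := by linarith
  have := F.pos _ h0
  rw [outer x hx, ← F.q_abs, Fr.q, Fr.w]; field_simp

include cont in
lemma tw_comp : ∃ C : ℝ, 0 < C ∧ ∀ x z, tw x / tw z ≤ C * (Real.exp (F.Q z) * (1 + F.q z)) / (Real.exp (F.Q x) * (1 + F.q x)) := by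
  have hd0 : 0 < d := by linarith
  have hqd := F.q_pos hd0
  set f : ℝ → ℝ := fun x => tw x * Real.exp (F.Q x) with hf
  have hfc : Continuous f := by have := F.cQ; fun_prop
  have hfp : ∀ x, 0 < f x := fun x => mul_pos (pos x) (Real.exp_pos _)
  obtain ⟨x1, _, hx1⟩ := (isCompact_Icc (a := -d) (b := d)).exists_isMinOn ⟨0, by constructor <;> linarith⟩ hfc.continuousOn
  obtain ⟨x2, _, hx2⟩ := (isCompact_Icc (a := -d) (b := d)).exists_isMaxOn ⟨0, by constructor <;> linarith⟩ hfc.continuousOn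
  have h1 := hfp x1
  have h2 := hfp x2
  have hup : ∀ x, f x * (1 + F.q x) ≤ (f x2 + 1 / F.q d + 1) * (1 + F.q d) := by
    intro x
    have hqx := F.q_nonneg x
    rcases le_total |x| d with hx | hx
    · have h3 : f x ≤ f x2 := hx2 (abs_le.1 hx)
      have h4 : F.q x ≤ F.q d := F.q_mono' (by rw [abs_of_pos hd0]; exact hx)
      have h5 : 0 < 1 / F.q d := by positivity
      exact mul_le_mul (by linarith) (by linarith) (by linarith) (by linarith)
    · have h3 : F.q d ≤ F.q x := F.q_mono' (by rw [abs_of_pos hd0]; exact hx)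
      have h0 : 0 < F.q x := by linarith
      have e : f x * (1 + F.q x) = 1 / F.q x + 1 := by
        rw [hf]; simp only
        rw [tw_outer hd pos outer hx]
        have := F.exp_w x
        calc _ = (Real.exp (F.Q x) * F.w x) * (1 / F.q x) * (1 + F.q x) := by ring
          _ = _ := by rw [this]; field_simp
      rw [e]
      have h5 : 1 / F.q x ≤ 1 / F.q d := one_div_le_one_div_of_le hqd h3
      have h6 : 0 < 1 / F.q d := by positivity
      nlinarith
  have hlow : ∀ x, min (f x1) 1 ≤ f x * (1 + F.q x) := by
    intro x
    have hqx := F.q_nonneg x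
    rcases le_total |x| d with hx | hx
    · have h3 : f x1 ≤ f x := hx1 (abs_le.1 hx)
      refine (min_le_left _ _).trans ?_
      nlinarith [hfp x]
    · have h3 : F.q d ≤ F.q x := F.q_mono' (by rw [abs_of_pos hd0]; exact hx)
      have h0 : 0 < F.q x := by linarith
      have e : f x * (1 + F.q x) = 1 / F.q x + 1 := by
        rw [hf]; simp only
        rw [tw_outer hd pos outer hx]
        have := F.exp_w x
        calc _ = (Real.exp (F.Q x) * F.w x) * (1 / F.q x) * (1 + F.q x) := by ring
          _ = _ := by rw [this]; field_simp
      rw [e]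
      refine (min_le_right _ _).trans ?_
      have : 0 < 1 / F.q x := by positivity
      linarith
  have hm : 0 < min (f x1) 1 := lt_min h1 one_pos
  refine ⟨(f x2 + 1 / F.q d + 1) * (1 + F.q d) / min (f x1) 1, by positivity, fun x z => ?_⟩
  have a1 := hup x
  have a2 := hlow z
  have hqx := F.q_nonneg x
  have hqz := F.q_nonneg z
  have hEx := Real.exp_pos (F.Q x)
  have hEz := Real.exp_pos (F.Q z)
  have hz := pos z
  set M := (f x2 + 1 / F.q d + 1) * (1 + F.q d)
  set μ := min (f x1) 1
  have hM : 0 ≤ M := by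
    have := mul_pos (hfp x) (show 0 < 1 + F.q x by linarith)
    linarith
  rw [div_le_div_iff₀ hz (by positivity)]
  calc tw x * (Real.exp (F.Q x) * (1 + F.q x)) = f x * (1 + F.q x) := by rw [hf]; ring
    _ ≤ M := a1
    _ = M / μ * μ := by field_simp
    _ ≤ M / μ * (f z * (1 + F.q z)) := mul_le_mul_of_nonneg_left a2 (by positivity)
    _ = _ := by rw [hf]; ring

lemma tw_tail {n : ℕ} {X x : ℝ} (hX : d ≤ X) (hRX : 4 * (n:ℝ) ≤ F.R X) (hx : X ≤ |x|) : tw x * (|x|/X)^(4*n) ≤ tw X := by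
  have hX0 : 0 < X := by linarith
  have hx0 : 0 < |x| := by linarith
  have aX : |X| = X := abs_of_pos hX0
  rw [tw_outer hd pos outer (hX.trans hx), tw_outer hd pos outer (hX.trans aX.symm.le)]
  have h1 := F.Q_log_lower hX0 hx
  have hr : 1 ≤ |x|/X := by rw [le_div_iff₀ hX0]; linarith
  have h2 : F.q X ≤ F.q x := F.q_mono' (by rw [aX]; exact hx)
  have hq := F.q_pos hX0
  have h3 : (|x|/X)^(4*n) ≤ Real.exp (F.Q x - F.Q X) := by
    rw [← Real.exp_log (show 0 < (|x|/X)^(4*n) by positivity), Real.log_pow]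
    apply Real.exp_le_exp.2
    rw [F.Q_abs] at h1
    have := mul_le_mul_of_nonneg_right hRX (Real.log_nonneg hr)
    push_cast; linarith
  have h4 : F.w x * Real.exp (F.Q x - F.Q X) = F.w X := by
    rw [Fr.w, Fr.w, ← Real.exp_add]; congr 1; ring
  have hw := F.w_pos x
  calc F.w x / F.q x * (|x|/X)^(4*n) ≤ F.w x / F.q X * Real.exp (F.Q x - F.Q X) := by gcongr
    _ = (F.w x * Real.exp (F.Q x - F.Q X)) / F.q X := by ring
    _ = _ := by rw [h4]

lemma ell_tail {n : ℕ} {y : Fin n → ℝ} (hy : Function.Injective y) {X r : ℝ} (hX : ∀ k, 2 * |y k| ≤ |X|) (hr : 1 ≤ r) (k : Fin n) :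
    (ell y k).eval (r * X) ^ 2 ≤ r^(4*n) * (ell y k).eval X ^ 2 := by
  rw [ON.eval_ell hy, ON.eval_ell hy, ← Finset.prod_pow, ← Finset.prod_pow]
  have h1 : ∀ j ∈ Finset.univ.erase k, ((r * X - y j) / (y k - y j))^2 ≤ r^4 * ((X - y j) / (y k - y j))^2 := by
    intro j _
    rw [div_pow, div_pow, ← mul_div_assoc]
    apply div_le_div_of_nonneg_right _ (sq_nonneg _)
    have h2 : |y j| ≤ |X - y j| := by
      have := abs_sub_abs_le_abs_sub X (y j)
      linarith [hX j]
    have h3 : |r * X - y j| ≤ r^2 * |X - y j| := by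
      calc |r * X - y j| = |r * (X - y j) + (r - 1) * y j| := by congr 1; ring
        _ ≤ |r * (X - y j)| + |(r - 1) * y j| := abs_add_le _ _
        _ = r * |X - y j| + (r - 1) * |y j| := by rw [abs_mul, abs_mul, abs_of_nonneg (by linarith : 0 ≤ r), abs_of_nonneg (by linarith : 0 ≤ r - 1)]
        _ ≤ r * |X - y j| + (r - 1) * |X - y j| := by
          have := mul_le_mul_of_nonneg_left h2 (show 0 ≤ r - 1 by linarith)
          linarith
        _ = (2 * r - 1) * |X - y j| := by ring
        _ ≤ _ := by
          apply mul_le_mul_of_nonneg_right _ (abs_nonneg _)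
          nlinarith [sq_nonneg (r - 1)]
    have h4 := pow_le_pow_left₀ (abs_nonneg _) h3 2
    rw [sq_abs, mul_pow, sq_abs] at h4
    calc _ ≤ _ := h4
      _ = _ := by ring
  calc _ ≤ ∏ j ∈ Finset.univ.erase k, r^4 * ((X - y j) / (y k - y j))^2 := Finset.prod_le_prod (fun _ _ => sq_nonneg _) h1
    _ = (r^4)^(n-1) * ∏ j ∈ Finset.univ.erase k, ((X - y j) / (y k - y j))^2 := by
      rw [Finset.prod_mul_distrib, Finset.prod_const, Finset.card_erase_of_mem (Finset.mem_univ k), Finset.card_univ, Fintype.card_fin]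
    _ ≤ _ := by
      apply mul_le_mul_of_nonneg_right _ (Finset.prod_nonneg fun _ _ => sq_nonneg _)
      rw [← pow_mul]
      exact pow_le_pow_right₀ hr (by omega)

lemma gr_tail {n : ℕ} {y : Fin n → ℝ} (hy : Function.Injective y) {X : ℝ} (hX : d ≤ X) (hXy : ∀ k, 2 * |y k| ≤ X) (hRX : 4 * (n:ℝ) ≤ F.R X)
    (ev : ∀ x, tw (-x) = tw x) {C : ℝ}
    (hC : ∀ x, |x| ≤ X → tw x * ∑ k, (ell y k).eval x ^ 2 / tw (y k) ≤ C) (x : ℝ) : tw x * ∑ k, (ell y k).eval x ^ 2 / tw (y k) ≤ C := by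
  rcases le_total |x| X with hx | hx
  · exact hC x hx
  have hX0 : 0 < X := by linarith
  set r := |x| / X with hr
  have hr1 : 1 ≤ r := by rw [hr, le_div_iff₀ hX0]; linarith
  obtain ⟨X', hX', hxX, htw⟩ : ∃ X' : ℝ, |X'| = X ∧ x = r * X' ∧ tw X' = tw X := by
    rcases abs_choice x with h1 | h1
    · exact ⟨X, abs_of_pos hX0, by rw [hr, h1]; field_simp, rfl⟩
    · exact ⟨-X, by rw [abs_neg, abs_of_pos hX0], by rw [hr, h1]; field_simp, ev X⟩
  have h1 := tw_tail hd pos outer hX hRX hx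
  refine le_trans ?_ (hC X' hX'.le)
  rw [htw]
  have hS : ∑ k, (ell y k).eval x ^ 2 / tw (y k) ≤ r^(4*n) * ∑ k, (ell y k).eval X' ^ 2 / tw (y k) := by
    rw [Finset.mul_sum]
    apply Finset.sum_le_sum
    intro k _
    rw [← mul_div_assoc]
    apply div_le_div_of_nonneg_right _ (pos _).le
    rw [hxX]
    exact ell_tail hd pos outer hy (by rw [hX']; exact hXy) hr1 k
  calc _ ≤ tw x * (r^(4*n) * ∑ k, (ell y k).eval X' ^ 2 / tw (y k)) := mul_le_mul_of_nonneg_left hS (pos _).le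
    _ = (tw x * r^(4*n)) * ∑ k, (ell y k).eval X' ^ 2 / tw (y k) := by ring
    _ ≤ _ := mul_le_mul_of_nonneg_right h1 (Finset.sum_nonneg fun k _ => div_nonneg (sq_nonneg _) (pos _).le)

include cont in
lemma gr_each {n : ℕ} {y : Fin n → ℝ} (hy : Function.Injective y) (ev : ∀ x, tw (-x) = tw x) :
    ∃ C : ℝ, ∀ x, tw x * ∑ k, (ell y k).eval x ^ 2 / tw (y k) ≤ C := by
  obtain ⟨a, ha, hRa⟩ := F.exists_a (y := 4 * (n:ℝ) + 1) (by positivity)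
  set X := d + a + 2 * ∑ k, |y k| with hXd
  have hs : ∀ k, |y k| ≤ ∑ k, |y k| := fun k => Finset.single_le_sum (f := fun k => |y k|) (fun _ _ => abs_nonneg _) (Finset.mem_univ k)
  have hs0 : 0 ≤ ∑ k, |y k| := Finset.sum_nonneg fun _ _ => abs_nonneg _
  have hcont : Continuous (fun x => tw x * ∑ k, (ell y k).eval x ^ 2 / tw (y k)) := by
    apply cont.mul
    apply continuous_finsetSum
    intro k _
    exact ((ell y k).continuous.pow 2).div_const _
  obtain ⟨C, hC⟩ := (isCompact_Icc (a := -X) (b := X)).bddAbove_image hcont.continuousOn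
  refine ⟨C, gr_tail hd pos outer hy (X := X) (by linarith) (fun k => by have := hs k; linarith) ?_ ev ?_⟩
  · have := F.R_le_of_le ha (show a ≤ X by linarith)
    linarith
  · intro x hx
    exact hC ⟨x, abs_le.1 hx, rfl⟩

include cont in
theorem main {P : ℕ → ℝ[X]} (h : ON F P) (ev : ∀ x, tw (-x) = tw x) (xz : (n : ℕ) → Fin n → ℝ) (hy : ∀ n, Function.Injective (xz n))
    (hz : ∀ n k, (P n).eval (xz n k) = 0) : ∃ C : ℝ, ∀ n x, tw x * ∑ k, (ell (xz n) k).eval x ^ 2 / tw (xz n k) ≤ C := by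
  obtain ⟨Ct, hCt, hcomp⟩ := tw_comp hd pos cont outer
  choose Cn hCn using fun n => gr_each hd pos cont outer (hy n) ev
  set n1 := F.n0 + ⌈F.R 20⌉₊ + ⌈F.R d⌉₊ with hn1
  refine ⟨|Ct * F.CT| + ∑ i ∈ Finset.range n1, |Cn i|, fun n x => ?_⟩
  rcases lt_or_ge n n1 with hn | hn
  · have h1 := hCn n x
    have h2 := Finset.single_le_sum (f := fun i => |Cn i|) (fun _ _ => abs_nonneg _) (Finset.mem_range.2 hn)
    have h3 := abs_nonneg (Ct * F.CT)
    have h4 := le_abs_self (Cn n)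
    linarith
  · have hs0 : 0 ≤ ∑ i ∈ Finset.range n1, |Cn i| := Finset.sum_nonneg fun _ _ => abs_nonneg _
    suffices hh : tw x * ∑ k, (ell (xz n) k).eval x ^ 2 / tw (xz n k) ≤ Ct * F.CT by
      linarith [le_abs_self (Ct * F.CT)]
    have hnn : F.n0 ≤ n := by omega
    have hn8 := F.n0_ge
    have hn0 : (0:ℝ) < n := by exact_mod_cast (by omega : 0 < n)
    obtain ⟨a, ha, hRa⟩ := F.exists_a hn0
    have ha20 : 20 ≤ a := by
      apply F.le_of_R_le (by norm_num) ha
      rw [hRa]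
      exact (Nat.le_ceil _).trans (by exact_mod_cast (by omega : ⌈F.R 20⌉₊ ≤ n))
    have had : d ≤ a := by
      apply F.le_of_R_le (by linarith) ha
      rw [hRa]
      exact (Nat.le_ceil _).trans (by exact_mod_cast (by omega : ⌈F.R d⌉₊ ≤ n))
    refine gr_tail hd pos outer (hy n) (X := 12 * a) (by linarith) (fun k => ?_) ?_ ev ?_ x
    · have := h.node_lt hnn ha hRa (hy n) (hz n) k
      linarith
    · have := F.R_lower ha (show a ≤ 12 * a by linarith)
      rw [hRa, show 12 * a / a = 12 by field_simp] at this
      linarith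
    · intro x hx
      have hm := h.mid (hy n) (hz n) hnn ha hRa ha20 hx
      have hqx := F.q_nonneg x
      have hE : 0 < Real.exp (F.Q x) * (1 + F.q x) := by have := Real.exp_pos (F.Q x); positivity
      calc _ = ∑ k, (ell (xz n) k).eval x ^ 2 * (tw x / tw (xz n k)) := by
            rw [Finset.mul_sum]; exact Finset.sum_congr rfl fun k _ => by ring
        _ ≤ ∑ k, Ct / (Real.exp (F.Q x) * (1 + F.q x)) * ((ell (xz n) k).eval x ^ 2 * (Real.exp (F.Q (xz n k)) * (1 + F.q (xz n k)))) := by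
            apply Finset.sum_le_sum
            intro k _
            calc _ ≤ _ := mul_le_mul_of_nonneg_left (hcomp x (xz n k)) (sq_nonneg _)
              _ = _ := by ring
        _ = Ct / (Real.exp (F.Q x) * (1 + F.q x)) * ∑ k, (ell (xz n) k).eval x ^ 2 * (Real.exp (F.Q (xz n k)) * (1 + F.q (xz n k))) := by rw [Finset.mul_sum]
        _ ≤ Ct / (Real.exp (F.Q x) * (1 + F.q x)) * (F.CT * (Real.exp (F.Q x) * (1 + F.q x))) := mul_le_mul_of_nonneg_left hm (by positivity)
        _ = _ := by field_simp
end tw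
end GW
end

open Real Filter Set Finset MeasureTheory

theorem grunwald_operators_uniformly_bounded
    (Q : ℝ → ℝ) (hQeven : ∀ x, Q (-x) = Q x) (hQsmooth : ContDiff ℝ 3 Q)
    (hQ'pos : ∀ x : ℝ, 0 < x → 0 < deriv Q x)
    (A B : ℝ) (hA : 2 ≤ A)
    (hAB : ∀ x : ℝ, 0 < x →
      A ≤ deriv (fun y => y * deriv Q y) x / deriv Q x ∧
      deriv (fun y => y * deriv Q y) x / deriv Q x ≤ B)
    (c : ℝ) (hc : ∀ x : ℝ, 1 ≤ |x| →
      |x * iteratedDeriv 3 Q x / iteratedDeriv 2 Q x| ≤ c)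
    (d : ℝ) (hd1 : 1 ≤ d)
    (hd : ∀ x : ℝ, d ≤ |x| →
      (1 - (B - 1) ^ 2 - c * (B - 1)) / x ^ 2 ≤ iteratedDeriv 2 Q x)
    (tw : ℝ → ℝ) (htw_even : ∀ x, tw (-x) = tw x) (htw_pos : ∀ x, 0 < tw x)
    (htw_smooth : ContDiff ℝ 2 tw)
    (htw_inner : ∀ x : ℝ, |x| ≤ 1 → tw x = Real.exp (-(Q x)))
    (htw_outer : ∀ x : ℝ, d ≤ |x| → tw x = Real.exp (-(Q x)) * |x| / deriv Q |x|)
    (hlog1 : ∀ x : ℝ, 0 < x → 0 < deriv (fun y => Real.log (1 / tw y)) x)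
    (hlog2 : ∀ x : ℝ, 0 < x →
      0 < deriv (deriv (fun y => Real.log (1 / tw y))) x)
    (hlog1c : ContinuousOn (deriv (fun y => Real.log (1 / tw y))) (Set.Ioi 0))
    (hlog2c : ContinuousOn (deriv (deriv (fun y => Real.log (1 / tw y)))) (Set.Ioi 0))
    (P : ℕ → Polynomial ℝ)
    (hdeg : ∀ n, (P n).natDegree = n) (hlead : ∀ n, 0 < (P n).leadingCoeff)
    (horth : ∀ n : ℕ, ∀ q : Polynomial ℝ, q.degree < n →
      ∫ t : ℝ, (P n).eval t * q.eval t * Real.exp (-(Q t)) = 0)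
    (hnorm : ∀ n : ℕ, ∫ t : ℝ, ((P n).eval t) ^ 2 * Real.exp (-(Q t)) = 1)
    (xz : (n : ℕ) → Fin n → ℝ)
    (hxz_mono : ∀ n, StrictMono (xz n))
    (hxz_zero : ∀ n : ℕ, ∀ k : Fin n, (P n).eval (xz n k) = 0) :
    ∃ C : ℝ, ∀ n : ℕ, ∀ x : ℝ,
      tw x * ∑ k : Fin n,
        (∏ j ∈ Finset.univ.erase k, (x - xz n j) / (xz n k - xz n j)) ^ 2 / tw (xz n k)
      ≤ C := by
  have hQd : Differentiable ℝ Q := hQsmooth.differentiable (by norm_num)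
  have hd1' : ∀ x, HasDerivAt Q (deriv Q x) x := fun x => (hQd x).hasDerivAt
  have hid : ∀ m : ℕ, m < 3 → ∀ x, HasDerivAt (iteratedDeriv m Q) (iteratedDeriv (m+1) Q x) x := by
    intro m hm x
    have : Differentiable ℝ (iteratedDeriv m Q) := hQsmooth.differentiable_iteratedDeriv m (by exact_mod_cast hm)
    rw [iteratedDeriv_succ]
    exact (this x).hasDerivAt
  have hd2' : ∀ x, HasDerivAt (deriv Q) (iteratedDeriv 2 Q x) x := by
    intro x
    have := hid 1 (by norm_num) x
    rwa [iteratedDeriv_one] at this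
  have hd3' : ∀ x, HasDerivAt (iteratedDeriv 2 Q) (iteratedDeriv 3 Q x) x := hid 2 (by norm_num)
  have hder : ∀ x, deriv (fun y => y * deriv Q y) x = deriv Q x + x * iteratedDeriv 2 Q x := by
    intro x
    have := (((hasDerivAt_id x).mul (hd2' x)).congr_deriv (g' := deriv Q x + x * iteratedDeriv 2 Q x) (by simp)).deriv
    exact this
  have hlo : ∀ x, 0 < x → deriv Q x ≤ x * iteratedDeriv 2 Q x := by
    intro x hx
    have h1 := (hAB x hx).1
    have hp := hQ'pos x hx
    rw [hder, le_div_iff₀ hp] at h1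
    nlinarith
  set D : ℕ := max ⌈B⌉₊ 2 with hD
  have hhi : ∀ x, 0 < x → x * iteratedDeriv 2 Q x ≤ ((D:ℝ) - 1) * deriv Q x := by
    intro x hx
    have h1 := (hAB x hx).2
    have hp := hQ'pos x hx
    rw [hder, div_le_iff₀ hp] at h1
    have h2 : B ≤ D := (Nat.le_ceil B).trans (by exact_mod_cast le_max_left _ _)
    nlinarith [mul_le_mul_of_nonneg_right h2 hp.le]
  have hc3 : ∀ x, 1 ≤ x → |x * iteratedDeriv 3 Q x| ≤ |c| * iteratedDeriv 2 Q x := by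
    intro x hx
    have hx0 : 0 < x := by linarith
    have h1 := hc x (by rw [abs_of_pos hx0]; exact hx)
    have h2 := hlo x hx0
    have h3 := hQ'pos x hx0
    have h4 : 0 < iteratedDeriv 2 Q x := by
      by_contra hcon
      push Not at hcon
      nlinarith
    rw [abs_div, abs_of_pos h4, div_le_iff₀ h4] at h1
    exact h1.trans (mul_le_mul_of_nonneg_right (le_abs_self c) h4.le)
  let F : GW.Fr := ⟨Q, deriv Q, iteratedDeriv 2 Q, iteratedDeriv 3 Q, D, |c|, le_max_right _ _, abs_nonneg _,
    hQeven, hd1', hd2', hd3', hQ'pos, hlo, hhi, hc3⟩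
  have hON : GW.ON F P := ⟨hdeg, hlead, horth, hnorm⟩
  have hinj : ∀ n, Function.Injective (xz n) := fun n => (hxz_mono n).injective
  obtain ⟨C, hC⟩ := GW.main (F := F) (tw := tw) (d := d) hd1 htw_pos htw_smooth.continuous htw_outer hON htw_even xz hinj hxz_zero
  refine ⟨C, fun n x => ?_⟩
  have := hC n x
  simp only [GW.ON.eval_ell (hinj n)] at this
  exact this
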